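/- arXiv:1504.06652 — 12 statements merged into one kernel-verified Lean document; each statement's English description precedes it below -/
import Mathlib

section
/- Let r1, r2 be rational numbers such that neither r1 - r2 nor r1 + r2 is an integer. Then the three real numbers 1, cos(π·r1), and cos(π·r2) are linearly independent over ℚ if and only if N(r1) ≥ 4, N(r2) ≥ 4, and (N(r1), N(r2)) ≠ (5, 5). -/
open Real

theorem IsPrimitiveRoot.two_mul_re {z : ℂ} {n m : ℕ} (hz : IsPrimitiveRoot z n) (hm : m ≠ 0)
    (h : n ∣ m) : (2 * z.re : ℂ) = z + z ^ (m - 1) := by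
  have hn : n ≠ 0 := fun h0 ↦ hm (by simpa [h0] using h)
  have hpow : z * z ^ (m - 1) = 1 := by
    rw [← pow_succ', Nat.sub_add_cancel (Nat.pos_of_ne_zero hm)]
    exact (hz.pow_eq_one_iff_dvd m).2 h
  rw [eq_inv_of_mul_eq_one_right hpow, Complex.inv_eq_conj (hz.norm'_eq_one hn),
    Complex.add_conj]
  push_cast; rfl

theorem IsPrimitiveRoot.re_eq_iff {z w : ℂ} {n m : ℕ} (hz : IsPrimitiveRoot z n)
    (hw : IsPrimitiveRoot w m) (hn : n ≠ 0) (hm : m ≠ 0) (h : z.re = w.re) :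
    z = w ∨ z * w = 1 := by
  have hz1 : z.re ^ 2 + z.im ^ 2 = 1 := by
    have := Complex.sq_norm_sub_sq_re z
    rw [hz.norm'_eq_one hn] at this
    linarith
  have hw1 : w.re ^ 2 + w.im ^ 2 = 1 := by
    have := Complex.sq_norm_sub_sq_re w
    rw [hw.norm'_eq_one hm] at this
    linarith
  have him : z.im ^ 2 = w.im ^ 2 := by rw [h] at hz1; linarith
  rcases sq_eq_sq_iff_eq_or_eq_neg.1 him with hi | hi
  · exact .inl (Complex.ext h hi)
  · refine .inr (Complex.ext ?_ ?_)
    · simp only [Complex.mul_re, Complex.one_re, h, hi]; linarith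
    · simp only [Complex.mul_im, Complex.one_im, h, hi]; ring

/-- Rational linear relations between `1` and the real parts of two roots of unity are
preserved by the Galois action. -/
theorem IsPrimitiveRoot.re_pow_relation {z w : ℂ} {n m k : ℕ} (hz : IsPrimitiveRoot z n)
    (hw : IsPrimitiveRoot w m) (hn : n ≠ 0) (hm : m ≠ 0) (hk : k.Coprime (n * m)) {p q s : ℚ}
    (h : (p : ℝ) + q * z.re + s * w.re = 0) :
    (p : ℝ) + q * (z ^ k).re + s * (w ^ k).re = 0 := by
  have hM : n * m ≠ 0 := mul_ne_zero hn hm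
  have : NeZero (n * m) := ⟨hM⟩
  have hζ := Complex.isPrimitiveRoot_exp (n * m) hM
  set ζ := Complex.exp (2 * π * Complex.I / (n * m : ℕ))
  obtain ⟨a, -, rfl⟩ := hζ.eq_pow_of_pow_eq_one
    ((hz.pow_eq_one_iff_dvd (n * m)).2 (dvd_mul_right n m))
  obtain ⟨b, -, rfl⟩ := hζ.eq_pow_of_pow_eq_one
    ((hw.pow_eq_one_iff_dvd (n * m)).2 (dvd_mul_left m n))
  let P : Polynomial ℚ := .C (2 * p) + .C q * (.X ^ a + (.X ^ a) ^ (n * m - 1))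
    + .C s * (.X ^ b + (.X ^ b) ^ (n * m - 1))
  have hP (x : ℂ) : Polynomial.aeval x P = 2 * p + q * (x ^ a + (x ^ a) ^ (n * m - 1))
      + s * (x ^ b + (x ^ b) ^ (n * m - 1)) := by
    simp [P]
  have hPζ : Polynomial.aeval ζ P = 0 := by
    rw [hP, ← hz.two_mul_re hM (dvd_mul_right n m), ← hw.two_mul_re hM (dvd_mul_left m n)]
    have := congrArg (fun x : ℝ ↦ (2 * x : ℂ)) h
    push_cast at this
    linear_combination this
  have hζk : Polynomial.aeval (ζ ^ k) P = 0 := by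
    refine Polynomial.aeval_eq_zero_of_dvd_aeval_eq_zero (p := minpoly ℚ ζ)
      (minpoly.dvd ℚ ζ hPζ) ?_
    rw [← Polynomial.cyclotomic_eq_minpoly_rat hζ (Nat.pos_of_ne_zero hM),
      Polynomial.cyclotomic_eq_minpoly_rat (hζ.pow_of_coprime k hk) (Nat.pos_of_ne_zero hM)]
    exact minpoly.aeval ..
  rw [hP, pow_right_comm, pow_right_comm ζ k b,
    ← (hz.pow_of_coprime k hk.coprime_mul_right_right).two_mul_re hM (dvd_mul_right n m),
    ← (hw.pow_of_coprime k hk.coprime_mul_left_right).two_mul_re hM (dvd_mul_left m n)] at hζk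
  have h2 : ((2 * (p + q * ((ζ ^ a) ^ k).re + s * ((ζ ^ b) ^ k).re) : ℝ) : ℂ) = 0 := by
    push_cast
    linear_combination hζk
  have := Complex.ofReal_eq_zero.1 h2
  linarith

theorem sum_primitiveRoots_eq_moebius {n : ℕ} (hn : 0 < n) :
    ∑ z ∈ primitiveRoots n ℂ, z = (ArithmeticFunction.moebius n : ℂ) := by
  classical
  have key := (ArithmeticFunction.sum_eq_iff_sum_mul_moebius_eq
    (f := fun n ↦ ∑ z ∈ primitiveRoots n ℂ, z) (g := fun n ↦ if n = 1 then (1 : ℂ) else 0)).1 ?_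
    n hn
  · rw [← key, Finset.sum_eq_single (n, 1)]
    · simp
    · rintro ⟨a, b⟩ hab hne
      have hb : b ≠ 1 := by
        rintro rfl
        simp at hab
        exact hne (by simp [hab])
      simp [hb]
    · simp [hn.ne']
  · intro m hm
    rw [← Finset.sum_biUnion (fun i _ j _ hij ↦ IsPrimitiveRoot.disjoint hij),
      ← IsPrimitiveRoot.nthRoots_one_eq_biUnion_primitiveRoots]
    have hζ := Complex.isPrimitiveRoot_exp m hm.ne'
    set ζ := Complex.exp (2 * π * Complex.I / m)
    split_ifs with h1
    · subst h1; simp [IsPrimitiveRoot.nthRoots_one_eq_biUnion_primitiveRoots]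
    · rw [← hζ.geom_sum_eq_zero (by omega)]
      symm
      refine Finset.sum_bij (fun i _ ↦ ζ ^ i) ?_ ?_ ?_ ?_
      · intro i _
        rw [Polynomial.mem_nthRootsFinset hm, pow_right_comm, hζ.pow_eq_one, one_pow]
      · intro i hi j hj h
        exact hζ.pow_inj (Finset.mem_range.1 hi) (Finset.mem_range.1 hj) h
      · intro w hw
        have : NeZero m := ⟨hm.ne'⟩
        rw [Polynomial.mem_nthRootsFinset hm] at hw
        obtain ⟨i, hi, h⟩ := hζ.eq_pow_of_pow_eq_one hw
        exact ⟨i, Finset.mem_range.2 hi, h⟩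
      · simp

theorem sum_re_primitiveRoots {n : ℕ} (hn : 0 < n) :
    ∑ z ∈ primitiveRoots n ℂ, z.re = (ArithmeticFunction.moebius n : ℝ) := by
  have := congrArg Complex.re (sum_primitiveRoots_eq_moebius hn)
  simpa using this

theorem IsPrimitiveRoot.re_rat_of_forall_pow {z : ℂ} {n : ℕ} (hz : IsPrimitiveRoot z n)
    (hn : 0 < n) (h : ∀ k : ℕ, k.Coprime n → (z ^ k).re = z.re) : ∃ r : ℚ, z.re = r := by
  have hs := sum_re_primitiveRoots hn
  rw [Finset.sum_congr rfl (g := fun _ ↦ z.re), Finset.sum_const, hz.card_primitiveRoots,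
    nsmul_eq_mul] at hs
  · have : (n.totient : ℝ) ≠ 0 := by exact_mod_cast (Nat.totient_pos.2 hn).ne'
    exact ⟨(ArithmeticFunction.moebius n : ℚ) / n.totient, by push_cast; field_simp; linarith⟩
  · intro w hw
    have : NeZero n := ⟨hn.ne'⟩
    obtain ⟨k, -, hk, rfl⟩ := hz.isPrimitiveRoot_iff.1 ((mem_primitiveRoots hn).1 hw)
    exact h k hk

theorem Nat.eq_of_dvd_of_totient_le {g n : ℕ} (hn : 0 < n) (hn4 : n % 4 ≠ 2) (hg : g ∣ n)
    (h : n.totient ≤ g.totient) : n = g := by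
  obtain ⟨t, rfl⟩ := hg
  have hg0 : 0 < g := Nat.pos_of_mul_pos_right hn
  have ht0 : 0 < t := Nat.pos_of_mul_pos_left hn
  have h1 := Nat.totient_super_multiplicative g t
  have hgp := Nat.totient_pos.2 hg0
  have htp := Nat.totient_pos.2 ht0
  have ht : t.totient = 1 := by nlinarith
  rcases Nat.totient_eq_one_iff.1 ht with rfl | rfl
  · simp
  · by_cases h2 : 2 ∣ g
    · have := Nat.totient_mul_of_prime_of_dvd Nat.prime_two h2
      rw [mul_comm] at this
      omega
    · omega

/-- Two linearly related real parts of roots of unity have comparable orders. -/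
theorem IsPrimitiveRoot.dvd_of_re_relation {z w : ℂ} {n m : ℕ} (hz : IsPrimitiveRoot z n)
    (hw : IsPrimitiveRoot w m) (hn : 0 < n) (hm : 0 < m) (hm4 : m % 4 ≠ 2) {p q s : ℚ}
    (hs : s ≠ 0) (h : (p : ℝ) + q * z.re + s * w.re = 0) (hirr : ¬ ∃ r : ℚ, w.re = r) :
    m ∣ n := by
  have hre (u : ℕ) (hu : u.Coprime m) (hug : u ≡ 1 [MOD n.gcd m]) : (w ^ u).re = w.re := by
    let k := Nat.chineseRemainder' hug.symm
    have hkn : (k : ℕ).Coprime n := by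
      rw [Nat.Coprime, Nat.ModEq.gcd_eq k.2.1]; simp
    have hkm : (k : ℕ).Coprime m := by
      rw [Nat.Coprime, Nat.ModEq.gcd_eq k.2.2]; exact hu
    have h1 := hz.re_pow_relation hw hn.ne' hm.ne' (hkn.mul_right hkm) h
    rw [← pow_mod_orderOf z, ← pow_mod_orderOf w, ← hz.eq_orderOf, ← hw.eq_orderOf, k.2.1,
      k.2.2, hz.eq_orderOf, hw.eq_orderOf, pow_mod_orderOf, pow_mod_orderOf, pow_one] at h1
    have hsR : (s : ℝ) ≠ 0 := by exact_mod_cast hs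
    exact mul_left_cancel₀ hsR (by linarith)
  have huniq (u : ℕ) (hu : u.Coprime m) (hug : u ≡ 1 [MOD n.gcd m]) : u ≡ 1 [MOD m] := by
    rcases (hw.pow_of_coprime u hu).re_eq_iff hw hm.ne' hm.ne' (hre u hu hug) with h1 | h1
    · refine hw.pow_inj (Nat.mod_lt _ hm) (Nat.mod_lt _ hm) ?_
      rw [hw.eq_orderOf, pow_mod_orderOf, pow_mod_orderOf, h1, pow_one]
    · exfalso
      rw [← pow_succ, hw.pow_eq_one_iff_dvd] at h1
      have h2 : n.gcd m ∣ 2 := by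
        have h3 : u + 1 ≡ 1 + 1 [MOD n.gcd m] := hug.add_right 1
        exact (h3.dvd_iff dvd_rfl).1 ((Nat.gcd_dvd_right n m).trans h1)
      refine hirr (hw.re_rat_of_forall_pow hm fun k hk ↦ hre k hk ?_)
      rcases (Nat.dvd_prime Nat.prime_two).1 h2 with hg | hg
      · rw [hg]; exact Nat.modEq_one
      · have : 2 ∣ m := hg ▸ Nat.gcd_dvd_right n m
        have : k.Coprime 2 := hk.coprime_dvd_right this
        rw [hg]
        exact Nat.odd_iff.1 (Nat.coprime_two_right.1 this)
  have hgm := Nat.gcd_dvd_right n m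
  have : NeZero m := ⟨hm.ne'⟩
  have : NeZero (n.gcd m) := ⟨(Nat.gcd_pos_of_pos_left m hn).ne'⟩
  have hinj : Function.Injective (ZMod.unitsMap hgm) := by
    rw [injective_iff_map_eq_one]
    intro u hu
    have h1 : ((u : ZMod m).val : ZMod (n.gcd m)) = (1 : ℕ) := by
      rw [ZMod.natCast_val, Nat.cast_one]
      exact congrArg Units.val hu
    have h2 := (ZMod.natCast_eq_natCast_iff _ _ _).2
      (huniq _ (ZMod.val_coe_unit_coprime u) ((ZMod.natCast_eq_natCast_iff _ _ _).1 h1))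
    ext
    rw [ZMod.natCast_zmod_val] at h2
    simpa only [Nat.cast_one, Units.val_one] using h2
  have hcard := Fintype.card_le_of_injective _ hinj
  rw [ZMod.card_units_eq_totient, ZMod.card_units_eq_totient] at hcard
  rw [Nat.eq_of_dvd_of_totient_le hm hm4 hgm hcard]
  exact Nat.gcd_dvd_left n m

theorem Nat.eq_of_totient_dvd_four {n : ℕ} (hsq : Squarefree n) (hn4 : n % 4 ≠ 2)
    (h : n.totient ∣ 4) : n = 1 ∨ n = 3 ∨ n = 5 := by
  have hdvd : n ∣ 30 := by
    rw [← Nat.prod_primeFactors_of_squarefree hsq]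
    refine (Finset.prod_dvd_prod_of_subset _ {2, 3, 5} _ fun p hp ↦ ?_).trans (by decide)
    have hpp := Nat.prime_of_mem_primeFactors hp
    have hp4 : p - 1 ∣ 4 := by
      rw [← Nat.totient_prime hpp]
      exact (Nat.totient_dvd_of_dvd (Nat.dvd_of_mem_primeFactors hp)).trans h
    have hle : p ≤ 5 := by have := Nat.le_of_dvd (by norm_num) hp4; omega
    have := hpp.two_le
    interval_cases p <;> simp_all
  have hle := Nat.le_of_dvd (by norm_num) hdvd
  have hmem : n ∈ Nat.divisors 30 := by simpa using hdvd
  have hdiv : Nat.divisors 30 = {1, 2, 3, 5, 6, 10, 15, 30} := by rfl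
  rw [hdiv] at hmem
  simp only [Finset.mem_insert, Finset.mem_singleton] at hmem
  rcases hmem with rfl | rfl | rfl | rfl | rfl | rfl | rfl | rfl <;> revert h hn4 <;> decide

theorem IsPrimitiveRoot.order_eq_five_of_re_relation {z w : ℂ} {n m : ℕ}
    (hz : IsPrimitiveRoot z n) (hw : IsPrimitiveRoot w m) (hn : 0 < n) (hm : 0 < m)
    (hn4 : n % 4 ≠ 2) (hm4 : m % 4 ≠ 2) {p q s : ℚ} (hq : q ≠ 0) (hs : s ≠ 0)
    (h : (p : ℝ) + q * z.re + s * w.re = 0) (hzirr : ¬ ∃ r : ℚ, z.re = r)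
    (hwirr : ¬ ∃ r : ℚ, w.re = r) (hne : z.re ≠ w.re) (hne' : z.re ≠ -w.re) :
    n = 5 ∧ m = 5 := by
  obtain rfl : n = m := Nat.dvd_antisymm
    (hw.dvd_of_re_relation (p := p) (q := s) hz hm hn hn4 hq (by linarith) hzirr)
    (hz.dvd_of_re_relation hw hn hm hm4 hs h hwirr)
  have : NeZero n := ⟨hn.ne'⟩
  obtain ⟨j, hjn, hj, rfl⟩ := hz.isPrimitiveRoot_iff.1 hw
  have hrel : ∀ x ∈ primitiveRoots n ℂ, (p : ℝ) + q * x.re + s * (x ^ j).re = 0 := by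
    intro x hx
    obtain ⟨k, -, hk, rfl⟩ := hz.isPrimitiveRoot_iff.1 ((mem_primitiveRoots hn).1 hx)
    rw [pow_right_comm]
    exact hz.re_pow_relation hw hn.ne' hn.ne' (hk.mul_right hk) h
  obtain ⟨i, -, hi⟩ := Nat.exists_mul_mod_eq_of_coprime 1 hj hn.ne'
  replace hi : j * i ≡ 1 [MOD n] := hi
  have hperm (F : ℂ → ℝ) : ∑ x ∈ primitiveRoots n ℂ, F (x ^ j) =
      ∑ x ∈ primitiveRoots n ℂ, F x := by
    have hcancel : ∀ x ∈ primitiveRoots n ℂ, x ^ (j * i) = x := by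
      intro x hx
      have hx := (mem_primitiveRoots hn).1 hx
      rw [← pow_mod_orderOf, ← hx.eq_orderOf, hi, hx.eq_orderOf, pow_mod_orderOf, pow_one]
    have hi' : i.Coprime n := by
      have : (j * i).Coprime n := by rw [Nat.Coprime, hi.gcd_eq]; simp
      exact this.coprime_mul_left
    refine Finset.sum_bij' (fun x _ ↦ x ^ j) (fun x _ ↦ x ^ i) ?_ ?_ ?_ ?_ ?_
    · intro x hx
      exact (mem_primitiveRoots hn).2 (((mem_primitiveRoots hn).1 hx).pow_of_coprime j hj)
    · intro x hx
      exact (mem_primitiveRoots hn).2 (((mem_primitiveRoots hn).1 hx).pow_of_coprime i hi')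
    · intro x hx
      rw [← pow_mul, hcancel x hx]
    · intro x hx
      rw [← pow_mul, mul_comm, hcancel x hx]
    · simp
  have hφ : (n.totient : ℝ) ≠ 0 := by exact_mod_cast (Nat.totient_pos.2 hn).ne'
  have hmean := sum_re_primitiveRoots hn
  set M : ℚ := (ArithmeticFunction.moebius n : ℚ) / n.totient with hM
  have hMφ : (M : ℝ) * n.totient = ArithmeticFunction.moebius n := by
    rw [hM]; push_cast; field_simp
  have hpM : (p : ℝ) + (q + s) * M = 0 := by
    have h0 := Finset.sum_eq_zero hrel
    rw [Finset.sum_add_distrib, Finset.sum_add_distrib, ← Finset.mul_sum, ← Finset.mul_sum,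
      hperm Complex.re, hmean, Finset.sum_const, hz.card_primitiveRoots, nsmul_eq_mul,
      ← hMφ] at h0
    exact mul_right_cancel₀ hφ (by linarith)
  have hsq : (q : ℝ) ^ 2 = s ^ 2 := by
    have hV : ∑ x ∈ primitiveRoots n ℂ, (q : ℝ) ^ 2 * (x.re - M) ^ 2
        = ∑ x ∈ primitiveRoots n ℂ, (s : ℝ) ^ 2 * (x.re - M) ^ 2 := by
      rw [← hperm fun x ↦ (s : ℝ) ^ 2 * (x.re - M) ^ 2]
      refine Finset.sum_congr rfl fun x hx ↦ ?_
      have : (q : ℝ) * (x.re - M) = -(s * ((x ^ j).re - M)) := by linarith [hrel x hx]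
      rw [← mul_pow, this, neg_sq, mul_pow]
    rw [← Finset.mul_sum, ← Finset.mul_sum] at hV
    refine mul_right_cancel₀ (ne_of_gt ?_) hV
    refine Finset.sum_pos' (fun _ _ ↦ sq_nonneg _) ⟨z, (mem_primitiveRoots hn).2 hz, ?_⟩
    exact sq_pos_of_ne_zero (sub_ne_zero.2 fun h ↦ hzirr ⟨M, h⟩)
  have hqR : (q : ℝ) ≠ 0 := by exact_mod_cast hq
  rcases sq_eq_sq_iff_eq_or_eq_neg.1 hsq with hqs | hqs
  swap
  · refine absurd (mul_left_cancel₀ hqR ?_) hne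
    rw [show (s : ℝ) = -q by linarith] at h hpM
    linarith
  have hsum : z.re + (z ^ j).re = 2 * M := by
    rw [← hqs] at h hpM
    exact mul_left_cancel₀ hqR (by linarith)
  have hint : ∃ k : ℤ, (2 * z.re + 2 * (z ^ j).re : ℂ) = k := by
    rw [← IsIntegral.exists_int_iff_exists_rat]
    · refine ⟨4 * M, ?_⟩
      have := congrArg (fun x : ℝ ↦ (2 * x : ℂ)) hsum
      push_cast at this ⊢
      linear_combination this
    · rw [hz.two_mul_re hn.ne' dvd_rfl, hw.two_mul_re hn.ne' dvd_rfl]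
      exact ((hz.isIntegral hn).add ((hz.isIntegral hn).pow _)).add
        ((hw.isIntegral hn).add ((hw.isIntegral hn).pow _))
  obtain ⟨k, hk⟩ := hint
  have hk' : 2 * z.re + 2 * (z ^ j).re = k := by exact_mod_cast hk
  have hkμ : k * n.totient = 4 * ArithmeticFunction.moebius n := by
    have : (k : ℝ) * n.totient = 4 * ArithmeticFunction.moebius n := by
      rw [← hMφ, ← hk']; linear_combination 2 * (n.totient : ℝ) * hsum
    exact_mod_cast this
  have hμ : ArithmeticFunction.moebius n ≠ 0 := by
    intro h0
    rw [h0, Int.cast_zero, zero_div] at hM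
    rw [hM] at hsum
    refine hne' ?_
    push_cast at hsum
    linarith
  have hdvd : n.totient ∣ 4 := by
    rw [← Int.natCast_dvd_natCast]
    rcases ArithmeticFunction.moebius_ne_zero_iff_eq_or.1 hμ with h1 | h1 <;> rw [h1] at hkμ
    · exact ⟨k, by push_cast; linarith⟩
    · exact ⟨-k, by push_cast; linarith⟩
  rcases Nat.eq_of_totient_dvd_four
    (ArithmeticFunction.moebius_ne_zero_iff_squarefree.1 hμ) hn4 hdvd with rfl | rfl | rfl
  · refine absurd ?_ hne
    rw [IsPrimitiveRoot.one_right_iff.1 hz, one_pow]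
  · refine absurd ?_ hne
    have h3 := hz.pow_eq_one
    have e1 := hz.two_mul_re three_ne_zero dvd_rfl
    have e2 := hw.two_mul_re three_ne_zero dvd_rfl
    have : j = 1 ∨ j = 2 := by interval_cases j <;> simp_all
    rcases this with rfl | rfl
    · simp
    · have : ((z.re : ℝ) : ℂ) = ((z ^ 2).re : ℝ) := by
        norm_num at e1 e2
        linear_combination (e1 - e2 - z * h3) / 2
      exact_mod_cast this
  · exact ⟨rfl, rfl⟩

theorem Rat.den_dvd_of_mul_eq_int {r : ℚ} {d : ℕ} {k : ℤ} (h : r * d = k) (hd : d ≠ 0) :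
    r.den ∣ d := by
  have hr : r = Rat.divInt k d := by
    rw [Rat.divInt_eq_div, ← h]
    have : (d : ℚ) ≠ 0 := by exact_mod_cast hd
    push_cast
    field_simp
  have := Rat.den_dvd k d
  rw [← hr] at this
  exact_mod_cast this

theorem Rat.exists_primitiveRoot_cos (r : ℚ) : ∃ (n : ℕ) (z : ℂ) (ε : ℚ), IsPrimitiveRoot z n ∧
    0 < n ∧ n % 4 ≠ 2 ∧ (ε = 1 ∨ ε = -1) ∧ Real.cos (π * r) = ε * z.re ∧ (n = 5 → r.den = 5) := by
  have hre (x : ℚ) : (Complex.exp (π * Complex.I * x)).re = Real.cos (π * x) := by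
    rw [show (π * Complex.I * x : ℂ) = ((π * x : ℝ) : ℂ) * Complex.I by push_cast; ring,
      Complex.exp_ofReal_mul_I_re]
  have hred (x : ℚ) : ¬ (Even x.num ∧ Even x.den) := by
    rintro ⟨h1, h2⟩
    have := Nat.dvd_gcd (Int.natCast_dvd.1 h1.two_dvd) h2.two_dvd
    rw [Nat.Coprime.gcd_eq_one x.reduced] at this
    exact absurd this (by decide)
  rcases Int.even_or_odd r.num with h | h
  · refine ⟨r.den, _, 1, Complex.isPrimitiveRoot_exp_rat_of_even_num r h, r.den_pos, ?_,
      .inl rfl, by rw [hre]; simp, id⟩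
    intro h4
    exact hred r ⟨h, Nat.even_iff.2 (by omega)⟩
  rcases Nat.even_or_odd r.den with hd | hd
  · refine ⟨2 * r.den, _, 1, Complex.isPrimitiveRoot_exp_rat_of_odd_num r h,
      by have := r.den_pos; omega, by obtain ⟨m, hm⟩ := hd; omega, .inl rfl, by rw [hre]; simp,
      by omega⟩
  · have hden : (r + 1).den = r.den := by exact_mod_cast Rat.add_natCast_den r 1
    have hev : Even (r + 1).num := by
      by_contra hodd
      have hnum : (r + 1).num = r.num + r.den := by
        have h1 := Rat.num_div_den (r + 1)
        have h2 := Rat.num_div_den r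
        rw [hden] at h1
        have hd0 : (r.den : ℚ) ≠ 0 := by exact_mod_cast r.den_nz
        rw [div_eq_iff hd0] at h1 h2
        have : ((r + 1).num : ℚ) = r.num + r.den := by linarith
        exact_mod_cast this
      rw [hnum] at hodd
      exact hodd (h.add_odd (by exact_mod_cast hd))
    refine ⟨(r + 1).den, _, -1, Complex.isPrimitiveRoot_exp_rat_of_even_num (r + 1) hev,
      (r + 1).den_pos, ?_, .inr rfl, ?_, by rw [hden]; exact id⟩
    · rw [hden]; obtain ⟨m, hm⟩ := hd; omega
    · rw [hre]
      push_cast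
      rw [mul_add, mul_one, Real.cos_add_pi]
      ring

theorem Rat.den_le_three_of_cos_rat {r : ℚ} (h : ∃ c : ℚ, Real.cos (π * r) = c) : r.den ≤ 3 := by
  have key (t : ℚ) (d : ℕ) (k : ℤ) (hd : d ≠ 0) (hd3 : d ≤ 3) (ht : t * d = k)
      (hc : Real.cos (π * r) = Real.cos (π * t)) : r.den ≤ 3 := by
    obtain ⟨l, hl⟩ := Real.cos_eq_cos_iff.1 hc.symm
    have hπ := Real.pi_ne_zero
    refine (Nat.le_of_dvd (Nat.pos_of_ne_zero hd) ?_).trans hd3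
    rcases hl with hl | hl
    · have h1 : (r : ℝ) = 2 * l + t := mul_left_cancel₀ hπ (by linarith)
      have h2 : r = 2 * l + t := by exact_mod_cast h1
      exact den_dvd_of_mul_eq_int (k := 2 * l * d + k)
        (by rw [h2]; push_cast; linarith) hd
    · have h1 : (r : ℝ) = 2 * l - t := mul_left_cancel₀ hπ (by linarith)
      have h2 : r = 2 * l - t := by exact_mod_cast h1
      exact den_dvd_of_mul_eq_int (k := 2 * l * d - k)
        (by rw [h2]; push_cast; linarith) hd
  have hn := niven ⟨r, mul_comm _ _⟩ h
  simp only [Set.mem_insert_iff, Set.mem_singleton_iff] at hn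
  rcases hn with hn | hn | hn | hn | hn
  · refine key 1 1 1 (by norm_num) (by norm_num) (by norm_num) ?_
    rw [hn]; simp
  · refine key (2 / 3) 3 2 (by norm_num) (by norm_num) (by norm_num) ?_
    rw [hn]; push_cast
    rw [show π * (2 / 3) = π - π / 3 by ring, Real.cos_pi_sub, Real.cos_pi_div_three]; norm_num
  · refine key (1 / 2) 2 1 (by norm_num) (by norm_num) (by norm_num) ?_
    rw [hn]; push_cast
    rw [show π * (1 / 2) = π / 2 by ring, Real.cos_pi_div_two]
  · refine key (1 / 3) 3 1 (by norm_num) (by norm_num) (by norm_num) ?_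
    rw [hn]; push_cast
    rw [show π * (1 / 3) = π / 3 by ring, Real.cos_pi_div_three]
  · refine key 0 1 0 (by norm_num) (by norm_num) (by norm_num) ?_
    rw [hn]; simp

theorem Rat.cos_pi_mul_den (r : ℚ) :
    Real.cos (r.den * (π * r)) = 1 ∨ Real.cos (r.den * (π * r)) = -1 := by
  have h : (r.den * (π * r) : ℝ) = r.num * π := by
    have : (r * r.den : ℝ) = r.num := by exact_mod_cast Rat.mul_den_eq_num r
    rw [← this]; ring
  rw [h, Real.cos_int_mul_pi]
  rcases Int.even_or_odd r.num with h | h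
  · exact .inl h.neg_one_zpow
  · exact .inr h.neg_one_zpow

theorem Rat.cos_rat_of_den_lt_four {r : ℚ} (h : r.den < 4) : ∃ c : ℚ, Real.cos (π * r) = c := by
  have h0 := r.den_pos
  have hr := r.cos_pi_mul_den
  set x := π * (r : ℝ)
  obtain h1 | h1 | h1 : r.den = 1 ∨ r.den = 2 ∨ r.den = 3 := by omega
  all_goals rw [h1] at hr; push_cast at hr
  · rw [one_mul] at hr
    rcases hr with h | h
    · exact ⟨1, by simpa using h⟩
    · exact ⟨-1, by simpa using h⟩
  · rw [Real.cos_two_mul] at hr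
    rcases hr with h | h
    · have : (Real.cos x - 1) * (Real.cos x + 1) = 0 := by linarith
      rcases mul_eq_zero.1 this with h | h
      · exact ⟨1, by push_cast; linarith⟩
      · exact ⟨-1, by push_cast; linarith⟩
    · have : Real.cos x ^ 2 = 0 := by linarith
      exact ⟨0, by simpa using this⟩
  · rw [Real.cos_three_mul] at hr
    rcases hr with h | h
    · have : (Real.cos x - 1) * (2 * Real.cos x + 1) ^ 2 = 0 := by linarith
      rcases mul_eq_zero.1 this with h | h
      · exact ⟨1, by push_cast; linarith⟩
      · exact ⟨-1 / 2, by push_cast; linarith [pow_eq_zero_iff two_ne_zero |>.1 h]⟩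
    · have : (Real.cos x + 1) * (2 * Real.cos x - 1) ^ 2 = 0 := by linarith
      rcases mul_eq_zero.1 this with h | h
      · exact ⟨-1, by push_cast; linarith⟩
      · exact ⟨1 / 2, by push_cast; linarith [pow_eq_zero_iff two_ne_zero |>.1 h]⟩

theorem Real.cos_five_mul (x : ℝ) :
    cos (5 * x) = 16 * cos x ^ 5 - 20 * cos x ^ 3 + 5 * cos x := by
  rw [show 5 * x = 2 * x + 3 * x by ring, cos_add, cos_two_mul, cos_three_mul, sin_two_mul,
    sin_three_mul]
  have hs : sin x ^ 2 = 1 - cos x ^ 2 := by rw [sin_sq]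
  linear_combination (-2 * cos x * (3 - 4 * (sin x ^ 2 + 1 - cos x ^ 2))) * hs

theorem Rat.cos_of_den_eq_five {r : ℚ} (h : r.den = 5) :
    ∃ a b : ℚ, Real.cos (π * r) = a + b * √5 := by
  have hr := r.cos_pi_mul_den
  rw [h] at hr
  push_cast at hr
  rw [Real.cos_five_mul] at hr
  set c := Real.cos (π * (r : ℝ))
  have h5 : (√5) ^ 2 = 5 := Real.sq_sqrt (by norm_num)
  rcases hr with h | h
  · have : (c - 1) * ((4 * c + 1 - √5) * (4 * c + 1 + √5)) ^ 2 = 0 := by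
      rw [show (4 * c + 1 - √5) * (4 * c + 1 + √5) = (4 * c + 1) ^ 2 - √5 ^ 2 by ring, h5]
      linear_combination 16 * h
    rcases mul_eq_zero.1 this with h | h
    · exact ⟨1, 0, by push_cast; linarith⟩
    rcases mul_eq_zero.1 (pow_eq_zero_iff two_ne_zero |>.1 h) with h | h
    · exact ⟨-1 / 4, 1 / 4, by push_cast; linarith⟩
    · exact ⟨-1 / 4, -1 / 4, by push_cast; linarith⟩
  · have : (c + 1) * ((4 * c - 1 - √5) * (4 * c - 1 + √5)) ^ 2 = 0 := by
      rw [show (4 * c - 1 - √5) * (4 * c - 1 + √5) = (4 * c - 1) ^ 2 - √5 ^ 2 by ring, h5]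
      linear_combination 16 * h
    rcases mul_eq_zero.1 this with h | h
    · exact ⟨-1, 0, by push_cast; linarith⟩
    rcases mul_eq_zero.1 (pow_eq_zero_iff two_ne_zero |>.1 h) with h | h
    · exact ⟨1 / 4, 1 / 4, by push_cast; linarith⟩
    · exact ⟨1 / 4, -1 / 4, by push_cast; linarith⟩

theorem Real.linearIndependent_one_pair_iff {x y : ℝ} :
    LinearIndependent ℚ ![(1 : ℝ), x, y] ↔
      ∀ p q s : ℚ, (p : ℝ) + q * x + s * y = 0 → p = 0 ∧ q = 0 ∧ s = 0 := by
  rw [Fintype.linearIndependent_iff]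
  constructor
  · intro h p q s hpqs
    have := h ![p, q, s] (by simpa [Fin.sum_univ_three, Rat.smul_def] using hpqs)
    exact ⟨this 0, this 1, this 2⟩
  · intro h g hg
    obtain ⟨h0, h1, h2⟩ := h (g 0) (g 1) (g 2)
      (by simpa [Fin.sum_univ_three, Rat.smul_def] using hg)
    intro i
    fin_cases i <;> assumption

theorem Rat.exists_int_of_cos_eq_or_neg {r s : ℚ}
    (h : Real.cos (π * r) = Real.cos (π * s) ∨ Real.cos (π * r) = -Real.cos (π * s)) :
    (∃ k : ℤ, r - s = k) ∨ ∃ k : ℤ, r + s = k := by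
  have hπ := Real.pi_ne_zero
  rcases h with h | h
  · obtain ⟨k, hk | hk⟩ := Real.cos_eq_cos_iff.1 h.symm
    · have h1 : (r : ℝ) - s = (2 * k : ℤ) := mul_left_cancel₀ hπ (by push_cast; linarith)
      exact .inl ⟨2 * k, by exact_mod_cast h1⟩
    · have h1 : (r : ℝ) + s = (2 * k : ℤ) := mul_left_cancel₀ hπ (by push_cast; linarith)
      exact .inr ⟨2 * k, by exact_mod_cast h1⟩
  · rw [← Real.cos_pi_sub] at h
    obtain ⟨k, hk | hk⟩ := Real.cos_eq_cos_iff.1 h.symm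
    · have h1 : (r : ℝ) + s = (2 * k + 1 : ℤ) := mul_left_cancel₀ hπ (by push_cast; linarith)
      exact .inr ⟨2 * k + 1, by exact_mod_cast h1⟩
    · have h1 : (r : ℝ) - s = (2 * k - 1 : ℤ) := mul_left_cancel₀ hπ (by push_cast; linarith)
      exact .inl ⟨2 * k - 1, by exact_mod_cast h1⟩

theorem cos_linear_independence_two (r1 r2 : ℚ)
    (h1 : ¬ ∃ k : ℤ, r1 - r2 = (k : ℚ)) (h2 : ¬ ∃ k : ℤ, r1 + r2 = (k : ℚ)) :
    LinearIndependent ℚ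
      ![(1 : ℝ), Real.cos (Real.pi * (r1 : ℝ)), Real.cos (Real.pi * (r2 : ℝ))] ↔
    (4 ≤ r1.den ∧ 4 ≤ r2.den ∧ (r1.den, r2.den) ≠ (5, 5)) := by
  rw [Real.linearIndependent_one_pair_iff]
  constructor
  · intro h
    refine ⟨?_, ?_, ?_⟩
    · by_contra hd
      obtain ⟨c, hc⟩ := Rat.cos_rat_of_den_lt_four (not_le.1 hd)
      have := h (-c) 1 0 (by rw [hc]; push_cast; ring)
      simp at this
    · by_contra hd
      obtain ⟨c, hc⟩ := Rat.cos_rat_of_den_lt_four (not_le.1 hd)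
      have := h (-c) 0 1 (by rw [hc]; push_cast; ring)
      simp at this
    · intro hd
      obtain ⟨hd1, hd2⟩ := Prod.mk.inj hd
      obtain ⟨a, b, hab⟩ := Rat.cos_of_den_eq_five hd1
      obtain ⟨a', b', hab'⟩ := Rat.cos_of_den_eq_five hd2
      obtain ⟨-, -, hb⟩ := h (b * a' - b' * a) b' (-b) (by rw [hab, hab']; push_cast; ring)
      have := h (-a) 1 0 (by rw [hab, neg_eq_zero.1 hb]; push_cast; ring)
      simp at this
  · rintro ⟨hd1, hd2, hd⟩ p q s hrel
    have hirr1 : ¬ ∃ c : ℚ, Real.cos (π * r1) = c := fun h ↦ by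
      have := Rat.den_le_three_of_cos_rat h; omega
    have hirr2 : ¬ ∃ c : ℚ, Real.cos (π * r2) = c := fun h ↦ by
      have := Rat.den_le_three_of_cos_rat h; omega
    by_cases hq : q = 0
    · by_cases hs : s = 0
      · subst hq hs
        exact ⟨by simpa using hrel, rfl, rfl⟩
      · refine absurd ⟨-p / s, ?_⟩ hirr2
        have hsR : (s : ℝ) ≠ 0 := by exact_mod_cast hs
        subst hq
        push_cast at hrel ⊢
        field_simp
        linarith
    by_cases hs : s = 0
    · refine absurd ⟨-p / q, ?_⟩ hirr1
      have hqR : (q : ℝ) ≠ 0 := by exact_mod_cast hq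
      subst hs
      push_cast at hrel ⊢
      field_simp
      linarith
    exfalso
    have hcos := mt Rat.exists_int_of_cos_eq_or_neg (not_or.2 ⟨h1, h2⟩)
    obtain ⟨n, z, ε, hz, hn, hn4, hε, hzc, hn5⟩ := r1.exists_primitiveRoot_cos
    obtain ⟨m, w, δ, hw, hm, hm4, hδ, hwc, hm5⟩ := r2.exists_primitiveRoot_cos
    rw [hzc, hwc] at hcos hrel
    rw [hzc] at hirr1
    rw [hwc] at hirr2
    have hε0 : ε ≠ 0 := by rcases hε with rfl | rfl <;> norm_num
    have hδ0 : δ ≠ 0 := by rcases hδ with rfl | rfl <;> norm_num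
    obtain ⟨hn', hm'⟩ := hz.order_eq_five_of_re_relation hw hn hm hn4 hm4 (p := p)
      (mul_ne_zero hq hε0) (mul_ne_zero hs hδ0) (by push_cast; linarith)
      (fun ⟨c, hc⟩ ↦ hirr1 ⟨ε * c, by rw [hc]; push_cast; rfl⟩)
      (fun ⟨c, hc⟩ ↦ hirr2 ⟨δ * c, by rw [hc]; push_cast; rfl⟩)
      (fun he ↦ hcos <| by rcases hε with rfl | rfl <;> rcases hδ with rfl | rfl <;> simp [he])
      (fun he ↦ hcos <| by rcases hε with rfl | rfl <;> rcases hδ with rfl | rfl <;> simp [he])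
    exact hd (by rw [hn5 hn', hm5 hm'])
end

section
/- Let r1, r2 be rational numbers such that neither r1 - r2 nor r1 + r2 is an integer, and let d ≥ 2 be a squarefree integer with gcd(d, N(r1)) = 1 and gcd(d, N(r2)) = 1. Then the three real numbers 1, cos(π·r1), and cos(π·r2) are linearly independent over the real quadratic field ℚ(√d) if and only if N(r1) ≥ 4, N(r2) ≥ 4, and (N(r1), N(r2)) ≠ (5, 5). -/
open Polynomial IntermediateField

/-- The real number `cos (2πa/m)`. -/
noncomputable def cosFrac (m : ℕ) (a : ℤ) : ℝ := Real.cos (2 * Real.pi * a / m)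

theorem cosFrac_eq_cosFrac_iff {m : ℕ} (hm : m ≠ 0) {a b : ℤ} :
    cosFrac m a = cosFrac m b ↔ (m : ℤ) ∣ b - a ∨ (m : ℤ) ∣ b + a := by
  have hm' : (m : ℝ) ≠ 0 := by exact_mod_cast hm
  have hpi := Real.pi_ne_zero
  rw [cosFrac, cosFrac, Real.cos_eq_cos_iff]
  constructor
  · rintro ⟨k, h | h⟩
    · refine .inl ⟨k, ?_⟩
      field_simp at h
      have : (b : ℝ) = m * k + a := by linear_combination h
      have : b = m * k + a := by exact_mod_cast this
      linarith
    · refine .inr ⟨k, ?_⟩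
      field_simp at h
      have : (b : ℝ) = m * k - a := by linear_combination h
      have : b = m * k - a := by exact_mod_cast this
      linarith
  · rintro (⟨k, h⟩ | ⟨k, h⟩) <;> refine ⟨k, ?_⟩
    · left
      obtain rfl : b = m * k + a := by linarith
      push_cast
      field_simp
    · right
      obtain rfl : b = m * k - a := by linarith
      push_cast
      field_simp

theorem cosFrac_congr {m : ℕ} {a b : ℤ} (h : a ≡ b [ZMOD m]) : cosFrac m a = cosFrac m b := by
  rcases eq_or_ne m 0 with rfl | hm
  · simp [cosFrac]
  · exact (cosFrac_eq_cosFrac_iff hm).2 (.inl h.dvd)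

theorem cosFrac_mul_right (m : ℕ) {k : ℕ} (hk : k ≠ 0) (a : ℤ) :
    cosFrac (m * k) (a * k) = cosFrac m a := by
  have : (k : ℝ) ≠ 0 := by exact_mod_cast hk
  rw [cosFrac, cosFrac]
  push_cast
  rw [← mul_assoc, mul_div_mul_right _ _ this]

theorem cosFrac_mul_left (m : ℕ) {k : ℕ} (hk : k ≠ 0) (a : ℤ) :
    cosFrac (k * m) (k * a) = cosFrac m a := by
  rw [mul_comm, mul_comm (k : ℤ), cosFrac_mul_right m hk]

theorem cosFrac_two_mul (m : ℕ) (a : ℤ) : cosFrac m (2 * a) = 2 * cosFrac m a ^ 2 - 1 := by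
  rw [cosFrac, cosFrac, ← Real.cos_two_mul]
  push_cast
  ring_nf

/-- Values `cosFrac m (t * a)` are polynomial expressions in the `t`-th power of a fixed primitive
root of unity, uniformly in `t`. -/
theorem exists_aeval_eq_cosFrac {m : ℕ} (hm : m ≠ 0) (a : ℤ) : ∃ P : ℚ[X], ∀ t : ℕ,
    aeval (Complex.exp (2 * Real.pi * Complex.I / m) ^ t) P = (cosFrac m (t * a) : ℂ) := by
  have hm' : (m : ℂ) ≠ 0 := by exact_mod_cast hm
  obtain ⟨e, he⟩ : ∃ e : ℕ, (e : ℤ) ≡ a [ZMOD m] :=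
    ⟨(a % m).toNat, by
      rw [Int.toNat_of_nonneg (Int.emod_nonneg _ (by exact_mod_cast hm))]
      exact Int.mod_modEq _ _⟩
  refine ⟨C (1 / 2) * (X ^ e + X ^ ((m - 1) * e)), fun t ↦ ?_⟩
  have hζ := Complex.isPrimitiveRoot_exp m hm
  have h1 : (Complex.exp (2 * Real.pi * Complex.I / m) ^ t) ^ e =
      Complex.exp (2 * Real.pi * (t * e) / m * Complex.I) := by
    rw [← pow_mul, ← Complex.exp_nat_mul]
    push_cast
    ring_nf
  have h2 : (Complex.exp (2 * Real.pi * Complex.I / m) ^ t) ^ ((m - 1) * e) =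
      Complex.exp (-(2 * Real.pi * (t * e) / m * Complex.I)) := by
    rw [Complex.exp_neg, ← h1]
    apply eq_inv_of_mul_eq_one_left
    rw [← pow_add, show (m - 1) * e + e = m * e by rw [← Nat.succ_mul, Nat.succ_eq_add_one,
        Nat.sub_add_cancel (Nat.pos_of_ne_zero hm)], ← pow_mul, mul_left_comm, pow_mul,
      hζ.pow_eq_one, one_pow]
  rw [cosFrac_congr (he.symm.mul_left t), cosFrac, Complex.ofReal_cos]
  push_cast
  rw [Complex.cos, neg_mul]
  simp only [map_mul, aeval_C, map_add, map_pow, aeval_X, h1, h2]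
  simp
  ring

/-- A rational linear relation between `1`, `cos (2πa₁/m₁)` and `cos (2πa₂/m₂)` is preserved by
Galois conjugation. -/
theorem cosFrac_relation_conj {m₁ m₂ : ℕ} (hm₁ : m₁ ≠ 0) (hm₂ : m₂ ≠ 0) {a₁ a₂ : ℤ} {a b c : ℚ}
    (h : a + b * cosFrac m₁ a₁ + c * cosFrac m₂ a₂ = 0) {t : ℕ} (ht₁ : t.Coprime m₁)
    (ht₂ : t.Coprime m₂) : a + b * cosFrac m₁ (t * a₁) + c * cosFrac m₂ (t * a₂) = 0 := by
  have hm : m₁ * m₂ ≠ 0 := mul_ne_zero hm₁ hm₂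
  obtain ⟨P₁, hP₁⟩ := exists_aeval_eq_cosFrac hm (a₁ * m₂)
  obtain ⟨P₂, hP₂⟩ := exists_aeval_eq_cosFrac hm (m₁ * a₂)
  simp only [← mul_assoc, cosFrac_mul_right _ hm₂] at hP₁
  simp only [mul_left_comm _ (m₁ : ℤ), cosFrac_mul_left _ hm₁] at hP₂
  set ζ := Complex.exp (2 * Real.pi * Complex.I / (m₁ * m₂ : ℕ))
  have hζ : IsPrimitiveRoot ζ (m₁ * m₂) := Complex.isPrimitiveRoot_exp _ hm
  have hP (s : ℕ) : aeval (ζ ^ s) (C a + C b * P₁ + C c * P₂) =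
      ((a + b * cosFrac m₁ (s * a₁) + c * cosFrac m₂ (s * a₂) : ℝ) : ℂ) := by
    simp [hP₁, hP₂]
  have hdvd : cyclotomic (m₁ * m₂) ℚ ∣ C a + C b * P₁ + C c * P₂ := by
    rw [cyclotomic_eq_minpoly_rat hζ (Nat.pos_of_ne_zero hm)]
    apply minpoly.dvd
    have := hP 1
    simp only [pow_one, Nat.cast_one, one_mul, h, Complex.ofReal_zero] at this
    exact this
  rw [cyclotomic_eq_minpoly_rat (hζ.pow_of_coprime t (ht₁.mul_right ht₂)) (Nat.pos_of_ne_zero hm)]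
    at hdvd
  have := hP t
  rw [aeval_eq_zero_of_dvd_aeval_eq_zero hdvd (minpoly.aeval _ _)] at this
  exact_mod_cast this.symm

/-- If `d` is a nonunit squarefree integer coprime to `n`, then `√d` does not lie in the `n`-th
cyclotomic field. -/
theorem IsCyclotomicExtension.Rat.sq_ne_intCast_of_squarefree {n : ℕ} [NeZero n] {K : Type*}
    [Field K] [CharZero K] [IsCyclotomicExtension {n} ℚ K] {d : ℤ} (hd : ¬ IsUnit d)
    (hsf : Squarefree d) (hdn : IsCoprime d n) (α : K) : α ^ 2 ≠ d := by
  intro hα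
  set ζ := IsCyclotomicExtension.zeta n ℚ K
  have hζ : IsPrimitiveRoot ζ n := IsCyclotomicExtension.zeta_spec n ℚ K
  have hαint : IsIntegral ℤ α := .of_pow two_pos (hα ▸ isIntegral_algebraMap (x := d))
  obtain ⟨F, rfl⟩ : ∃ F : ℤ[X], aeval ζ F = α := by
    have := isIntegralClosure_adjoin_singleton hζ
    obtain ⟨y, rfl⟩ := (IsIntegralClosure.isIntegral_iff
      (A := Algebra.adjoin ℤ ({ζ} : Set K))).1 hαint
    exact (Algebra.adjoin_singleton_eq_range_aeval ℤ ζ).le y.2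
  have hker (G : ℤ[X]) (hG : aeval ζ G = 0) : cyclotomic n ℤ ∣ G := by
    rw [cyclotomic_eq_minpoly hζ (NeZero.pos n)]
    exact minpoly.isIntegrallyClosed_dvd (hζ.isIntegral (NeZero.pos n)) hG
  obtain ⟨p, hpp, hpd⟩ := Nat.exists_prime_and_dvd (fun h ↦ hd (Int.isUnit_iff_natAbs_eq.2 h))
  obtain ⟨e, rfl⟩ := Int.natCast_dvd.2 hpd
  have hp := Nat.prime_iff_prime_int.1 hpp
  have := Fact.mk hpp
  have hpn : ((n : ℕ) : ZMod p) ≠ 0 := by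
    rw [Ne, ZMod.natCast_eq_zero_iff]
    intro h
    exact hp.not_isUnit (hdn.isUnit_of_dvd' (dvd_mul_right _ _) (by exact_mod_cast h))
  have hsq : Squarefree (cyclotomic n (ZMod p)) :=
    ((X_pow_sub_one_separable_iff.2 hpn).of_dvd (cyclotomic.dvd_X_pow_sub_one n _)).squarefree
  have hdvd : cyclotomic n (ZMod p) ∣ F.map (Int.castRingHom (ZMod p)) := by
    rw [← hsq.dvd_pow_iff_dvd two_ne_zero]
    have := Polynomial.map_dvd (Int.castRingHom (ZMod p))
      (hker (F ^ 2 - C (p * e : ℤ)) (by simp_all))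
    simpa using this
  obtain ⟨H, hH⟩ := hdvd
  obtain ⟨H, rfl⟩ :=
    Polynomial.map_surjective (Int.castRingHom (ZMod p)) ZMod.intCast_surjective H
  have hmod : (F - cyclotomic n ℤ * H).map (Int.castRingHom (ZMod p)) = 0 := by
    simp [hH]
  obtain ⟨G, hG⟩ : C (p : ℤ) ∣ F - cyclotomic n ℤ * H := by
    rw [C_dvd_iff_dvd_coeff]
    intro i
    have := congr_arg (coeff · i) hmod
    rw [← ZMod.intCast_zmod_eq_zero_iff_dvd]
    simpa [coeff_map, -Polynomial.map_sub] using this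
  have hF : aeval ζ F = p * aeval ζ G := by
    have h0 : aeval ζ (cyclotomic n ℤ) = 0 := by
      rw [cyclotomic_eq_minpoly hζ (NeZero.pos n)]; exact minpoly.aeval _ _
    have := congr_arg (aeval ζ) hG
    simpa [h0] using this
  have hp0 : (p : K) ≠ 0 := by exact_mod_cast hp.ne_zero
  have hGe : (p : K) * aeval ζ G ^ 2 = e := by
    rw [hF] at hα
    apply mul_left_cancel₀ hp0
    push_cast at hα
    linear_combination hα
  have hpe : (p : ℤ) ∣ e := by
    have hint : IsIntegral ℤ (algebraMap ℚ K (e / p)) := by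
      refine .of_pow one_pos ?_
      have : algebraMap ℚ K (e / p) ^ 1 = aeval ζ G ^ 2 := by
        simp [← hGe, hp0]
      rw [this]
      exact IsIntegral.pow (adjoin_le_integralClosure (hζ.isIntegral (NeZero.pos n))
        (aeval_mem_adjoin_singleton ℤ ζ)) 2
    rw [isIntegral_algebraMap_iff (algebraMap ℚ K).injective,
      IsIntegrallyClosed.isIntegral_iff] at hint
    obtain ⟨f, hf⟩ := hint
    refine ⟨f, ?_⟩
    have hpq : (p : ℚ) ≠ 0 := by exact_mod_cast hp.ne_zero
    rw [eq_div_iff hpq] at hf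
    rw [mul_comm]
    rw [eq_intCast] at hf
    exact_mod_cast hf.symm
  exact hp.not_isUnit (hsf p (mul_dvd_mul_left _ hpe))

/-- Moduli `m ≥ 5` with `m ≢ 2 mod 4` have a unit different from `±1`. -/
theorem exists_coprime_not_dvd_sub_one {m : ℕ} (h5 : 5 ≤ m) (hm : Odd m ∨ 4 ∣ m) :
    ∃ u : ℕ, u.Coprime m ∧ ¬ (m : ℤ) ∣ u - 1 ∧ ¬ (m : ℤ) ∣ u + 1 := by
  rcases hm with hm | ⟨k, rfl⟩
  · refine ⟨2, (Nat.coprime_two_left).2 hm, fun h ↦ ?_, fun h ↦ ?_⟩ <;>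
    · have := Int.le_of_dvd (by norm_num) h
      norm_num at this
      omega
  · refine ⟨1 + 2 * k, ?_, fun h ↦ ?_, fun h ↦ ?_⟩
    · rw [show 4 * k = 2 * (2 * k) by ring]
      exact Nat.Coprime.mul_right (by simp) (by simp)
    all_goals
      have := Int.le_of_dvd (by push_cast; omega) h
      push_cast at this
      omega

theorem intCast_dvd_of_dvd_mul {m : ℕ} {x a : ℤ} (ha : IsCoprime a m) (h : (m : ℤ) ∣ x * a) :
    (m : ℤ) ∣ x :=
  ha.symm.dvd_of_dvd_mul_right h

/-- If `1, cos (2πa₁/m₁), cos (2πa₂/m₂)` satisfy a rational relation involving the last term, then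
`m₂ ∣ m₁`. -/
theorem dvd_of_cosFrac_relation {m₁ m₂ : ℕ} (hm₁ : m₁ ≠ 0) (h5 : 5 ≤ m₂) (hm₂ : Odd m₂ ∨ 4 ∣ m₂)
    {a₁ a₂ : ℤ} (ha₂ : IsCoprime a₂ m₂) {a b c : ℚ} (hc : c ≠ 0)
    (h : a + b * cosFrac m₁ a₁ + c * cosFrac m₂ a₂ = 0) : m₂ ∣ m₁ := by
  have hm₂0 : m₂ ≠ 0 := by omega
  have : NeZero m₂ := ⟨hm₂0⟩
  set g := m₁.gcd m₂
  have hg : g ∣ m₂ := Nat.gcd_dvd_right _ _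
  have key (u : ℕ) (hu : u.Coprime m₂) (hug : 1 ≡ u [MOD g]) :
      (m₂ : ℤ) ∣ u - 1 ∨ (m₂ : ℤ) ∣ u + 1 := by
    obtain ⟨t, ht₁, ht₂⟩ := Nat.chineseRemainder' hug
    have hct₁ : t.Coprime m₁ := by rw [Nat.Coprime, ht₁.gcd_eq]; simp
    have hct₂ : t.Coprime m₂ := by rw [Nat.Coprime, ht₂.gcd_eq]; exact hu
    have h' := cosFrac_relation_conj hm₁ hm₂0 h hct₁ hct₂
    have e₁ : cosFrac m₁ (t * a₁) = cosFrac m₁ a₁ := cosFrac_congr <| by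
      simpa using (Int.natCast_modEq_iff.2 ht₁).mul_right a₁
    have e₂ : cosFrac m₂ (t * a₂) = cosFrac m₂ (u * a₂) :=
      cosFrac_congr ((Int.natCast_modEq_iff.2 ht₂).mul_right a₂)
    have hcR : (c : ℝ) ≠ 0 := by exact_mod_cast hc
    have e : cosFrac m₂ a₂ = cosFrac m₂ (u * a₂) := by
      rw [← e₂]
      apply mul_left_cancel₀ hcR
      rw [e₁] at h'
      linarith
    rcases (cosFrac_eq_cosFrac_iff hm₂0).1 e with h | h
    · exact .inl (intCast_dvd_of_dvd_mul ha₂ (by convert h using 1; ring))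
    · exact .inr (intCast_dvd_of_dvd_mul ha₂ (by convert h using 1; ring))
  have hg2 : ¬ g ∣ 2 := by
    intro hg2
    obtain ⟨u, hu, h1, h2⟩ := exists_coprime_not_dvd_sub_one h5 hm₂
    refine (key u hu ?_).elim h1 h2
    have hcop : u.Coprime g := hu.coprime_dvd_right hg
    rcases (Nat.dvd_prime Nat.prime_two).1 hg2 with h | h
    · rw [h]
      exact Nat.modEq_one
    · rw [h] at hcop ⊢
      exact (Nat.odd_iff.1 (Nat.coprime_two_right.1 hcop)).symm
  have hinj : Function.Injective (ZMod.unitsMap hg) := by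
    rw [injective_iff_map_eq_one]
    intro u hu
    have hug : 1 ≡ (u : ZMod m₂).val [MOD g] := by
      rw [← ZMod.natCast_eq_natCast_iff]
      have := congr_arg Units.val hu
      rw [ZMod.unitsMap_val] at this
      rw [ZMod.natCast_val, this]
      simp
    rcases key _ (ZMod.val_coe_unit_coprime u) hug with h | h
    · rw [← ZMod.intCast_zmod_eq_zero_iff_dvd] at h
      ext
      simpa [sub_eq_zero] using h
    · refine absurd ?_ hg2
      have hug' := (Nat.modEq_iff_dvd.1 hug)
      have h2 : (g : ℤ) ∣ _ := (Int.natCast_dvd_natCast.2 hg).trans h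
      have := dvd_sub h2 hug'
      have e : ((u : ZMod m₂).val : ℤ) + 1 - (((u : ZMod m₂).val : ℤ) - (1 : ℕ)) = (2 : ℕ) := by
        push_cast; ring
      rw [e] at this
      exact_mod_cast this
  have hg0 : NeZero g := ⟨Nat.gcd_ne_zero_left hm₁⟩
  have hcard := Fintype.card_le_of_injective _ hinj
  rw [ZMod.card_units_eq_totient, ZMod.card_units_eq_totient] at hcard
  have htot : g.totient = m₂.totient :=
    le_antisymm (Nat.le_of_dvd (Nat.totient_pos.2 (by omega)) (Nat.totient_dvd_of_dvd hg)) hcard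
  have : g = m₂ := by
    refine (Nat.eq_or_eq_of_totient_eq_totient hg htot).elim id fun h ↦ ?_
    refine Even.eq_of_totient_eq_totient hg ?_ htot
    rcases hm₂ with ⟨k, hk⟩ | ⟨k, hk⟩
    · omega
    · exact ⟨k, by omega⟩
  exact this ▸ Nat.gcd_dvd_left _ _

/-- `cos (2πa/m)` is irrational for `a` coprime to `m`, `m ≥ 5` and `m ≢ 2 mod 4`. -/
theorem coeff_eq_zero_of_cosFrac_relation {m : ℕ} (h5 : 5 ≤ m) (hm : Odd m ∨ 4 ∣ m) {a : ℤ}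
    (ha : IsCoprime a m) {x c : ℚ} (h : x + c * cosFrac m a = 0) : c = 0 := by
  by_contra hc
  have := dvd_of_cosFrac_relation (m₁ := 1) (a₁ := 0) (b := 0) (a := x) one_ne_zero h5 hm ha hc
    (by simpa using h)
  have := Nat.le_of_dvd one_pos this
  omega

theorem dvd_sub_or_dvd_add_of_cosFrac_relation_of_odd {m : ℕ} (h7 : 7 ≤ m) (hm : Odd m)
    {a₁ a₂ : ℤ} (ha₁ : IsCoprime a₁ m) {a b : ℚ} (hb : b ≠ 0)
    (h : cosFrac m a₂ = a + b * cosFrac m a₁) : (m : ℤ) ∣ a₁ - a₂ ∨ (m : ℤ) ∣ a₁ + a₂ := by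
  have hm0 : m ≠ 0 := by omega
  have hrel (t : ℕ) (ht : t.Coprime m) : cosFrac m (t * a₂) = a + b * cosFrac m (t * a₁) := by
    have := cosFrac_relation_conj (a := a) (b := b) (c := -1) (a₁ := a₁) (a₂ := a₂) hm0 hm0
      (by push_cast; linarith) ht ht
    push_cast at this
    linarith
  have hroot (t : ℕ) (ht : t.Coprime m) :
      2 * (a + b * cosFrac m (t * a₁)) ^ 2 - 1 = a + b * (2 * cosFrac m (t * a₁) ^ 2 - 1) := by
    have := hrel (2 * t) ((Nat.coprime_two_left.2 hm).mul_left ht)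
    push_cast at this
    rwa [mul_assoc, mul_assoc, cosFrac_two_mul, cosFrac_two_mul, hrel t ht] at this
  have hne (s t : ℕ) (h1 : s < t) (h2 : s + t < m) :
      cosFrac m (s * a₁) ≠ cosFrac m (t * a₁) := by
    rw [Ne, cosFrac_eq_cosFrac_iff hm0, ← sub_mul, ← add_mul]
    rintro (h | h)
    all_goals
      have := Int.le_of_dvd (by omega) (intCast_dvd_of_dvd_mul ha₁ h)
      omega
  have c2 : Nat.Coprime 2 m := Nat.coprime_two_left.2 hm
  have r1 := hroot 1 (by simp)
  have r2 := hroot 2 c2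
  have r4 := hroot 4 (c2.mul_left c2)
  have n12 := sub_ne_zero.2 (hne 1 2 (by norm_num) (by omega))
  have n14 := sub_ne_zero.2 (hne 1 4 (by norm_num) (by omega))
  have n24 : cosFrac m ((2 : ℕ) * a₁) - cosFrac m ((4 : ℕ) * a₁) ≠ 0 := by
    rw [sub_ne_zero, Ne, cosFrac_eq_cosFrac_iff hm0, ← sub_mul, ← add_mul]
    rintro (h | h)
    · have := Int.le_of_dvd (by omega) (intCast_dvd_of_dvd_mul ha₁ h)
      omega
    · have := intCast_dvd_of_dvd_mul ha₁ h
      obtain ⟨k, hk⟩ := hm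
      rw [show ((4 : ℕ) : ℤ) + (2 : ℕ) = 2 * 3 by norm_num] at this
      have := Int.le_of_dvd (by omega)
        ((Nat.isCoprime_iff_coprime.2 c2).symm.dvd_of_dvd_mul_left this)
      omega
  generalize cosFrac m ((1 : ℕ) * a₁) = x at *
  generalize cosFrac m ((2 : ℕ) * a₁) = y at *
  generalize cosFrac m ((4 : ℕ) * a₁) = z at *
  have q12 : (2 * b ^ 2 - 2 * b) * (x + y) + 4 * a * b = 0 := by
    apply mul_left_cancel₀ n12
    linear_combination r1 - r2
  have q24 : (2 * b ^ 2 - 2 * b) * (y + z) + 4 * a * b = 0 := by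
    apply mul_left_cancel₀ n24
    linear_combination r2 - r4
  have q : (2 * b ^ 2 - 2 * b : ℝ) = 0 := by
    apply mul_left_cancel₀ n14
    linear_combination q12 - q24
  have hbR : (b : ℝ) ≠ 0 := by exact_mod_cast hb
  have hb1 : (b : ℝ) = 1 := by
    apply mul_left_cancel₀ hbR
    linear_combination q / 2
  have ha0 : (a : ℝ) = 0 := by
    rw [q, hb1] at q12
    linarith
  rw [ha0, hb1, zero_add, one_mul, cosFrac_eq_cosFrac_iff hm0] at h
  exact h

theorem dvd_two_mul_of_cosFrac_relation_of_four_dvd {m : ℕ} (h5 : 5 ≤ m) (hm : 4 ∣ m)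
    {a₁ a₂ : ℤ} (ha₁ : IsCoprime a₁ m) (ha₂ : IsCoprime a₂ m) {a b : ℚ}
    (h : cosFrac m a₂ = a + b * cosFrac m a₁) :
    (m : ℤ) ∣ 2 * (a₁ - a₂) ∨ (m : ℤ) ∣ 2 * (a₁ + a₂) := by
  have hm0 : m ≠ 0 := by omega
  have hrel (t : ℕ) (ht : t.Coprime m) : cosFrac m (t * a₂) = a + b * cosFrac m (t * a₁) := by
    have := cosFrac_relation_conj (a := a) (b := b) (c := -1) (a₁ := a₁) (a₂ := a₂) hm0 hm0
      (by push_cast; linarith) ht ht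
    push_cast at this
    linarith
  obtain ⟨k, rfl⟩ := hm
  have hk : k ≠ 0 := by omega
  have hneg (x : ℤ) (hx : IsCoprime x (4 * k : ℕ)) :
      cosFrac (4 * k) ((1 + 2 * k : ℕ) * x) = -cosFrac (4 * k) x := by
    have hodd : Odd x := by
      rw [← Int.not_even_iff_odd, even_iff_two_dvd]
      intro h2
      have := hx.isUnit_of_dvd' h2 ⟨2 * k, by push_cast; ring⟩
      exact absurd (Int.isUnit_iff.1 this) (by norm_num)
    obtain ⟨y, rfl⟩ := hodd
    rw [cosFrac, cosFrac, ← Real.cos_add_pi, ← Real.cos_add_int_mul_two_pi (_ + Real.pi) y]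
    congr 1
    have : (k : ℝ) ≠ 0 := by exact_mod_cast hk
    push_cast
    field_simp
    ring
  have ha0 : (a : ℝ) = 0 := by
    have := hrel (1 + 2 * k) (by
      rw [show 4 * k = 2 * (2 * k) by ring]
      exact Nat.Coprime.mul_right (by simp) (by simp))
    rw [hneg _ ha₁, hneg _ ha₂] at this
    linarith
  set m := 4 * k
  have hmZ : (m : ℤ) = 4 * k := by simp [m]
  have hm0' : NeZero m := ⟨hm0⟩
  obtain ⟨j, hjm, hj⟩ : ∃ j : ℕ, j.Coprime m ∧ j * a₁ ≡ a₂ [ZMOD m] := by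
    let u := ZMod.unitOfIsCoprime a₂ ha₂ * (ZMod.unitOfIsCoprime a₁ ha₁)⁻¹
    refine ⟨(u : ZMod m).val, ZMod.val_coe_unit_coprime u, ?_⟩
    rw [← ZMod.intCast_eq_intCast_iff]
    push_cast
    rw [ZMod.natCast_val, ZMod.cast_id]
    rw [← ZMod.coe_unitOfIsCoprime a₁ ha₁, ← ZMod.coe_unitOfIsCoprime a₂ ha₂, ← Units.val_mul]
    simp [u]
  have hpow (i : ℕ) : cosFrac m ((j ^ i : ℕ) * a₁) = b ^ i * cosFrac m a₁ := by
    induction i with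
    | zero => simp
    | succ i ih =>
      have := hrel (j ^ i) (hjm.pow_left i)
      rw [ih, ha0, zero_add] at this
      rw [pow_succ' (b : ℝ), mul_assoc, ← this]
      apply cosFrac_congr
      push_cast
      rw [pow_succ, mul_assoc]
      exact hj.mul_left _
  have hx0 : cosFrac m a₁ ≠ 0 := by
    intro h0
    exact one_ne_zero (coeff_eq_zero_of_cosFrac_relation (x := 0) (c := 1) h5 (.inr ⟨k, rfl⟩) ha₁
      (by simpa using h0))
  have hb : (b : ℝ) ^ m.totient = 1 := by
    apply mul_right_cancel₀ hx0
    rw [← hpow, one_mul]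
    apply cosFrac_congr
    simpa using (Int.natCast_modEq_iff.2 (Nat.ModEq.pow_totient hjm)).mul_right a₁
  have htot : m.totient ≠ 0 := (Nat.totient_pos.2 (by omega)).ne'
  have habs : |(b : ℝ)| = 1 := by
    rw [← pow_eq_one_iff_of_nonneg (abs_nonneg _) htot, ← abs_pow, hb, abs_one]
  rw [ha0, zero_add] at h
  rcases (abs_eq zero_le_one).1 habs with hb1 | hb1
  · rw [hb1, one_mul, cosFrac_eq_cosFrac_iff hm0] at h
    exact h.imp (fun h ↦ h.mul_left _) (fun h ↦ h.mul_left _)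
  · rw [hb1, neg_one_mul, ← hneg _ ha₁, cosFrac_eq_cosFrac_iff hm0] at h
    refine h.imp (fun ⟨q, hq⟩ ↦ ⟨2 * q - a₁, ?_⟩) (fun ⟨q, hq⟩ ↦ ⟨2 * q - a₁, ?_⟩)
    all_goals
      push_cast at hq
      linear_combination 2 * hq + a₁ * hmZ

/-- The criterion for rational linear independence of `1, cos (2πa₁/m₁), cos (2πa₂/m₂)`. -/
theorem eq_zero_of_cosFrac_relation {m₁ m₂ : ℕ} (h5₁ : 5 ≤ m₁) (h5₂ : 5 ≤ m₂)
    (hm₁ : Odd m₁ ∨ 4 ∣ m₁) (hm₂ : Odd m₂ ∨ 4 ∣ m₂) {a₁ a₂ : ℤ} (ha₁ : IsCoprime a₁ m₁)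
    (ha₂ : IsCoprime a₂ m₂) (h55 : ¬ (m₁ = 5 ∧ m₂ = 5))
    (hsub : m₁ = m₂ → ¬ (m₁ : ℤ) ∣ 2 * (a₁ - a₂)) (hadd : m₁ = m₂ → ¬ (m₁ : ℤ) ∣ 2 * (a₁ + a₂))
    {a b c : ℚ} (h : a + b * cosFrac m₁ a₁ + c * cosFrac m₂ a₂ = 0) : a = 0 ∧ b = 0 ∧ c = 0 := by
  suffices hbc : b = 0 ∨ c = 0 by
    rcases hbc with rfl | rfl
    · obtain rfl := coeff_eq_zero_of_cosFrac_relation h5₂ hm₂ ha₂ (by simpa using h)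
      simpa using h
    · obtain rfl := coeff_eq_zero_of_cosFrac_relation h5₁ hm₁ ha₁ (by simpa using h)
      simpa using h
  by_contra! hbc
  obtain ⟨hb, hc⟩ := hbc
  obtain rfl : m₁ = m₂ := Nat.dvd_antisymm
    (dvd_of_cosFrac_relation (a := a) (b := c) (a₁ := a₂) (by omega) h5₁ hm₁ ha₁ hb
      (by linarith))
    (dvd_of_cosFrac_relation (by omega) h5₂ hm₂ ha₂ hc h)
  have hcR : (c : ℝ) ≠ 0 := by exact_mod_cast hc
  have h' : cosFrac m₁ a₂ = (-a / c : ℚ) + (-b / c : ℚ) * cosFrac m₁ a₁ := by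
    push_cast
    field_simp
    linarith
  rcases hm₁ with hm₁ | hm₁
  · have h7 : 7 ≤ m₁ := by
      obtain ⟨k, hk⟩ := hm₁
      omega
    have := dvd_sub_or_dvd_add_of_cosFrac_relation_of_odd h7 hm₁ ha₁
      (div_ne_zero (neg_ne_zero.2 hb) hc) h'
    exact this.elim (fun h ↦ hsub rfl (h.mul_left 2)) (fun h ↦ hadd rfl (h.mul_left 2))
  · exact (dvd_two_mul_of_cosFrac_relation_of_four_dvd h5₁ hm₁ ha₁ ha₂ h').elim
      (hsub rfl) (hadd rfl)

/-- Every rational number with denominator at least `4` is, up to an integer, of the form `2a/m`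
with `a` coprime to `m ≥ 5` and `m ≢ 2 mod 4`. -/
theorem exists_eq_two_mul_div_add_int (r : ℚ) (hr : 4 ≤ r.den) : ∃ (m : ℕ) (a k : ℤ),
    5 ≤ m ∧ (Odd m ∨ 4 ∣ m) ∧ IsCoprime a m ∧ r = 2 * a / m + k ∧ (m = 5 → r.den = 5) ∧
      ∀ d : ℤ, IsCoprime d r.den → IsCoprime d m := by
  have hcop : IsCoprime r.num r.den := Rat.isCoprime_num_den r
  have hden : (r.den : ℚ) ≠ 0 := by exact_mod_cast r.den_ne_zero
  have hr' : r = r.num / r.den := (Rat.num_div_den r).symm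
  generalize r.num = p at *
  generalize r.den = q at *
  rcases Nat.even_or_odd q with ⟨s, rfl⟩ | hq
  · have h2 (x : ℤ) (hx : IsCoprime x (s + s : ℕ)) : IsCoprime x (2 * (s + s) : ℕ) := by
      rw [Nat.cast_mul]
      refine IsCoprime.mul_right (hx.of_isCoprime_of_dvd_right ?_) hx
      exact ⟨s, by push_cast; ring⟩
    refine ⟨2 * (s + s), p, 0, by omega, .inr ⟨s, by ring⟩, h2 p hcop, ?_, by omega, h2⟩
    rw [hr']
    push_cast at hden ⊢
    field_simp
    ring
  · have hqZ : Odd (q : ℤ) := by exact_mod_cast hq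
    have h5 : 5 ≤ q := by
      obtain ⟨t, rfl⟩ := hq
      omega
    obtain ⟨a, k, rfl⟩ : ∃ a k : ℤ, p = 2 * a + q * k := by
      rcases Int.even_or_odd p with ⟨a, ha⟩ | hp
      · exact ⟨a, 0, by linarith⟩
      · obtain ⟨a, ha⟩ := hp.sub_odd hqZ
        exact ⟨a, 1, by linarith⟩
    refine ⟨q, a, k, h5, .inl hq, ?_, ?_, id, fun _ h ↦ h⟩
    · exact (IsCoprime.of_add_mul_left_left hcop).of_mul_left_right
    · rw [hr']
      push_cast
      field_simp

theorem cos_pi_mul_eq_cosFrac {r : ℚ} {m : ℕ} {a k : ℤ} (h : r = 2 * a / m + k) :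
    Real.cos (Real.pi * r) = ((-1) ^ k : ℚ) * cosFrac m a := by
  rw [h, cosFrac]
  push_cast
  rw [← Real.cos_add_int_mul_pi]
  congr 1
  ring

theorem exists_eq_add_mul_sqrt_of_mem_adjoin {d : ℤ} (hd : 0 ≤ d) {x : ℝ}
    (hx : x ∈ ℚ⟮Real.sqrt (d : ℝ)⟯) : ∃ p q : ℚ, x = p + q * Real.sqrt d := by
  have hsq : Real.sqrt (d : ℝ) ^ 2 = d := Real.sq_sqrt (by exact_mod_cast hd)
  have halg : IsAlgebraic ℚ (Real.sqrt (d : ℝ)) := by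
    refine ⟨X ^ 2 - C (d : ℚ), X_pow_sub_C_ne_zero two_pos _, ?_⟩
    simp [hsq]
  rw [← IntermediateField.mem_toSubalgebra, adjoin_simple_toSubalgebra_of_isAlgebraic halg,
    Algebra.adjoin_singleton_eq_range_aeval] at hx
  obtain ⟨P, rfl⟩ := hx
  induction P using Polynomial.induction_on' with
  | add P Q hP hQ =>
    obtain ⟨p, q, h⟩ := hP
    obtain ⟨p', q', h'⟩ := hQ
    refine ⟨p + p', q + q', ?_⟩
    simp only [RingHom.coe_coe, AlgHom.toRingHom_eq_coe] at h h' ⊢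
    rw [map_add, h, h']
    push_cast
    ring
  | monomial n c =>
    have key : ∃ p q : ℚ, Real.sqrt (d : ℝ) ^ n = p + q * Real.sqrt d := by
      induction n with
      | zero => exact ⟨1, 0, by simp⟩
      | succ n ih =>
        obtain ⟨p, q, h⟩ := ih
        refine ⟨q * d, p, ?_⟩
        rw [pow_succ, h]
        push_cast
        linear_combination q * hsq
    obtain ⟨p, q, h⟩ := key
    refine ⟨c * p, c * q, ?_⟩
    simp [aeval_monomial, h]
    ring

/-- A linear combination over `ℚ(√d)` of `1` and cosines with denominators coprime to `d` vanishes
only if both of its rational components do. -/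
theorem eq_zero_of_add_sqrt_mul_eq_zero {d : ℤ} (hd : 2 ≤ d) (hsf : Squarefree d) {m₁ m₂ : ℕ}
    (hm₁ : m₁ ≠ 0) (hm₂ : m₂ ≠ 0) (hdm₁ : IsCoprime d m₁) (hdm₂ : IsCoprime d m₂) {a₁ a₂ : ℤ}
    {a b c a' b' c' : ℚ}
    (h : (a + b * cosFrac m₁ a₁ + c * cosFrac m₂ a₂) +
      Real.sqrt d * (a' + b' * cosFrac m₁ a₁ + c' * cosFrac m₂ a₂) = 0) :
    a + b * cosFrac m₁ a₁ + c * cosFrac m₂ a₂ = 0 ∧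
      a' + b' * cosFrac m₁ a₁ + c' * cosFrac m₂ a₂ = 0 := by
  have hm : m₁ * m₂ ≠ 0 := mul_ne_zero hm₁ hm₂
  set ζ := Complex.exp (2 * Real.pi * Complex.I / (m₁ * m₂ : ℕ))
  have hζ : IsPrimitiveRoot ζ (m₁ * m₂) := Complex.isPrimitiveRoot_exp _ hm
  have : NeZero (m₁ * m₂) := ⟨hm⟩
  have hmem (x : ℤ) : (cosFrac (m₁ * m₂) x : ℂ) ∈ ℚ⟮ζ⟯ := by
    obtain ⟨P, hP⟩ := exists_aeval_eq_cosFrac hm x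
    have := hP 1
    rw [Nat.cast_one, one_mul, pow_one] at this
    rw [← this]
    exact algebra_adjoin_le_adjoin _ _ (aeval_mem_adjoin_singleton ℚ ζ)
  have hmem' (a b c : ℚ) : ((a + b * cosFrac m₁ a₁ + c * cosFrac m₂ a₂ : ℝ) : ℂ) ∈ ℚ⟮ζ⟯ := by
    rw [← cosFrac_mul_right m₁ hm₂, ← cosFrac_mul_left m₂ hm₁]
    push_cast
    have hq (q : ℚ) : (q : ℂ) ∈ ℚ⟮ζ⟯ := _root_.algebraMap_mem _ q
    exact add_mem (add_mem (hq a) (mul_mem (hq b) (hmem _))) (mul_mem (hq c) (hmem _))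
  have hx := hmem' a b c
  have hy := hmem' a' b' c'
  generalize a + b * cosFrac m₁ a₁ + c * cosFrac m₂ a₂ = x at *
  generalize a' + b' * cosFrac m₁ a₁ + c' * cosFrac m₂ a₂ = y at *
  suffices y = 0 by simp_all
  by_contra hy0
  have hs : ((Real.sqrt d : ℝ) : ℂ) ∈ ℚ⟮ζ⟯ := by
    have : Real.sqrt d = -x / y := by
      field_simp
      linarith
    rw [this]
    push_cast
    exact div_mem (neg_mem hx) hy
  have : IsCyclotomicExtension {m₁ * m₂} ℚ ℚ⟮ζ⟯ := by
    change IsCyclotomicExtension {m₁ * m₂} ℚ ℚ⟮ζ⟯.toSubalgebra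
    rw [adjoin_simple_toSubalgebra_of_isAlgebraic
      (hζ.isIntegral (Nat.pos_of_ne_zero hm)).tower_top.isAlgebraic]
    exact hζ.adjoin_isCyclotomicExtension ℚ
  refine IsCyclotomicExtension.Rat.sq_ne_intCast_of_squarefree (n := m₁ * m₂) (K := ℚ⟮ζ⟯)
    ?_ hsf (by push_cast; exact hdm₁.mul_right hdm₂) ⟨_, hs⟩ ?_
  · rw [Int.isUnit_iff]
    omega
  · ext
    have hsq : Real.sqrt (d : ℝ) ^ 2 = d := Real.sq_sqrt (by exact_mod_cast (by omega : 0 ≤ d))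
    push_cast
    exact_mod_cast hsq

/-- `cos (πr)` lies in `ℚ(√5)` if `r` has denominator `1, 2, 3` or `5`, and it is rational in the
first three cases. -/
theorem exists_cos_pi_mul_eq_of_den (r : ℚ) (hr : r.den ≤ 3 ∨ r.den = 5) :
    ∃ p q : ℚ, Real.cos (Real.pi * r) = p + q * Real.sqrt 5 ∧ (r.den ≤ 3 → q = 0) := by
  have hcos : Real.cos (r.den * (Real.pi * r)) ^ 2 = 1 := by
    have : r.den * (Real.pi * r) = r.num * Real.pi := by
      rw [mul_left_comm]
      have : (r.den : ℝ) * r = r.num := by exact_mod_cast Rat.den_mul_eq_num r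
      rw [this, mul_comm]
    rw [this, Real.cos_int_mul_pi, ← zpow_natCast, ← zpow_mul, mul_comm, zpow_mul]
    simp
  have hpos := r.den_pos
  generalize Real.pi * r = x at *
  have h5 : Real.sqrt 5 ^ 2 = 5 := Real.sq_sqrt (by norm_num)
  have h5x : Real.cos (5 * x) = 16 * Real.cos x ^ 5 - 20 * Real.cos x ^ 3 + 5 * Real.cos x := by
    rw [show 5 * x = 3 * x + 2 * x by ring, Real.cos_add, Real.cos_three_mul, Real.cos_two_mul,
      Real.sin_three_mul, Real.sin_two_mul]
    have := Real.sin_sq_add_cos_sq x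
    linear_combination (-2 * Real.cos x * (3 - 4 * (Real.sin x ^ 2 + (1 - Real.cos x ^ 2)))) * this
  generalize Real.sqrt 5 = s at *
  rcases (by omega : r.den = 1 ∨ r.den = 2 ∨ r.den = 3 ∨ r.den = 5) with h | h | h | h <;>
    rw [h] at hcos ⊢ <;> push_cast at hcos
  · rw [one_mul] at hcos
    generalize Real.cos x = c at *
    have : (c - 1) * (c + 1) = 0 := by linear_combination hcos
    rcases mul_eq_zero.1 this with h | h
    · exact ⟨1, 0, by push_cast; linarith, fun _ ↦ rfl⟩
    · exact ⟨-1, 0, by push_cast; linarith, fun _ ↦ rfl⟩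
  · rw [Real.cos_two_mul] at hcos
    generalize Real.cos x = c at *
    have : c ^ 2 * (c - 1) * (c + 1) = 0 := by linear_combination hcos / 4
    rcases mul_eq_zero.1 this with h | h
    · rcases mul_eq_zero.1 h with h | h
      · exact ⟨0, 0, by simpa using h, fun _ ↦ rfl⟩
      · exact ⟨1, 0, by push_cast; linarith, fun _ ↦ rfl⟩
    · exact ⟨-1, 0, by push_cast; linarith, fun _ ↦ rfl⟩
  · rw [Real.cos_three_mul] at hcos
    generalize Real.cos x = c at *
    have : ((c - 1) * (c + 1)) * ((2 * c - 1) * (2 * c + 1)) ^ 2 = 0 := by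
      linear_combination hcos
    rcases mul_eq_zero.1 this with h | h
    · rcases mul_eq_zero.1 h with h | h
      · exact ⟨1, 0, by push_cast; linarith, fun _ ↦ rfl⟩
      · exact ⟨-1, 0, by push_cast; linarith, fun _ ↦ rfl⟩
    · rcases mul_eq_zero.1 (pow_eq_zero_iff two_ne_zero |>.1 h) with h | h
      · exact ⟨1 / 2, 0, by push_cast; linarith, fun _ ↦ rfl⟩
      · exact ⟨-1 / 2, 0, by push_cast; linarith, fun _ ↦ rfl⟩
  · rw [h5x] at hcos
    generalize Real.cos x = c at *
    have : ((c - 1) * (c + 1)) * ((4 * c ^ 2 - 2 * c - 1) * (4 * c ^ 2 + 2 * c - 1)) ^ 2 = 0 := by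
      linear_combination hcos
    rcases mul_eq_zero.1 this with h | h
    · rcases mul_eq_zero.1 h with h | h
      · exact ⟨1, 0, by push_cast; linarith, fun _ ↦ rfl⟩
      · exact ⟨-1, 0, by push_cast; linarith, fun _ ↦ rfl⟩
    · rcases mul_eq_zero.1 (pow_eq_zero_iff two_ne_zero |>.1 h) with h | h
      · have : (4 * c - 1 - s) * (4 * c - 1 + s) = 0 := by linear_combination 4 * h - h5
        rcases mul_eq_zero.1 this with h | h
        · exact ⟨1 / 4, 1 / 4, by push_cast; linarith, by norm_num⟩
        · exact ⟨1 / 4, -1 / 4, by push_cast; linarith, by norm_num⟩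
      · have : (4 * c + 1 - s) * (4 * c + 1 + s) = 0 := by linear_combination 4 * h - h5
        rcases mul_eq_zero.1 this with h | h
        · exact ⟨-1 / 4, 1 / 4, by push_cast; linarith, by norm_num⟩
        · exact ⟨-1 / 4, -1 / 4, by push_cast; linarith, by norm_num⟩

theorem cos_linear_independence_two_quadratic (r1 r2 : ℚ)
    (h1 : ¬ ∃ k : ℤ, r1 - r2 = (k : ℚ)) (h2 : ¬ ∃ k : ℤ, r1 + r2 = (k : ℚ))
    (d : ℤ) (hd2 : 2 ≤ d) (hdsf : Squarefree d)
    (hg1 : Int.gcd d (r1.den : ℤ) = 1) (hg2 : Int.gcd d (r2.den : ℤ) = 1) :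
    (∀ a b c : ℝ,
        a ∈ IntermediateField.adjoin ℚ {Real.sqrt (d : ℝ)} →
        b ∈ IntermediateField.adjoin ℚ {Real.sqrt (d : ℝ)} →
        c ∈ IntermediateField.adjoin ℚ {Real.sqrt (d : ℝ)} →
        a * 1 + b * Real.cos (Real.pi * (r1 : ℝ)) + c * Real.cos (Real.pi * (r2 : ℝ)) = 0 →
        a = 0 ∧ b = 0 ∧ c = 0) ↔
    (4 ≤ r1.den ∧ 4 ≤ r2.den ∧ (r1.den, r2.den) ≠ (5, 5)) := by
  constructor
  · intro H
    have hmem (q : ℚ) : (q : ℝ) ∈ ℚ⟮Real.sqrt (d : ℝ)⟯ := _root_.algebraMap_mem _ q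
    have H' (a b c : ℚ) (h : a + b * Real.cos (Real.pi * r1) + c * Real.cos (Real.pi * r2) = 0) :
        b = 0 ∧ c = 0 := by
      have := (H a b c (hmem a) (hmem b) (hmem c) (by rwa [mul_one])).2
      exact_mod_cast this
    refine ⟨?_, ?_, ?_⟩
    · by_contra! hr
      obtain ⟨p, q, h, hq⟩ := exists_cos_pi_mul_eq_of_den r1 (.inl (by omega))
      obtain rfl := hq (by omega)
      exact one_ne_zero (H' (-p) 1 0 (by rw [h]; push_cast; ring)).1
    · by_contra! hr
      obtain ⟨p, q, h, hq⟩ := exists_cos_pi_mul_eq_of_den r2 (.inl (by omega))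
      obtain rfl := hq (by omega)
      exact one_ne_zero (H' (-p) 0 1 (by rw [h]; push_cast; ring)).2
    · rw [Ne, Prod.mk.injEq]
      rintro ⟨h₁, h₂⟩
      obtain ⟨p₁, q₁, h₁, -⟩ := exists_cos_pi_mul_eq_of_den r1 (.inr h₁)
      obtain ⟨p₂, q₂, h₂, -⟩ := exists_cos_pi_mul_eq_of_den r2 (.inr h₂)
      obtain ⟨-, rfl⟩ := H' (q₂ * p₁ - q₁ * p₂) (-q₂) q₁ (by rw [h₁, h₂]; push_cast; ring)
      exact one_ne_zero (H' (-p₁) 1 0 (by rw [h₁]; push_cast; ring)).1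
  · rintro ⟨h4₁, h4₂, h55⟩ a b c ha hb hc h
    obtain ⟨m₁, a₁, k₁, h5₁, hm₁, ha₁, hr₁, hfive₁, hd₁⟩ := exists_eq_two_mul_div_add_int r1 h4₁
    obtain ⟨m₂, a₂, k₂, h5₂, hm₂, ha₂, hr₂, hfive₂, hd₂⟩ := exists_eq_two_mul_div_add_int r2 h4₂
    have hm₁0 : m₁ ≠ 0 := by omega
    have hm₂0 : m₂ ≠ 0 := by omega
    obtain ⟨x, x', rfl⟩ := exists_eq_add_mul_sqrt_of_mem_adjoin (by omega) ha
    obtain ⟨y, y', rfl⟩ := exists_eq_add_mul_sqrt_of_mem_adjoin (by omega) hb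
    obtain ⟨z, z', rfl⟩ := exists_eq_add_mul_sqrt_of_mem_adjoin (by omega) hc
    rw [cos_pi_mul_eq_cosFrac hr₁, cos_pi_mul_eq_cosFrac hr₂] at h
    have hs₁ : ((-1) ^ k₁ : ℚ) ≠ 0 := zpow_ne_zero _ (by norm_num)
    have hs₂ : ((-1) ^ k₂ : ℚ) ≠ 0 := zpow_ne_zero _ (by norm_num)
    generalize ((-1) ^ k₁ : ℚ) = s₁ at *
    generalize ((-1) ^ k₂ : ℚ) = s₂ at *
    have hrat {u v w : ℚ}
        (h : u + (v * s₁ : ℚ) * cosFrac m₁ a₁ + (w * s₂ : ℚ) * cosFrac m₂ a₂ = 0) :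
        u = 0 ∧ v = 0 ∧ w = 0 := by
      have := eq_zero_of_cosFrac_relation h5₁ h5₂ hm₁ hm₂ ha₁ ha₂ ?_ ?_ ?_ h
      · simpa [hs₁, hs₂] using this
      · rintro ⟨e₁, e₂⟩
        exact h55 (by rw [hfive₁ e₁, hfive₂ e₂])
      · rintro rfl ⟨q, hq⟩
        refine h1 ⟨q + k₁ - k₂, ?_⟩
        have hq' : (2 * (a₁ - a₂) : ℚ) = m₁ * q := by exact_mod_cast hq
        have : (m₁ : ℚ) ≠ 0 := by exact_mod_cast hm₁0
        rw [hr₁, hr₂]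
        push_cast
        field_simp
        linear_combination hq'
      · rintro rfl ⟨q, hq⟩
        refine h2 ⟨q + k₁ + k₂, ?_⟩
        have hq' : (2 * (a₁ + a₂) : ℚ) = m₁ * q := by exact_mod_cast hq
        have : (m₁ : ℚ) ≠ 0 := by exact_mod_cast hm₁0
        rw [hr₁, hr₂]
        push_cast
        field_simp
        linear_combination hq'
    obtain ⟨e, e'⟩ := eq_zero_of_add_sqrt_mul_eq_zero hd2 hdsf hm₁0 hm₂0
      (hd₁ d (Int.isCoprime_iff_gcd_eq_one.2 hg1)) (hd₂ d (Int.isCoprime_iff_gcd_eq_one.2 hg2))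
      (a₁ := a₁) (a₂ := a₂) (a := x) (b := y * s₁) (c := z * s₂) (a' := x') (b' := y' * s₁)
      (c' := z' * s₂) (by push_cast; linear_combination h)
    obtain ⟨rfl, rfl, rfl⟩ := hrat e
    obtain ⟨rfl, rfl, rfl⟩ := hrat e'
    simp
end

section
/- Let r1, r2, r3 be positive rational numbers with r1 + r2 + r3 = 1 (the angles of a rational triangle are π·r1, π·r2, π·r3), and let N(Δ) denote the least common multiple of N(r1), N(r2), N(r3). Then the following are equivalent: (i) there exist positive real numbers x1, x2, x3, each of degree at most 2 over ℚ, such that x1/x2 = sin(π·r1)/sin(π·r2) and x2/x3 = sin(π·r2)/sin(π·r3); (ii) N(Δ) ∈ {3, 4, 5, 6, 12}. -/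
open Polynomial

theorem exists_quadratic_of_natDegree_minpoly_le_two {x : ℝ} (hx : IsAlgebraic ℚ x)
    (hd : (minpoly ℚ x).natDegree ≤ 2) : ∃ b c : ℚ, x ^ 2 + b * x + c = 0 := by
  have hm : (minpoly ℚ x).Monic := minpoly.monic hx.isIntegral
  set q := minpoly ℚ x * X ^ (2 - (minpoly ℚ x).natDegree) with hq
  have hqm : q.Monic := hm.mul (monic_X_pow _)
  have hqd : q.natDegree = 2 := by
    rw [hq, hm.natDegree_mul (monic_X_pow _), natDegree_X_pow]; omega
  have h0 : aeval x q = 0 := by simp [hq]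
  have h2 : q.coeff 2 = 1 := by rw [← hqd]; exact hqm
  refine ⟨q.coeff 1, q.coeff 0, ?_⟩
  rw [aeval_eq_sum_range, hqd] at h0
  simp only [Finset.sum_range_succ, Finset.sum_range_zero, Rat.smul_def, h2] at h0
  push_cast at h0
  linarith

theorem natDegree_minpoly_le_two_of_quadratic {x : ℝ} (b c : ℚ) (h : x ^ 2 + b * x + c = 0) :
    IsAlgebraic ℚ x ∧ (minpoly ℚ x).natDegree ≤ 2 := by
  have hm : (C 1 * X ^ 2 + C b * X + C c : ℚ[X]).natDegree = 2 :=
    natDegree_quadratic one_ne_zero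
  have hne : (C 1 * X ^ 2 + C b * X + C c : ℚ[X]) ≠ 0 := by
    intro h0; rw [h0] at hm; simp at hm
  have h0 : aeval x (C 1 * X ^ 2 + C b * X + C c : ℚ[X]) = 0 := by
    simpa using h
  exact ⟨⟨_, hne, h0⟩, hm ▸ natDegree_le_of_dvd (minpoly.dvd ℚ x h0) hne⟩

theorem map_map_eq_of_quadratic {A : Type*} [Field A] [Algebra ℚ A] (σ : A →ₐ[ℚ] A)
    {x : A} {b c : ℚ} (h : x ^ 2 + algebraMap ℚ A b * x + algebraMap ℚ A c = 0) :
    σ (σ x) = x := by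
  have h1 := congrArg σ h
  have h2 := congrArg σ h1
  simp only [map_add, map_mul, map_pow, AlgHom.commutes, map_zero] at h1 h2
  have e1 : (σ x - x) * (σ x + x + algebraMap ℚ A b) = 0 := by linear_combination h1 - h
  rcases mul_eq_zero.1 e1 with e | e
  · rw [sub_eq_zero.1 e, sub_eq_zero.1 e]
  · have e2 := congrArg σ e
    simp only [map_add, AlgHom.commutes, map_zero] at e2
    linear_combination e2 - e

theorem eq_or_eq_inv_of_add_inv_eq {A : Type*} [Field A] {w z : A} (hw : w ≠ 0) (hz : z ≠ 0)
    (h : w + w⁻¹ = z + z⁻¹) : w = z ∨ w = z⁻¹ := by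
  have : (w - z) * (w - z⁻¹) = 0 := by
    have h1 := mul_inv_cancel₀ hw
    have h2 := mul_inv_cancel₀ hz
    linear_combination w * h - h1 + h2
  rcases mul_eq_zero.1 this with e | e
  · exact .inl (sub_eq_zero.1 e)
  · exact .inr (sub_eq_zero.1 e)

theorem add_inv_fixed {A : Type*} [Field A] (τ : A →+* A) {x y t z : A} (hx : x ≠ 0) (hy : y ≠ 0)
    (hz : z ≠ 0) (fx : τ x = x) (fy : τ y = y) (ft : τ t = t)
    (h : (z + z⁻¹) * (x * y) = x ^ 2 + y ^ 2 - t ^ 2) : τ z = z ∨ τ z = z⁻¹ := by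
  refine eq_or_eq_inv_of_add_inv_eq (by simpa using hz) hz ?_
  have h' := congrArg τ h
  simp only [map_add, map_sub, map_mul, map_pow, map_inv₀, fx, fy, ft] at h'
  exact mul_right_cancel₀ (mul_ne_zero hx hy) (h'.trans h.symm)

theorem sub_inv_same_sign {A : Type*} [Field A] [CharZero A] (τ : A →+* A) {x y u v : A}
    (hx : x ≠ 0) (hv : v - v⁻¹ ≠ 0) (fx : τ x = x) (fy : τ y = y)
    (h : x * (v - v⁻¹) = y * (u - u⁻¹)) (hu : τ u = u) : τ v ≠ v⁻¹ := by
  intro e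
  have h' := congrArg τ h
  simp only [map_sub, map_mul, map_inv₀, fx, fy, hu, e, inv_inv] at h'
  have : (2 : A) * (x * (v - v⁻¹)) = 0 := by linear_combination h - h'
  exact (mul_ne_zero two_ne_zero (mul_ne_zero hx hv)) this

theorem triangle_root_map {A : Type*} [Field A] [CharZero A] (τ : A →+* A)
    {x₁ x₂ x₃ z₁ z₂ z₃ : A} (hx₁ : x₁ ≠ 0) (hx₂ : x₂ ≠ 0) (hx₃ : x₃ ≠ 0)
    (hz₁ : z₁ ≠ 0) (hz₂ : z₂ ≠ 0) (hz₃ : z₃ ≠ 0)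
    (hs₁ : z₁ - z₁⁻¹ ≠ 0) (hs₂ : z₂ - z₂⁻¹ ≠ 0) (hs₃ : z₃ - z₃⁻¹ ≠ 0)
    (f₁ : τ x₁ = x₁) (f₂ : τ x₂ = x₂) (f₃ : τ x₃ = x₃)
    (h₁₂ : x₁ * (z₂ - z₂⁻¹) = x₂ * (z₁ - z₁⁻¹)) (h₂₃ : x₂ * (z₃ - z₃⁻¹) = x₃ * (z₂ - z₂⁻¹))
    (c₁ : (z₁ + z₁⁻¹) * (x₂ * x₃) = x₂ ^ 2 + x₃ ^ 2 - x₁ ^ 2)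
    (c₂ : (z₂ + z₂⁻¹) * (x₃ * x₁) = x₃ ^ 2 + x₁ ^ 2 - x₂ ^ 2)
    (c₃ : (z₃ + z₃⁻¹) * (x₁ * x₂) = x₁ ^ 2 + x₂ ^ 2 - x₃ ^ 2) :
    (τ z₁ = z₁ ∧ τ z₂ = z₂ ∧ τ z₃ = z₃) ∨ (τ z₁ = z₁⁻¹ ∧ τ z₂ = z₂⁻¹ ∧ τ z₃ = z₃⁻¹) := by
  have d₁ := add_inv_fixed τ hx₂ hx₃ hz₁ f₂ f₃ f₁ c₁
  have d₂ := add_inv_fixed τ hx₃ hx₁ hz₂ f₃ f₁ f₂ c₂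
  have d₃ := add_inv_fixed τ hx₁ hx₂ hz₃ f₁ f₂ f₃ c₃
  have m₁ := sub_inv_same_sign τ hx₁ hs₂ f₁ f₂ h₁₂
  have m₂ := sub_inv_same_sign τ hx₂ hs₁ f₂ f₁ h₁₂.symm
  have m₃ := sub_inv_same_sign τ hx₂ hs₃ f₂ f₃ h₂₃
  have m₄ := sub_inv_same_sign τ hx₃ hs₂ f₃ f₂ h₂₃.symm
  tauto


theorem exists_algHom_pow {A : Type*} [Field A] [CharZero A] [Algebra ℚ A] [Normal ℚ A]
    {n : ℕ} (hn : 0 < n) {ζ : A} (hζ : IsPrimitiveRoot ζ n) {a : ℕ} (ha : a.Coprime n) :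
    ∃ σ : A →ₐ[ℚ] A, σ ζ = ζ ^ a := by
  have h : IsConjRoot ℚ ζ (ζ ^ a) := by
    have e : ∀ {μ : A}, IsPrimitiveRoot μ n → minpoly ℚ μ = cyclotomic n ℚ := by
      intro μ hμ
      convert (cyclotomic_eq_minpoly_rat hμ hn).symm
      exact Subsingleton.elim _ _
    rw [IsConjRoot, e hζ, e (hζ.pow_of_coprime a ha)]
  obtain ⟨σ, hσ⟩ := isConjRoot_iff_exists_algEquiv.1 h.symm
  exact ⟨σ, hσ⟩

theorem normal_algebraicClosure_rat_complex : Normal ℚ (algebraicClosure ℚ ℂ) := by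
  have h : @Normal ℚ (algebraicClosure ℚ ℂ) _ _ (algebraicClosure ℚ ℂ).algebra' :=
    IsAlgClosure.normal _ _
  convert h
  exact Subsingleton.elim _ _

theorem mem_of_forall_coprime_sq {N : ℕ} (hN : 3 ≤ N)
    (h : ∀ a : ℕ, a.Coprime (2 * N) → (((2 * N : ℕ) : ℤ) ∣ (a : ℤ) ^ 2 - 1 ∨
      ((2 * N : ℕ) : ℤ) ∣ (a : ℤ) ^ 2 + 1)) :
    N ∈ ({3, 4, 5, 6, 12} : Set ℕ) := by
  simp only [Set.mem_insert_iff, Set.mem_singleton_iff]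
  suffices h2 : 2 * N ∣ 8 ∨ 2 * N ∣ 10 ∨ 2 * N ∣ 24 ∨ (2 * N ∣ 26 ∧ 3 ∣ N) by
    have h1 : N ≤ 13 := by
      rcases h2 with h | h | h | ⟨h, -⟩ <;> have := Nat.le_of_dvd (by norm_num) h <;> omega
    clear h
    interval_cases N <;> revert h2 <;> decide
  by_cases h3 : 3 ∣ N
  · by_cases h5 : 5 ∣ N
    · exfalso
      have h15 : 15 ∣ 2 * N := by omega
      have : NeZero (2 * N) := ⟨by omega⟩
      obtain ⟨u, hu⟩ := ZMod.unitsMap_surjective h15 (ZMod.unitOfCoprime 2 (by norm_num))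
      have hu2 : ((ZMod.val (u : ZMod (2 * N)) : ℕ) : ZMod 15) = 2 := by
        have := congrArg (Units.val) hu
        simpa [ZMod.unitsMap_def, ZMod.natCast_val] using this
      have hc := h _ (ZMod.val_coe_unit_coprime u)
      have hd : ((15 : ℕ) : ℤ) ∣ ((2 * N : ℕ) : ℤ) := by exact_mod_cast h15
      rcases hc with hc | hc
      · have := (ZMod.intCast_zmod_eq_zero_iff_dvd _ 15).2 (hd.trans hc)
        push_cast at this
        rw [hu2] at this
        revert this; decide
      · have := (ZMod.intCast_zmod_eq_zero_iff_dvd _ 15).2 (hd.trans hc)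
        push_cast at this
        rw [hu2] at this
        revert this; decide
    · have hc : (5 : ℕ).Coprime (2 * N) :=
        (Nat.Prime.coprime_iff_not_dvd (by norm_num)).2 (by omega)
      rcases h 5 hc with h | h
      · exact .inr (.inr (.inl (by norm_num at h; exact_mod_cast h)))
      · exact .inr (.inr (.inr ⟨by norm_num at h; exact_mod_cast h, h3⟩))
  · have hc : (3 : ℕ).Coprime (2 * N) :=
      (Nat.Prime.coprime_iff_not_dvd (by norm_num)).2 (by omega)
    rcases h 3 hc with h | h
    · exact .inl (by norm_num at h; exact_mod_cast h)
    · exact .inr (.inl (by norm_num at h; exact_mod_cast h))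

theorem two_mul_cos_mul_sin_mul_sin {a b c : ℝ} (h : a + b + c = Real.pi) :
    2 * Real.cos c * (Real.sin a * Real.sin b) =
      Real.sin a ^ 2 + Real.sin b ^ 2 - Real.sin c ^ 2 := by
  obtain rfl : c = Real.pi - (a + b) := by linarith
  rw [Real.sin_pi_sub, Real.cos_pi_sub, Real.sin_add, Real.cos_add]
  linear_combination Real.sin a ^ 2 * Real.sin_sq_add_cos_sq b +
    Real.sin b ^ 2 * Real.sin_sq_add_cos_sq a

theorem exp_mul_I_add_inv (t : ℝ) :
    Complex.exp (t * Complex.I) + (Complex.exp (t * Complex.I))⁻¹ = ((2 * Real.cos t : ℝ) : ℂ) := by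
  rw [← Complex.exp_neg, ← neg_mul]
  push_cast
  rw [Complex.cos]
  ring

theorem exp_mul_I_sub_inv (t : ℝ) :
    Complex.exp (t * Complex.I) - (Complex.exp (t * Complex.I))⁻¹ =
      ((2 * Real.sin t : ℝ) : ℂ) * Complex.I := by
  rw [← Complex.exp_neg, ← neg_mul]
  push_cast
  rw [Complex.sin]
  linear_combination (-Complex.exp (-t * Complex.I) + Complex.exp (t * Complex.I)) * Complex.I_sq

theorem Rat.eq_num_mul_div_div {r : ℚ} {N : ℕ} (hN : N ≠ 0) (h : r.den ∣ N) :
    r = ((r.num * (N / r.den : ℕ) : ℤ) : ℚ) / N := by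
  obtain ⟨m, rfl⟩ := h
  have h1 : (r.den : ℚ) ≠ 0 := by exact_mod_cast r.den_ne_zero
  have h2 : (m : ℚ) ≠ 0 := by
    rintro h; apply hN; rw [Nat.cast_eq_zero.1 h, mul_zero]
  rw [Nat.mul_div_cancel_left _ r.den_pos]
  push_cast
  rw [mul_div_mul_right _ _ h2, Rat.num_div_den]

theorem exists_bezout_of_lcm_den {r₁ r₂ r₃ : ℚ} {k₁ k₂ k₃ : ℤ} {N : ℕ} (hN : 0 < N)
    (hlcm : Nat.lcm (Nat.lcm r₁.den r₂.den) r₃.den = N)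
    (h₁ : r₁ = k₁ / N) (h₂ : r₂ = k₂ / N) (h₃ : r₃ = k₃ / N) (hsum : k₁ + k₂ + k₃ = N) :
    ∃ u v w : ℤ, u * k₁ + v * k₂ + w * k₃ = 1 := by
  set d := Int.gcd (Int.gcd k₁ k₂) k₃ with hd
  have d0 : (d : ℤ) ∣ Int.gcd k₁ k₂ := Int.gcd_dvd_left _ _
  have d₁ : (d : ℤ) ∣ k₁ := d0.trans (Int.gcd_dvd_left _ _)
  have d₂ : (d : ℤ) ∣ k₂ := d0.trans (Int.gcd_dvd_right _ _)
  have d₃ : (d : ℤ) ∣ k₃ := Int.gcd_dvd_right _ _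
  have dN : d ∣ N := by
    have : (d : ℤ) ∣ N := hsum ▸ dvd_add (dvd_add d₁ d₂) d₃
    exact_mod_cast this
  obtain ⟨M, hM⟩ := dN
  have hdpos : 0 < d := Nat.pos_of_ne_zero fun h ↦ by rw [h, zero_mul] at hM; omega
  have key : ∀ {r : ℚ} {k : ℤ}, r = k / N → (d : ℤ) ∣ k → r.den ∣ M := by
    rintro r k hr ⟨j, rfl⟩
    have hd0 : (d : ℚ) ≠ 0 := by exact_mod_cast hdpos.ne'
    have e : r = (j : ℚ) / ((M : ℤ) : ℚ) := by
      rw [hr, hM]; push_cast; exact mul_div_mul_left _ _ hd0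
    have := Rat.den_dvd j M
    rw [Rat.divInt_eq_div, ← e] at this
    exact_mod_cast this
  have hNM : N ∣ M := hlcm ▸ Nat.lcm_dvd (Nat.lcm_dvd (key h₁ d₁) (key h₂ d₂)) (key h₃ d₃)
  have hMpos : 0 < M := Nat.pos_of_ne_zero fun h ↦ by rw [h, mul_zero] at hM; omega
  have hd1 : d = 1 := by
    have := Nat.le_of_dvd hMpos hNM
    nlinarith
  have e1 := Int.gcd_eq_gcd_ab (Int.gcd k₁ k₂) k₃
  rw [← hd, hd1, Int.gcd_eq_gcd_ab k₁ k₂] at e1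
  generalize Int.gcdA (k₁ * Int.gcdA k₁ k₂ + k₂ * Int.gcdB k₁ k₂) k₃ = p at e1
  generalize Int.gcdB (k₁ * Int.gcdA k₁ k₂ + k₂ * Int.gcdB k₁ k₂) k₃ = q at e1
  exact ⟨Int.gcdA k₁ k₂ * p, Int.gcdB k₁ k₂ * p, q, by push_cast at e1; linear_combination -e1⟩

theorem sq_congr_of_triangle_roots {A : Type*} [Field A] [CharZero A] [Algebra ℚ A]
    [Normal ℚ A] {n : ℕ} (hn : 0 < n) {ζ : A} (hζ : IsPrimitiveRoot ζ n) {k₁ k₂ k₃ u₁ u₂ u₃ : ℤ} (hu : u₁ * k₁ + u₂ * k₂ + u₃ * k₃ = 1)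
    {x₁ x₂ x₃ z₁ z₂ z₃ : A} (hx₁ : x₁ ≠ 0) (hx₂ : x₂ ≠ 0) (hx₃ : x₃ ≠ 0)
    (hz₁ : z₁ = ζ ^ k₁) (hz₂ : z₂ = ζ ^ k₂) (hz₃ : z₃ = ζ ^ k₃)
    (hs₁ : z₁ - z₁⁻¹ ≠ 0) (hs₂ : z₂ - z₂⁻¹ ≠ 0) (hs₃ : z₃ - z₃⁻¹ ≠ 0)
    (q₁ : ∃ b c : ℚ, x₁ ^ 2 + algebraMap ℚ A b * x₁ + algebraMap ℚ A c = 0)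
    (q₂ : ∃ b c : ℚ, x₂ ^ 2 + algebraMap ℚ A b * x₂ + algebraMap ℚ A c = 0)
    (q₃ : ∃ b c : ℚ, x₃ ^ 2 + algebraMap ℚ A b * x₃ + algebraMap ℚ A c = 0)
    (h₁₂ : x₁ * (z₂ - z₂⁻¹) = x₂ * (z₁ - z₁⁻¹)) (h₂₃ : x₂ * (z₃ - z₃⁻¹) = x₃ * (z₂ - z₂⁻¹))
    (c₁ : (z₁ + z₁⁻¹) * (x₂ * x₃) = x₂ ^ 2 + x₃ ^ 2 - x₁ ^ 2)
    (c₂ : (z₂ + z₂⁻¹) * (x₃ * x₁) = x₃ ^ 2 + x₁ ^ 2 - x₂ ^ 2)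
    (c₃ : (z₃ + z₃⁻¹) * (x₁ * x₂) = x₁ ^ 2 + x₂ ^ 2 - x₃ ^ 2) {a : ℕ} (ha : a.Coprime n) :
    (n : ℤ) ∣ (a : ℤ) ^ 2 - 1 ∨ (n : ℤ) ∣ (a : ℤ) ^ 2 + 1 := by
  obtain ⟨σ, hσ⟩ := exists_algHom_pow hn hζ ha
  obtain ⟨_, _, q₁⟩ := q₁
  obtain ⟨_, _, q₂⟩ := q₂
  obtain ⟨_, _, q₃⟩ := q₃
  have hζ0 : ζ ≠ 0 := hζ.ne_zero hn.ne'
  let τ : A →+* A := (σ.comp σ).toRingHom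
  have hτζ : τ ζ = ζ ^ ((a : ℤ) ^ 2) := by
    change σ (σ ζ) = _
    rw [hσ, map_pow, hσ, ← pow_mul, ← sq]
    exact_mod_cast rfl
  have hprod : ζ = z₁ ^ u₁ * z₂ ^ u₂ * z₃ ^ u₃ := by
    rw [hz₁, hz₂, hz₃, ← zpow_mul, ← zpow_mul, ← zpow_mul, ← zpow_add₀ hζ0, ← zpow_add₀ hζ0,
      mul_comm k₁, mul_comm k₂, mul_comm k₃, hu, zpow_one]
  have hτprod : τ ζ = τ z₁ ^ u₁ * τ z₂ ^ u₂ * τ z₃ ^ u₃ := by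
    conv_lhs => rw [hprod]
    simp only [map_mul, map_zpow₀]
  rcases triangle_root_map τ hx₁ hx₂ hx₃ (hz₁ ▸ zpow_ne_zero _ hζ0) (hz₂ ▸ zpow_ne_zero _ hζ0)
    (hz₃ ▸ zpow_ne_zero _ hζ0) hs₁ hs₂ hs₃ (map_map_eq_of_quadratic σ q₁)
    (map_map_eq_of_quadratic σ q₂) (map_map_eq_of_quadratic σ q₃)
    h₁₂ h₂₃ c₁ c₂ c₃ with ⟨e₁, e₂, e₃⟩ | ⟨e₁, e₂, e₃⟩
  · left
    rw [e₁, e₂, e₃, ← hprod, hτζ] at hτprod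
    rw [← hζ.zpow_eq_one_iff_dvd, zpow_sub₀ hζ0, hτprod, zpow_one, div_self hζ0]
  · right
    rw [e₁, e₂, e₃, inv_zpow, inv_zpow, inv_zpow, ← mul_inv, ← mul_inv, ← hprod, hτζ] at hτprod
    rw [← hζ.zpow_eq_one_iff_dvd, zpow_add₀ hζ0, hτprod, zpow_one, inv_mul_cancel₀ hζ0]

theorem sq_congr_of_quadratic_sides {N : ℕ} (hN : 0 < N) {k₁ k₂ k₃ u₁ u₂ u₃ : ℤ}
    (hu : u₁ * k₁ + u₂ * k₂ + u₃ * k₃ = 1) {t₁ t₂ t₃ x₁ x₂ x₃ : ℝ}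
    (ht₁ : t₁ = Real.pi * (k₁ / N)) (ht₂ : t₂ = Real.pi * (k₂ / N)) (ht₃ : t₃ = Real.pi * (k₃ / N))
    (hs₁ : Real.sin t₁ ≠ 0) (hs₂ : Real.sin t₂ ≠ 0) (hs₃ : Real.sin t₃ ≠ 0)
    (hsum : t₁ + t₂ + t₃ = Real.pi) (hx₁ : x₁ ≠ 0) (hx₂ : x₂ ≠ 0) (hx₃ : x₃ ≠ 0)
    (q₁ : ∃ b c : ℚ, x₁ ^ 2 + b * x₁ + c = 0) (q₂ : ∃ b c : ℚ, x₂ ^ 2 + b * x₂ + c = 0)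
    (q₃ : ∃ b c : ℚ, x₃ ^ 2 + b * x₃ + c = 0)
    (h₁₂ : x₁ / x₂ = Real.sin t₁ / Real.sin t₂) (h₂₃ : x₂ / x₃ = Real.sin t₂ / Real.sin t₃)
    {a : ℕ} (ha : a.Coprime (2 * N)) :
    ((2 * N : ℕ) : ℤ) ∣ (a : ℤ) ^ 2 - 1 ∨ ((2 * N : ℕ) : ℤ) ∣ (a : ℤ) ^ 2 + 1 := by
  have := normal_algebraicClosure_rat_complex
  obtain ⟨φ, hφ⟩ : ∃ φ : algebraicClosure ℚ ℂ →+* ℂ,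
      ∀ x : ℂ, IsAlgebraic ℚ x → ∃ X, φ X = x :=
    ⟨(algebraicClosure ℚ ℂ).val.toRingHom, fun x hx ↦ ⟨⟨x, mem_algebraicClosure_iff.2 hx⟩, rfl⟩⟩
  have hN0 : (N : ℂ) ≠ 0 := by exact_mod_cast hN.ne'
  obtain ⟨s, e₁, e₂, e₃⟩ : ∃ s, x₁ = s * Real.sin t₁ ∧ x₂ = s * Real.sin t₂ ∧
      x₃ = s * Real.sin t₃ := by
    rw [div_eq_div_iff hx₂ hs₂] at h₁₂
    rw [div_eq_div_iff hx₃ hs₃] at h₂₃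
    refine ⟨x₂ / Real.sin t₂, ?_, ?_, ?_⟩ <;> field_simp <;> linarith
  have law : ∀ {a b c x y z : ℝ}, a + b + c = Real.pi → x = s * Real.sin a → y = s * Real.sin b →
      z = s * Real.sin c → 2 * Real.cos c * (x * y) = x ^ 2 + y ^ 2 - z ^ 2 := by
    rintro a b c x y z h rfl rfl rfl
    linear_combination s ^ 2 * two_mul_cos_mul_sin_mul_sin h
  set ζ : ℂ := Complex.exp (2 * Real.pi * Complex.I / (2 * N : ℕ)) with hζdef
  have hζ : IsPrimitiveRoot ζ (2 * N) := Complex.isPrimitiveRoot_exp _ (by omega)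
  obtain ⟨Z, hZ⟩ := hφ ζ (hζ.isIntegral (by omega)).tower_top.isAlgebraic
  have hZ' : IsPrimitiveRoot Z (2 * N) :=
    .of_map_of_injective (f := φ) (hZ.symm ▸ hζ) φ.injective
  have hz : ∀ {t : ℝ} {k : ℤ}, t = Real.pi * (k / N) → ζ ^ k = Complex.exp (t * Complex.I) := by
    rintro t k rfl
    rw [hζdef, ← Complex.exp_int_mul]
    congr 1
    push_cast
    field_simp
  have hsub : ∀ {t : ℝ} {k : ℤ}, t = Real.pi * (k / N) → Real.sin t ≠ 0 →
      Z ^ k - (Z ^ k)⁻¹ ≠ 0 := by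
    intro t k ht hs h
    have := congrArg φ h
    simp only [map_sub, map_inv₀, map_zpow₀, map_zero, hZ] at this
    rw [hz ht, exp_mul_I_sub_inv, mul_eq_zero, Complex.ofReal_eq_zero] at this
    exact this.elim (mul_ne_zero two_ne_zero hs) Complex.I_ne_zero
  have lift : ∀ {x : ℝ}, x ≠ 0 → (∃ b c : ℚ, x ^ 2 + b * x + c = 0) →
      ∃ X : algebraicClosure ℚ ℂ, φ X = x ∧ X ≠ 0 ∧
        ∃ b c : ℚ, X ^ 2 + algebraMap ℚ _ b * X + algebraMap ℚ _ c = 0 := by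
    rintro x hx ⟨b, c, h⟩
    obtain ⟨X, hX⟩ := hφ x ((natDegree_minpoly_le_two_of_quadratic b c h).1.algebraMap (A := ℂ))
    refine ⟨X, hX, ?_, b, c, φ.injective ?_⟩
    · rintro rfl
      rw [map_zero] at hX
      exact hx (Complex.ofReal_eq_zero.1 hX.symm)
    · have h' := congrArg (fun y : ℝ ↦ (y : ℂ)) h
      simpa [hX] using h'
  obtain ⟨X₁, hX₁, n₁, q₁⟩ := lift hx₁ q₁
  obtain ⟨X₂, hX₂, n₂, q₂⟩ := lift hx₂ q₂
  obtain ⟨X₃, hX₃, n₃, q₃⟩ := lift hx₃ q₃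
  refine sq_congr_of_triangle_roots (by omega) hZ' hu n₁ n₂ n₃
    rfl rfl rfl (hsub ht₁ hs₁) (hsub ht₂ hs₂) (hsub ht₃ hs₃) q₁ q₂ q₃
    ?_ ?_ ?_ ?_ ?_ ha <;> apply φ.injective <;>
    simp only [map_add, map_sub, map_mul, map_pow, map_inv₀, map_zpow₀, hZ, hX₁, hX₂, hX₃,
      hz ht₁, hz ht₂, hz ht₃, exp_mul_I_sub_inv, exp_mul_I_add_inv]
  · rw [e₁, e₂]; push_cast; ring
  · rw [e₂, e₃]; push_cast; ring
  · exact_mod_cast law (by linarith) e₂ e₃ e₁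
  · exact_mod_cast law (by linarith) e₃ e₁ e₂
  · exact_mod_cast law (by linarith) e₁ e₂ e₃

theorem quadratic_two_mul_sqrt_two_mul_sin (k : ℕ) (hk : 0 < k) (hk' : k < 12) :
    ∃ b c : ℚ, (2 * √2 * Real.sin (Real.pi * (k / 12))) ^ 2 +
      b * (2 * √2 * Real.sin (Real.pi * (k / 12))) + c = 0 := by
  have h2 : √2 ^ 2 = 2 := Real.sq_sqrt (by norm_num)
  have h3 : √3 ^ 2 = 3 := Real.sq_sqrt (by norm_num)
  wlog h6 : k ≤ 6 generalizing k
  · have := this (12 - k) (by omega) (by omega) (by omega)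
    rwa [Nat.cast_sub hk'.le, show Real.pi * (((12 : ℕ) - (k : ℝ)) / 12) =
      Real.pi - Real.pi * (k / 12) by push_cast; ring, Real.sin_pi_sub] at this
  interval_cases k
  · refine ⟨2, -2, ?_⟩
    rw [show Real.pi * ((1 : ℕ) / 12) = Real.pi / 3 - Real.pi / 4 by push_cast; ring,
      Real.sin_sub, Real.sin_pi_div_three, Real.cos_pi_div_three, Real.sin_pi_div_four,
      Real.cos_pi_div_four]
    rw [show 2 * √2 * (√3 / 2 * (√2 / 2) - 1 / 2 * (√2 / 2)) = √3 - 1 by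
      linear_combination (√3 - 1) / 2 * h2]
    push_cast
    linear_combination h3
  · refine ⟨0, -2, ?_⟩
    rw [show Real.pi * ((2 : ℕ) / 12) = Real.pi / 6 by push_cast; ring, Real.sin_pi_div_six]
    push_cast
    linear_combination h2
  · refine ⟨0, -4, ?_⟩
    rw [show Real.pi * ((3 : ℕ) / 12) = Real.pi / 4 by push_cast; ring, Real.sin_pi_div_four]
    push_cast
    linear_combination (√2 ^ 2 + 2) * h2
  · refine ⟨0, -6, ?_⟩
    rw [show Real.pi * ((4 : ℕ) / 12) = Real.pi / 3 by push_cast; ring, Real.sin_pi_div_three]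
    push_cast
    linear_combination √3 ^ 2 * h2 + 2 * h3
  · refine ⟨-2, -2, ?_⟩
    rw [show Real.pi * ((5 : ℕ) / 12) = Real.pi / 4 + Real.pi / 6 by push_cast; ring,
      Real.sin_add, Real.sin_pi_div_six, Real.cos_pi_div_six, Real.sin_pi_div_four,
      Real.cos_pi_div_four]
    rw [show 2 * √2 * (√2 / 2 * (√3 / 2) + √2 / 2 * (1 / 2)) = √3 + 1 by
      linear_combination (√3 + 1) / 2 * h2]
    push_cast
    linear_combination h3
  · refine ⟨0, -8, ?_⟩
    rw [show Real.pi * ((6 : ℕ) / 12) = Real.pi / 2 by push_cast; ring, Real.sin_pi_div_two]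
    push_cast
    linear_combination 4 * h2

theorem quadratic_sin_div_sin_pi_div_five (k : ℕ) (hk : 0 < k) (hk' : k < 5) :
    ∃ b c : ℚ, ((Real.sin (Real.pi / 5))⁻¹ * Real.sin (Real.pi * (k / 5))) ^ 2 +
      b * ((Real.sin (Real.pi / 5))⁻¹ * Real.sin (Real.pi * (k / 5))) + c = 0 := by
  have h0 : Real.sin (Real.pi / 5) ≠ 0 :=
    (Real.sin_pos_of_pos_of_lt_pi (by positivity) (by linarith [Real.pi_pos])).ne'
  have h5 : √5 ^ 2 = 5 := Real.sq_sqrt (by norm_num)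
  wlog h6 : k ≤ 2 generalizing k
  · have := this (5 - k) (by omega) (by omega) (by omega)
    rwa [Nat.cast_sub hk'.le, show Real.pi * (((5 : ℕ) - (k : ℝ)) / 5) =
      Real.pi - Real.pi * (k / 5) by push_cast; ring, Real.sin_pi_sub] at this
  interval_cases k
  · refine ⟨-1, 0, ?_⟩
    rw [show Real.pi * ((1 : ℕ) / 5) = Real.pi / 5 by push_cast; ring, inv_mul_cancel₀ h0]
    norm_num
  · refine ⟨-1, -1, ?_⟩
    rw [show Real.pi * ((2 : ℕ) / 5) = 2 * (Real.pi / 5) by push_cast; ring, Real.sin_two_mul,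
      show (Real.sin (Real.pi / 5))⁻¹ * (2 * Real.sin (Real.pi / 5) * Real.cos (Real.pi / 5)) =
        2 * Real.cos (Real.pi / 5) by field_simp, Real.cos_pi_div_five]
    push_cast
    linear_combination h5 / 4

theorem exists_nat_div_of_den_dvd {r : ℚ} (h0 : 0 < r) (h1 : r < 1) {N : ℕ} (hN : N ≠ 0)
    (h : r.den ∣ N) : ∃ k : ℕ, 0 < k ∧ k < N ∧ r = (k : ℤ) / N := by
  have e := Rat.eq_num_mul_div_div hN h
  generalize r.num * ((N / r.den : ℕ) : ℤ) = j at e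
  have hNpos : (0 : ℚ) < N := by exact_mod_cast Nat.pos_of_ne_zero hN
  rw [e] at h0 h1
  have j0 : (0 : ℤ) < j := by exact_mod_cast (div_pos_iff_of_pos_right hNpos).1 h0
  have j1 : j < N := by exact_mod_cast (div_lt_one hNpos).1 h1
  lift j to ℕ using j0.le
  exact ⟨j, by exact_mod_cast j0, by exact_mod_cast j1, e⟩

theorem rational_high_school_triangle_classification (r1 r2 r3 : ℚ)
    (hr1 : 0 < r1) (hr2 : 0 < r2) (hr3 : 0 < r3) (hsum : r1 + r2 + r3 = 1) :
    (∃ x1 x2 x3 : ℝ, 0 < x1 ∧ 0 < x2 ∧ 0 < x3 ∧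
        (IsAlgebraic ℚ x1 ∧ (minpoly ℚ x1).natDegree ≤ 2) ∧
        (IsAlgebraic ℚ x2 ∧ (minpoly ℚ x2).natDegree ≤ 2) ∧
        (IsAlgebraic ℚ x3 ∧ (minpoly ℚ x3).natDegree ≤ 2) ∧
        x1 / x2 = Real.sin (Real.pi * (r1 : ℝ)) / Real.sin (Real.pi * (r2 : ℝ)) ∧
        x2 / x3 = Real.sin (Real.pi * (r2 : ℝ)) / Real.sin (Real.pi * (r3 : ℝ))) ↔
    Nat.lcm (Nat.lcm r1.den r2.den) r3.den ∈ ({3, 4, 5, 6, 12} : Set ℕ) := by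
  have sin_pos : ∀ {r : ℚ}, 0 < r → r < 1 → 0 < Real.sin (Real.pi * (r : ℝ)) := by
    intro r h0 h1
    have h0' : (0 : ℝ) < r := by exact_mod_cast h0
    have h1' : (r : ℝ) < 1 := by exact_mod_cast h1
    exact Real.sin_pos_of_pos_of_lt_pi (by positivity) (by nlinarith [Real.pi_pos])
  have s1 := sin_pos hr1 (by linarith)
  have s2 := sin_pos hr2 (by linarith)
  have s3 := sin_pos hr3 (by linarith)
  obtain ⟨N, hlcm⟩ : ∃ N, Nat.lcm (Nat.lcm r1.den r2.den) r3.den = N := ⟨_, rfl⟩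
  have hN0 : N ≠ 0 := hlcm ▸
    Nat.lcm_ne_zero (Nat.lcm_ne_zero r1.den_ne_zero r2.den_ne_zero) r3.den_ne_zero
  have dv1 : r1.den ∣ N := hlcm ▸ (Nat.dvd_lcm_left _ _).trans (Nat.dvd_lcm_left _ _)
  have dv2 : r2.den ∣ N := hlcm ▸ (Nat.dvd_lcm_right _ _).trans (Nat.dvd_lcm_left _ _)
  have dv3 : r3.den ∣ N := hlcm ▸ Nat.dvd_lcm_right _ _
  constructor
  · rintro ⟨x1, x2, x3, hx1, hx2, hx3, ⟨a1, d1⟩, ⟨a2, d2⟩, ⟨a3, d3⟩, h12, h23⟩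
    obtain ⟨k1, p1, -, e1⟩ := exists_nat_div_of_den_dvd hr1 (by linarith) hN0 dv1
    obtain ⟨k2, p2, -, e2⟩ := exists_nat_div_of_den_dvd hr2 (by linarith) hN0 dv2
    obtain ⟨k3, p3, -, e3⟩ := exists_nat_div_of_den_dvd hr3 (by linarith) hN0 dv3
    have hsumR : (r1 : ℝ) + r2 + r3 = 1 := by exact_mod_cast hsum
    have hk : k1 + k2 + k3 = N := by
      have hNR : (N : ℚ) ≠ 0 := by exact_mod_cast hN0
      rw [e1, e2, e3, ← add_div, ← add_div, div_eq_one_iff_eq hNR] at hsum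
      exact_mod_cast hsum
    obtain ⟨u, v, w, huvw⟩ := exists_bezout_of_lcm_den (k₁ := k1) (k₂ := k2) (k₃ := k3)
      (Nat.pos_of_ne_zero hN0) hlcm e1 e2
      e3 (by exact_mod_cast hk)
    rw [hlcm]
    refine mem_of_forall_coprime_sq (by omega) fun a ha ↦
      sq_congr_of_quadratic_sides (Nat.pos_of_ne_zero hN0) huvw (by rw [e1]; push_cast; rfl)
        (by rw [e2]; push_cast; rfl) (by rw [e3]; push_cast; rfl) s1.ne' s2.ne' s3.ne'
        (by rw [← mul_add, ← mul_add, hsumR, mul_one]) hx1.ne' hx2.ne' hx3.ne'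
        (exists_quadratic_of_natDegree_minpoly_le_two a1 d1)
        (exists_quadratic_of_natDegree_minpoly_le_two a2 d2)
        (exists_quadratic_of_natDegree_minpoly_le_two a3 d3) h12 h23 ha
  · rw [hlcm]
    intro hN
    have of_scale : ∀ s : ℝ, 0 < s →
        (∀ r : ℚ, 0 < r → r < 1 → r.den ∣ N → ∃ b c : ℚ,
          (s * Real.sin (Real.pi * (r : ℝ))) ^ 2 + b * (s * Real.sin (Real.pi * (r : ℝ))) + c = 0) →
        ∃ x1 x2 x3 : ℝ, 0 < x1 ∧ 0 < x2 ∧ 0 < x3 ∧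
        (IsAlgebraic ℚ x1 ∧ (minpoly ℚ x1).natDegree ≤ 2) ∧
        (IsAlgebraic ℚ x2 ∧ (minpoly ℚ x2).natDegree ≤ 2) ∧
        (IsAlgebraic ℚ x3 ∧ (minpoly ℚ x3).natDegree ≤ 2) ∧
        x1 / x2 = Real.sin (Real.pi * (r1 : ℝ)) / Real.sin (Real.pi * (r2 : ℝ)) ∧
        x2 / x3 = Real.sin (Real.pi * (r2 : ℝ)) / Real.sin (Real.pi * (r3 : ℝ)) := by
      intro s hs hq
      obtain ⟨b1, c1, q1⟩ := hq r1 hr1 (by linarith) dv1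
      obtain ⟨b2, c2, q2⟩ := hq r2 hr2 (by linarith) dv2
      obtain ⟨b3, c3, q3⟩ := hq r3 hr3 (by linarith) dv3
      exact ⟨_, _, _, mul_pos hs s1, mul_pos hs s2, mul_pos hs s3,
        natDegree_minpoly_le_two_of_quadratic b1 c1 q1,
        natDegree_minpoly_le_two_of_quadratic b2 c2 q2,
        natDegree_minpoly_le_two_of_quadratic b3 c3 q3,
        mul_div_mul_left _ _ hs.ne', mul_div_mul_left _ _ hs.ne'⟩
    by_cases h5 : N = 5
    · have h0 : 0 < Real.sin (Real.pi / 5) :=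
        Real.sin_pos_of_pos_of_lt_pi (by positivity) (by linarith [Real.pi_pos])
      refine of_scale _ (inv_pos.2 h0) fun r h0 h1 hd ↦ ?_
      obtain ⟨k, p, q, e⟩ := exists_nat_div_of_den_dvd h0 h1 (by norm_num) (h5 ▸ hd)
      rw [e]
      push_cast
      exact quadratic_sin_div_sin_pi_div_five k p q
    · have h12 : N ∣ 12 := by
        simp only [Set.mem_insert_iff, Set.mem_singleton_iff] at hN
        rcases hN with rfl | rfl | rfl | rfl | rfl <;> first | decide | exact absurd rfl h5
      refine of_scale (2 * √2) (by positivity) fun r h0 h1 hd ↦ ?_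
      obtain ⟨k, p, q, e⟩ := exists_nat_div_of_den_dvd h0 h1 (by norm_num) (hd.trans h12)
      rw [e]
      push_cast
      exact quadratic_two_mul_sqrt_two_mul_sin k p q
end

section
/- Let r be a rational number. Then the real numbers 1 and cos(π·r) are linearly independent over ℚ if and only if N(r) ≥ 4. -/
/-- A rational number in `[0, 1)` with denominator at most `3` is `0`, `1/2`, `1/3` or `2/3`. -/
theorem Rat.mem_of_den_lt_four {f : ℚ} (h0 : 0 ≤ f) (h1 : f < 1) (hd : f.den < 4) :
    f = 0 ∨ f = 1 / 2 ∨ f = 1 / 3 ∨ f = 2 / 3 := by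
  have hf : f = f.num / f.den := (Rat.num_div_den f).symm
  have hpos : 0 < f.den := f.den_pos
  have hnum : 0 ≤ f.num := Rat.num_nonneg.mpr h0
  have hlt : f.num < f.den := by
    rw [hf, div_lt_one (by positivity)] at h1
    exact_mod_cast h1
  generalize f.num = n at *
  generalize f.den = d at *
  interval_cases d <;> interval_cases n <;> norm_num [hf]

/-- If `r` has denominator at most `3`, then `cos (π r)` is rational. -/
theorem Real.exists_rat_eq_cos_pi_mul {r : ℚ} (hr : r.den < 4) :
    ∃ q : ℚ, Real.cos (Real.pi * r) = q := by
  have hfract : ∃ q : ℚ, Real.cos (Real.pi * (Int.fract r : ℚ)) = q := by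
    rcases Rat.mem_of_den_lt_four (Int.fract_nonneg r) (Int.fract_lt_one r)
      (by rwa [Rat.den_intFract]) with h | h | h | h <;> rw [h]
    · exact ⟨1, by simp⟩
    · refine ⟨0, ?_⟩
      push_cast
      rw [mul_one_div, Real.cos_pi_div_two]
    · refine ⟨1 / 2, ?_⟩
      push_cast
      rw [mul_one_div, Real.cos_pi_div_three]
    · refine ⟨-1 / 2, ?_⟩
      push_cast
      rw [show Real.pi * (2 / 3) = Real.pi - Real.pi / 3 by ring, Real.cos_pi_sub,
        Real.cos_pi_div_three]
      ring
  obtain ⟨q, hq⟩ := hfract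
  refine ⟨(-1) ^ ⌊r⌋ * q, ?_⟩
  have hsplit : Real.pi * (r : ℝ) = Real.pi * (Int.fract r : ℚ) + ⌊r⌋ * Real.pi := by
    rw [Int.fract]
    push_cast
    ring
  rw [hsplit, Real.cos_add_int_mul_pi, hq]
  push_cast
  rfl

theorem cos_linear_independence_one (r : ℚ) :
    LinearIndependent ℚ ![(1 : ℝ), Real.cos (Real.pi * (r : ℝ))] ↔ 4 ≤ r.den := by
  rw [LinearIndependent.pair_iff' one_ne_zero]
  constructor
  · intro h
    by_contra! hr
    obtain ⟨q, hq⟩ := Real.exists_rat_eq_cos_pi_mul hr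
    exact h q (by rw [hq, Rat.smul_def, mul_one])
  · intro hr q hq
    refine irrational_cos_rat_mul_pi (r := r) hr ⟨q, ?_⟩
    rw [mul_comm, ← hq, Rat.smul_def, mul_one]
end

section
/- The set { 2·cos(π·r) : r ∈ ℚ } ∩ ℚ equals {-2, -1, 0, 1, 2}. Equivalently, for a rational number r, if 2·cos(π·r) is rational then 2·cos(π·r) is an integer belonging to {-2, -1, 0, 1, 2}. -/
theorem niven_theorem :
    {x : ℝ | ∃ r : ℚ, x = 2 * Real.cos (Real.pi * (r : ℝ))} ∩
      {x : ℝ | ∃ q : ℚ, x = (q : ℝ)} = {-2, -1, 0, 1, 2} := by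
  have cos_two_thirds : Real.cos (Real.pi * (2 / 3)) = -1 / 2 := by
    rw [show Real.pi * (2 / 3) = Real.pi - Real.pi / 3 by ring, Real.cos_pi_sub,
      Real.cos_pi_div_three]
    norm_num
  ext x
  simp only [Set.mem_inter_iff, Set.mem_ofPred_eq, Set.mem_insert_iff, Set.mem_singleton_iff]
  constructor
  · rintro ⟨⟨r, rfl⟩, q, hq⟩
    have h := niven (θ := Real.pi * r) ⟨r, mul_comm _ _⟩ ⟨q / 2, by push_cast; linarith⟩
    simp only [Set.mem_insert_iff, Set.mem_singleton_iff] at h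
    rcases h with h | h | h | h | h <;> rw [h] <;> norm_num
  · rintro (rfl | rfl | rfl | rfl | rfl)
    · exact ⟨⟨1, by simp⟩, -2, by simp⟩
    · exact ⟨⟨2 / 3, by push_cast; rw [cos_two_thirds]; norm_num⟩, -1, by simp⟩
    · exact ⟨⟨1 / 2, by push_cast; rw [mul_one_div, Real.cos_pi_div_two, mul_zero]⟩, 0, by simp⟩
    · exact ⟨⟨1 / 3, by push_cast; rw [mul_one_div, Real.cos_pi_div_three]; norm_num⟩, 1, by simp⟩
    · exact ⟨⟨0, by simp⟩, 2, by simp⟩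
end

section
/- Let n be a squarefree positive integer. Then a(0,n) = 1, and the triple (a(1,n), a(2,n), a(3,n)) takes exactly one of the following eight values: (1,1,1), (1,1,0), (1,0,0), (1,0,-1), (-1,1,0), (-1,1,-1), (-1,0,1), (-1,0,0). -/
/-- The coefficient `a(j,n)` of `z^(φ(n)-j)` in the `n`-th cyclotomic polynomial,
with `a(j,n) = 0` for `j > φ(n)`. -/
noncomputable def cycCoeff (j n : ℕ) : ℤ :=
  if j ≤ n.totient then (Polynomial.cyclotomic n ℤ).coeff (n.totient - j) else 0

open Polynomial in
theorem Polynomial.reverse_expand {R : Type*} [CommSemiring R] {p : ℕ} (hp : 0 < p) (f : R[X]) :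
    (expand R p f).reverse = expand R p f.reverse := by
  ext j
  rw [coeff_expand hp, coeff_reverse, natDegree_expand, coeff_expand hp, coeff_reverse]
  rcases le_or_gt j (f.natDegree * p) with hj | hj
  · rw [revAt_le hj]
    by_cases hd : p ∣ j
    · obtain ⟨k, rfl⟩ := hd
      have hk : k ≤ f.natDegree := Nat.le_of_mul_le_mul_right (by rwa [mul_comm k]) hp
      rw [mul_comm p k, ← Nat.sub_mul, if_pos (dvd_mul_left _ _), if_pos (dvd_mul_left _ _),
        Nat.mul_div_cancel _ hp, Nat.mul_div_cancel _ hp, revAt_le hk]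
    · have hd' : ¬ p ∣ f.natDegree * p - j := fun h =>
        hd ((Nat.dvd_sub_iff_right hj (dvd_mul_left _ _)).1 h)
      rw [if_neg hd, if_neg hd']
  · rw [revAt_eq_self_of_lt hj]
    split_ifs with hd
    · rw [revAt_eq_self_of_lt ((Nat.lt_div_iff_mul_lt_of_dvd hp.ne' hd).2 hj)]
    · rfl

open Polynomial in
theorem cycCoeff_eq_coeff_reverse (j n : ℕ) :
    cycCoeff j n = (cyclotomic n ℤ).reverse.coeff j := by
  rw [cycCoeff, coeff_reverse, natDegree_cyclotomic]
  split_ifs with h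
  · rw [revAt_le h]
  · rw [revAt_eq_self_of_lt (not_le.1 h), coeff_eq_zero_of_natDegree_lt]
    rw [natDegree_cyclotomic]
    exact not_le.1 h

theorem cycCoeff_zero_left (n : ℕ) : cycCoeff 0 n = 1 := by
  rw [cycCoeff_eq_coeff_reverse, Polynomial.coeff_zero_reverse]
  exact Polynomial.cyclotomic.monic n ℤ

open Polynomial in
/-- The coefficientwise form of `Φ_n(z ^ p) = Φ_{np}(z) Φ_n(z)`. -/
theorem sum_antidiagonal_cycCoeff_mul {p n : ℕ} (hp : p.Prime) (hpn : ¬ p ∣ n) (j : ℕ) :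
    ∑ x ∈ Finset.HasAntidiagonal.antidiagonal j, cycCoeff x.1 (p * n) * cycCoeff x.2 n =
      if p ∣ j then cycCoeff (j / p) n else 0 := by
  simp only [cycCoeff_eq_coeff_reverse]
  rw [← coeff_mul, ← reverse_mul_of_domain, mul_comm p n,
    ← cyclotomic_expand_eq_cyclotomic_mul hp hpn, reverse_expand hp.pos, coeff_expand hp.pos]

theorem cycCoeff_one_right :
    cycCoeff 1 1 = -1 ∧ cycCoeff 2 1 = 0 ∧ cycCoeff 3 1 = 0 := by
  simp [cycCoeff, Polynomial.coeff_one]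

/-- The leading coefficients depend only on the Möbius function of `n` and on which of the primes
`2` and `3` divide `n`. -/
theorem cycCoeff_triple_of_squarefree (n : ℕ) (hsf : Squarefree n) :
    (¬ 2 ∣ n ∧ ¬ 3 ∣ n ∧
      ((cycCoeff 1 n = -1 ∧ cycCoeff 2 n = 0 ∧ cycCoeff 3 n = 0) ∨
       (cycCoeff 1 n = 1 ∧ cycCoeff 2 n = 1 ∧ cycCoeff 3 n = 1))) ∨
    (2 ∣ n ∧ ¬ 3 ∣ n ∧
      ((cycCoeff 1 n = 1 ∧ cycCoeff 2 n = 0 ∧ cycCoeff 3 n = 0) ∨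
       (cycCoeff 1 n = -1 ∧ cycCoeff 2 n = 1 ∧ cycCoeff 3 n = -1))) ∨
    (¬ 2 ∣ n ∧ 3 ∣ n ∧
      ((cycCoeff 1 n = 1 ∧ cycCoeff 2 n = 1 ∧ cycCoeff 3 n = 0) ∨
       (cycCoeff 1 n = -1 ∧ cycCoeff 2 n = 0 ∧ cycCoeff 3 n = 1))) ∨
    (2 ∣ n ∧ 3 ∣ n ∧
      ((cycCoeff 1 n = -1 ∧ cycCoeff 2 n = 1 ∧ cycCoeff 3 n = 0) ∨
       (cycCoeff 1 n = 1 ∧ cycCoeff 2 n = 0 ∧ cycCoeff 3 n = -1))) := by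
  induction n using induction_on_primes with
  | zero => exact absurd hsf not_squarefree_zero
  | one => exact Or.inl ⟨by norm_num, by norm_num, Or.inl cycCoeff_one_right⟩
  | prime_mul p n hp ih =>
    have hpn : ¬ p ∣ n :=
      (Nat.Prime.coprime_iff_not_dvd hp).1 (Nat.squarefree_mul_iff.1 hsf).1
    have ih := ih (Nat.squarefree_mul_iff.1 hsf).2.2
    have h1 := sum_antidiagonal_cycCoeff_mul hp hpn 1
    have h2 := sum_antidiagonal_cycCoeff_mul hp hpn 2
    have h3 := sum_antidiagonal_cycCoeff_mul hp hpn 3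
    simp only [Finset.Nat.sum_antidiagonal_eq_sum_range_succ_mk, Finset.sum_range_succ,
      Finset.sum_range_zero, cycCoeff_zero_left, Nat.sub_self, Nat.sub_zero, Nat.reduceSub,
      zero_add, one_mul, mul_one] at h1 h2 h3
    rw [if_neg (fun h => hp.ne_one (Nat.dvd_one.1 h))] at h1
    rw [Nat.Prime.dvd_mul Nat.prime_two, Nat.Prime.dvd_mul Nat.prime_three,
      Nat.prime_dvd_prime_iff_eq Nat.prime_two hp, Nat.prime_dvd_prime_iff_eq Nat.prime_three hp]
    simp only [Nat.prime_dvd_prime_iff_eq hp Nat.prime_two] at h2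
    simp only [Nat.prime_dvd_prime_iff_eq hp Nat.prime_three] at h3
    by_cases hp2 : p = 2
    · subst hp2
      norm_num at h2 h3
      rcases ih with ⟨d2, d3, ⟨a, b, c⟩ | ⟨a, b, c⟩⟩ | ⟨d2, d3, ⟨a, b, c⟩ | ⟨a, b, c⟩⟩ |
          ⟨d2, d3, ⟨a, b, c⟩ | ⟨a, b, c⟩⟩ | ⟨d2, d3, ⟨a, b, c⟩ | ⟨a, b, c⟩⟩ <;>
        simp only [a, b, c] at h1 h2 h3 <;> simp [d2, d3] at hpn ⊢ <;> omega
    by_cases hp3 : p = 3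
    · subst hp3
      norm_num at h2 h3
      rcases ih with ⟨d2, d3, ⟨a, b, c⟩ | ⟨a, b, c⟩⟩ | ⟨d2, d3, ⟨a, b, c⟩ | ⟨a, b, c⟩⟩ |
          ⟨d2, d3, ⟨a, b, c⟩ | ⟨a, b, c⟩⟩ | ⟨d2, d3, ⟨a, b, c⟩ | ⟨a, b, c⟩⟩ <;>
        simp only [a, b, c] at h1 h2 h3 <;> simp [d2, d3] at hpn ⊢ <;> omega
    rw [if_neg hp2] at h2
    rw [if_neg hp3] at h3
    rcases ih with ⟨d2, d3, ⟨a, b, c⟩ | ⟨a, b, c⟩⟩ | ⟨d2, d3, ⟨a, b, c⟩ | ⟨a, b, c⟩⟩ |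
        ⟨d2, d3, ⟨a, b, c⟩ | ⟨a, b, c⟩⟩ | ⟨d2, d3, ⟨a, b, c⟩ | ⟨a, b, c⟩⟩ <;>
      simp only [a, b, c] at h1 h2 h3 <;> simp [d2, d3, Ne.symm hp2, Ne.symm hp3] <;> omega

theorem cyclotomic_leading_coeffs_squarefree (n : ℕ) (hn : 0 < n) (hsf : Squarefree n) :
    cycCoeff 0 n = 1 ∧
    (cycCoeff 1 n, cycCoeff 2 n, cycCoeff 3 n) ∈
      ({(1, 1, 1), (1, 1, 0), (1, 0, 0), (1, 0, -1),
        (-1, 1, 0), (-1, 1, -1), (-1, 0, 1), (-1, 0, 0)} : Set (ℤ × ℤ × ℤ)) := by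
  refine ⟨cycCoeff_zero_left n, ?_⟩
  rcases cycCoeff_triple_of_squarefree n hsf with
      ⟨-, -, ⟨a, b, c⟩ | ⟨a, b, c⟩⟩ | ⟨-, -, ⟨a, b, c⟩ | ⟨a, b, c⟩⟩ |
      ⟨-, -, ⟨a, b, c⟩ | ⟨a, b, c⟩⟩ | ⟨-, -, ⟨a, b, c⟩ | ⟨a, b, c⟩⟩ <;>
    simp [a, b, c]
end

section
/- Let n be a positive integer not divisible by 4. Then the value Φ_n(i) of the n-th cyclotomic polynomial at the imaginary unit i belongs to the set {-1, -1+i, -i, i, 1, 1+i} of Gaussian integers. -/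
open Polynomial in
theorem GaussianInt.prod_divisors_norm_eval_cyclotomic {n : ℕ} (hn : 0 < n) (h4 : ¬ 4 ∣ n) :
    ∏ d ∈ n.divisors, ((cyclotomic d GaussianInt).eval ⟨0, 1⟩).norm =
      ∏ d ∈ n.divisors, (if d = 1 then 2 else 1) * (if d = 2 then 2 else 1) := by
  have hprod : ∏ d ∈ n.divisors, ((cyclotomic d GaussianInt).eval ⟨0, 1⟩).norm =
      ((⟨0, 1⟩ : GaussianInt) ^ n - 1).norm := by
    have h := congrArg (fun P => (P.eval (⟨0, 1⟩ : GaussianInt)).norm)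
      (prod_cyclotomic_eq_X_pow_sub_one hn GaussianInt)
    simp only [eval_prod, eval_sub, eval_pow, eval_X, eval_one] at h
    rw [← h]
    exact (map_prod (Zsqrtd.normMonoidHom (d := -1)) _ _).symm
  have hpow : (⟨0, 1⟩ : GaussianInt) ^ n = ⟨0, 1⟩ ^ (n % 4) :=
    pow_eq_pow_mod n (by decide)
  rw [hprod, hpow, Finset.prod_mul_distrib, Finset.prod_ite_eq', Finset.prod_ite_eq']
  have hlt : n % 4 < 4 := Nat.mod_lt _ (by norm_num)
  have hr : n % 4 = 1 ∨ n % 4 = 2 ∨ n % 4 = 3 := by omega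
  rcases hr with hr | hr | hr
  · have h2 : ¬ 2 ∣ n := by omega
    simp only [hr, Nat.mem_divisors, h2, one_dvd, ne_eq, hn.ne', not_false_eq_true, and_true]
    decide
  · have h2 : 2 ∣ n := by omega
    simp only [hr, Nat.mem_divisors, h2, one_dvd, ne_eq, hn.ne', not_false_eq_true, and_true]
    decide
  · have h2 : ¬ 2 ∣ n := by omega
    simp only [hr, Nat.mem_divisors, h2, one_dvd, ne_eq, hn.ne', not_false_eq_true, and_true]
    decide

open Polynomial in
theorem GaussianInt.norm_eval_cyclotomic {n : ℕ} (hn : 0 < n) (h4 : ¬ 4 ∣ n) :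
    ((cyclotomic n GaussianInt).eval ⟨0, 1⟩).norm =
      (if n = 1 then 2 else 1) * (if n = 2 then 2 else 1) := by
  induction n using Nat.strong_induction_on with
  | _ n ih =>
    have h := prod_divisors_norm_eval_cyclotomic hn h4
    rw [← Nat.cons_self_properDivisors hn.ne', Finset.prod_cons, Finset.prod_cons,
      Finset.prod_congr rfl fun d hd => ih d (Nat.mem_properDivisors.1 hd).2
        (Nat.pos_of_mem_properDivisors hd)
        fun h => h4 (h.trans (Nat.mem_properDivisors.1 hd).1)] at h
    refine mul_right_cancel₀ (Finset.prod_ne_zero_iff.2 fun d _ => ?_) h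
    split_ifs <;> norm_num

theorem GaussianInt.eq_of_norm_eq_one {z : GaussianInt} (hz : z.norm = 1) :
    z = ⟨-1, 0⟩ ∨ z = ⟨0, -1⟩ ∨ z = ⟨0, 1⟩ ∨ z = ⟨1, 0⟩ := by
  obtain ⟨a, b⟩ := z
  simp only [Zsqrtd.norm_def] at hz
  have ha : -1 ≤ a ∧ a ≤ 1 := by constructor <;> nlinarith [mul_self_nonneg a, mul_self_nonneg b]
  have hb : -1 ≤ b ∧ b ≤ 1 := by constructor <;> nlinarith [mul_self_nonneg a, mul_self_nonneg b]
  obtain ⟨ha₁, ha₂⟩ := ha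
  obtain ⟨hb₁, hb₂⟩ := hb
  interval_cases a <;> interval_cases b <;> simp_all

theorem cyclotomic_eval_I_of_not_four_dvd (n : ℕ) (hn : 0 < n) (h4 : ¬ (4 ∣ n)) :
    (Polynomial.cyclotomic n ℂ).eval Complex.I ∈
      ({-1, -1 + Complex.I, -Complex.I, Complex.I, 1, 1 + Complex.I} : Set ℂ) := by
  by_cases h1 : n = 1
  · subst h1
    simp [sub_eq_neg_add]
  by_cases h2 : n = 2
  · subst h2
    simp [add_comm]
  have hI : Complex.I = GaussianInt.toComplex ⟨0, 1⟩ := by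
    simp [GaussianInt.toComplex_def₂, Complex.ext_iff]
  have heval := Polynomial.cyclotomic.eval_apply (⟨0, 1⟩ : GaussianInt) n GaussianInt.toComplex
  rw [← hI] at heval
  have hnorm := GaussianInt.norm_eval_cyclotomic hn h4
  rw [if_neg h1, if_neg h2, one_mul] at hnorm
  rw [heval]
  rcases GaussianInt.eq_of_norm_eq_one hnorm with h | h | h | h <;>
    simp [h, GaussianInt.toComplex_def]
end

section
/- Let n be a positive integer divisible by 4. Then Φ_n(i) = 0 if n = 4; Φ_n(i) = p if n = 4·p^j for some prime number p and positive integer j; and Φ_n(i) = 1 in all other cases. -/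
open Polynomial in
theorem Polynomial.eval_neg_one_cyclotomic_of_odd {R : Type*} [CommRing R] {m : ℕ}
    (hm : Odd m) (h1 : m ≠ 1) : (cyclotomic m R).eval (-1) = 1 := by
  induction m using Nat.strong_induction_on with
  | _ m ih =>
    have hpos : 0 < m := hm.pos
    have hprod := congrArg (eval (-1 : R)) (prod_cyclotomic_eq_geom_sum hpos R)
    rw [eval_prod, eval_geom_sum, neg_one_geom_sum, if_neg (Nat.not_even_iff_odd.mpr hm)] at hprod
    refine Eq.trans (Eq.symm ?_) hprod
    refine Finset.prod_eq_single_of_mem m (by simp [hpos.ne', h1]) fun d hd hdm => ?_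
    simp only [Finset.mem_erase, Nat.mem_divisors] at hd
    exact ih d (lt_of_le_of_ne (Nat.le_of_dvd hpos hd.2.1) hdm) (hm.of_dvd_nat hd.2.1) hd.1

open Polynomial in
theorem Polynomial.eval_neg_one_cyclotomic_two_mul {R : Type*} [CommRing R] (m : ℕ) :
    (cyclotomic (2 * m) R).eval (-1) = (cyclotomic m R).eval 1 := by
  rcases Nat.even_or_odd m with hm | hm
  · have h := congrArg (eval (-1 : R)) (cyclotomic_expand_eq_cyclotomic Nat.prime_two hm.two_dvd R)
    rw [expand_eval, neg_one_sq, mul_comm] at h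
    exact h.symm
  · by_cases h1 : m = 1
    · simp [h1]
    · have h := congrArg (eval (-1 : R)) (cyclotomic_expand_eq_cyclotomic_mul Nat.prime_two
        hm.not_two_dvd_nat R)
      rw [expand_eval, neg_one_sq, mul_comm m, eval_mul, eval_neg_one_cyclotomic_of_odd hm h1,
        mul_one] at h
      exact h.symm

open Polynomial in
theorem Polynomial.eval_I_cyclotomic_four_mul (m : ℕ) :
    (cyclotomic (4 * m) ℂ).eval Complex.I = (cyclotomic m ℂ).eval 1 := by
  have h := congrArg (eval Complex.I)
    (cyclotomic_expand_eq_cyclotomic Nat.prime_two (dvd_mul_right 2 m) ℂ)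
  rw [expand_eval, Complex.I_sq, eval_neg_one_cyclotomic_two_mul] at h
  rw [h]
  congr 2
  ring

theorem cyclotomic_eval_I_of_four_dvd (n : ℕ) (hn : 0 < n) (h4 : 4 ∣ n) :
    (n = 4 → (Polynomial.cyclotomic n ℂ).eval Complex.I = 0) ∧
    (∀ p j : ℕ, p.Prime → 0 < j → n = 4 * p ^ j →
      (Polynomial.cyclotomic n ℂ).eval Complex.I = (p : ℂ)) ∧
    (n ≠ 4 → (¬ ∃ p j : ℕ, p.Prime ∧ 0 < j ∧ n = 4 * p ^ j) →
      (Polynomial.cyclotomic n ℂ).eval Complex.I = 1) := by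
  obtain ⟨m, rfl⟩ := h4
  rw [Polynomial.eval_I_cyclotomic_four_mul]
  refine ⟨fun h => ?_, fun p j hp hj h => ?_, fun h h' => ?_⟩
  · obtain rfl : m = 1 := by omega
    simp
  · obtain rfl : m = p ^ j := by omega
    obtain ⟨k, rfl⟩ := Nat.exists_eq_succ_of_ne_zero hj.ne'
    have := Fact.mk hp
    exact Polynomial.eval_one_cyclotomic_prime_pow k
  · refine Polynomial.eval_one_cyclotomic_not_prime_pow fun {p} hp k hk => ?_
    rcases Nat.eq_zero_or_pos k with rfl | hk0
    · exact h (by rw [← hk, pow_zero, mul_one])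
    · exact h' ⟨p, k, hp, hk0, by rw [hk]⟩
end

section
/- Let n be a positive integer and d ≥ 2 a squarefree integer. Define d̂ = d if d ≡ 1 (mod 4), and d̂ = 4d if d ≡ 2 or 3 (mod 4) (so d̂ is the discriminant of ℚ(√d)). Then the n-th cyclotomic polynomial Φ_n is irreducible over the real quadratic field ℚ(√d) if and only if d̂ does not divide n. -/
open IntermediateField

/-- The `n`-th cyclotomic field inside `ℂ`. -/
noncomputable def cyclotomicSubfield (n : ℕ) : IntermediateField ℚ ℂ :=
  adjoin ℚ {x : ℂ | x ^ n = 1}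

namespace cyclotomicSubfield

theorem eq_adjoin {n : ℕ} [NeZero n] {ζ : ℂ} (hζ : IsPrimitiveRoot ζ n) :
    cyclotomicSubfield n = ℚ⟮ζ⟯ := by
  refine le_antisymm (adjoin_le_iff.2 fun x hx => ?_) (adjoin.mono _ _ _ ?_)
  · obtain ⟨i, -, rfl⟩ := hζ.eq_pow_of_pow_eq_one hx
    exact pow_mem (mem_adjoin_simple_self ℚ ζ) i
  · simpa using hζ.pow_eq_one

instance (n : ℕ) [NeZero n] : IsCyclotomicExtension {n} ℚ (cyclotomicSubfield n) := by
  have hζ := Complex.isPrimitiveRoot_exp n (NeZero.ne n)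
  exact (IntermediateField.isCyclotomicExtension_singleton_iff_eq_adjoin n ℚ ℂ _ hζ).2 (eq_adjoin hζ)

instance (n : ℕ) [NeZero n] : FiniteDimensional ℚ (cyclotomicSubfield n) :=
  IsCyclotomicExtension.finiteDimensional {n} ℚ _

theorem finrank (n : ℕ) [NeZero n] :
    Module.finrank ℚ (cyclotomicSubfield n) = n.totient :=
  IsCyclotomicExtension.finrank _ (Polynomial.cyclotomic.irreducible_rat (NeZero.pos n))

theorem mem_of_pow_eq_one {n : ℕ} {x : ℂ} (hx : x ^ n = 1) : x ∈ cyclotomicSubfield n :=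
  subset_adjoin ℚ _ hx

theorem le_of_dvd {m n : ℕ} (h : m ∣ n) : cyclotomicSubfield m ≤ cyclotomicSubfield n := by
  obtain ⟨k, rfl⟩ := h
  refine adjoin.mono _ _ _ fun x (hx : x ^ m = 1) => ?_
  simp [pow_mul, hx]

theorem sup_eq (m n : ℕ) [NeZero m] [NeZero n] :
    cyclotomicSubfield m ⊔ cyclotomicSubfield n = cyclotomicSubfield (m.lcm n) := by
  have : NeZero (m.lcm n) := ⟨Nat.lcm_ne_zero (NeZero.ne m) (NeZero.ne n)⟩
  have h (k : ℕ) [NeZero k] :=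
    (IntermediateField.isCyclotomicExtension_singleton_iff_eq_adjoin k ℚ ℂ (cyclotomicSubfield k)
      (Complex.isPrimitiveRoot_exp k (NeZero.ne k))).2
        (eq_adjoin (Complex.isPrimitiveRoot_exp k (NeZero.ne k)))
  have := h m
  have := h n
  have := h (m.lcm n)
  have := isCyclotomicExtension_lcm_sup ℚ ℂ m n (cyclotomicSubfield m) (cyclotomicSubfield n)
  exact isCyclotomicExtension_eq {m.lcm n} ℚ ℂ _ _

theorem inf_eq_bot {m n : ℕ} [NeZero m] [NeZero n] (h : m.Coprime n) :
    cyclotomicSubfield m ⊓ cyclotomicSubfield n = ⊥ := by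
  apply LinearDisjoint.inf_eq_bot
  have : NeZero (m * n) := ⟨mul_ne_zero (NeZero.ne m) (NeZero.ne n)⟩
  apply LinearDisjoint.of_finrank_sup
  rw [sup_eq, h.lcm_eq_mul, finrank, finrank, finrank, Nat.totient_mul h]

theorem totient_lcm_of_le {m n : ℕ} [NeZero m] [NeZero n]
    (h : cyclotomicSubfield m ≤ cyclotomicSubfield n) : (m.lcm n).totient = n.totient := by
  have : NeZero (m.lcm n) := ⟨Nat.lcm_ne_zero (NeZero.ne m) (NeZero.ne n)⟩
  rw [← finrank, ← finrank, ← sup_eq, sup_eq_right.2 h]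

end cyclotomicSubfield

/-- The integer `a` has a square root in the `n`-th cyclotomic field. -/
def IsCyclotomicSquare (n : ℕ) (a : ℤ) : Prop := ∃ x ∈ cyclotomicSubfield n, x ^ 2 = (a : ℂ)

namespace IsCyclotomicSquare

variable {m n : ℕ} {a b : ℤ}

theorem of_dvd (ha : IsCyclotomicSquare m a) (h : m ∣ n) : IsCyclotomicSquare n a :=
  let ⟨x, hx, e⟩ := ha
  ⟨x, cyclotomicSubfield.le_of_dvd h hx, e⟩

theorem mul (ha : IsCyclotomicSquare n a) (hb : IsCyclotomicSquare n b) :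
    IsCyclotomicSquare n (a * b) := by
  obtain ⟨x, hx, ex⟩ := ha
  obtain ⟨y, hy, ey⟩ := hb
  exact ⟨x * y, mul_mem hx hy, by rw [mul_pow, ex, ey]; push_cast; rfl⟩

theorem of_mul_right (h : IsCyclotomicSquare n (a * b)) (hb : IsCyclotomicSquare n b)
    (hb0 : b ≠ 0) : IsCyclotomicSquare n a := by
  obtain ⟨x, hx, ex⟩ := h
  obtain ⟨y, hy, ey⟩ := hb
  refine ⟨x / y, div_mem hx hy, ?_⟩
  have : (b : ℂ) ≠ 0 := mod_cast hb0
  rw [div_pow, ex, ey]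
  push_cast
  field_simp

theorem mem_of_sq_eq (ha : IsCyclotomicSquare n a) {x : ℂ} (hx : x ^ 2 = a) :
    x ∈ cyclotomicSubfield n := by
  obtain ⟨y, hy, ey⟩ := ha
  rcases sq_eq_sq_iff_eq_or_eq_neg.1 (hx.trans ey.symm) with rfl | rfl
  · exact hy
  · exact neg_mem hy

theorem isSquare_of_coprime [NeZero m] [NeZero n] (h : m.Coprime n)
    (hm : IsCyclotomicSquare m a) (hn : IsCyclotomicSquare n a) : IsSquare a := by
  obtain ⟨x, hx, ex⟩ := hm
  have hx' : x ∈ cyclotomicSubfield m ⊓ cyclotomicSubfield n := ⟨hx, hn.mem_of_sq_eq ex⟩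
  rw [cyclotomicSubfield.inf_eq_bot h, mem_bot] at hx'
  obtain ⟨r, rfl⟩ := hx'
  rw [← Rat.isSquare_intCast_iff]
  refine ⟨r, ?_⟩
  apply Rat.cast_injective (α := ℂ)
  simpa [sq] using ex.symm

theorem neg_one_four : IsCyclotomicSquare 4 (-1) :=
  ⟨Complex.I, cyclotomicSubfield.mem_of_pow_eq_one Complex.I_pow_four, by simp⟩

theorem exists_primitive_eight : ∃ ζ : ℂ, IsPrimitiveRoot ζ 8 ∧ ζ ^ 4 = -1 := by
  have h := Complex.isPrimitiveRoot_exp 8 (by norm_num)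
  refine ⟨_, h, ?_⟩
  have h2 : IsPrimitiveRoot _ 2 := h.pow (by norm_num) (show 8 = 4 * 2 by norm_num)
  exact h2.eq_neg_one_of_two_right

theorem two_eight : IsCyclotomicSquare 8 2 := by
  obtain ⟨ζ, h, h4⟩ := exists_primitive_eight
  have hm := cyclotomicSubfield.mem_of_pow_eq_one h.pow_eq_one
  refine ⟨ζ - ζ ^ 3, sub_mem hm (pow_mem hm 3), ?_⟩
  push_cast
  linear_combination (-2 + ζ ^ 2) * h4

theorem cyclotomicSubfield_four_le (h : IsCyclotomicSquare n (-1)) :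
    cyclotomicSubfield 4 ≤ cyclotomicSubfield n := by
  have h4 := Complex.isPrimitiveRoot_I
  rw [cyclotomicSubfield.eq_adjoin h4, adjoin_simple_le_iff]
  exact h.mem_of_sq_eq (by simp)

theorem cyclotomicSubfield_eight_le (h : IsCyclotomicSquare n (-1)) (h2 : IsCyclotomicSquare n 2) :
    cyclotomicSubfield 8 ≤ cyclotomicSubfield n := by
  obtain ⟨ζ, hζ, h4⟩ := exists_primitive_eight
  rw [cyclotomicSubfield.eq_adjoin hζ, adjoin_simple_le_iff]
  have hi : ζ ^ 2 ∈ cyclotomicSubfield n := h.mem_of_sq_eq (by push_cast; linear_combination h4)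
  have hs : ζ - ζ ^ 3 ∈ cyclotomicSubfield n :=
    h2.mem_of_sq_eq (by push_cast; linear_combination (-2 + ζ ^ 2) * h4)
  have h0 : (1 - ζ ^ 2) ≠ 0 := fun h0 => by
    have : ζ ^ 4 = 1 := by linear_combination (-1 - ζ ^ 2) * h0
    rw [h4] at this
    norm_num at this
  have : ζ = (ζ - ζ ^ 3) / (1 - ζ ^ 2) := by field_simp
  rw [this]
  exact div_mem hs (sub_mem (one_mem _) hi)

theorem four_dvd [NeZero n] (h : IsCyclotomicSquare n (-1)) : 4 ∣ n := by
  have ht := cyclotomicSubfield.totient_lcm_of_le h.cyclotomicSubfield_four_le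
  have hpos := Nat.totient_pos.2 (NeZero.pos n)
  by_contra h4
  rcases Nat.even_or_odd' n with ⟨m, rfl | rfl⟩
  · have hm : Nat.Coprime 2 m := (Nat.Prime.coprime_iff_not_dvd Nat.prime_two).2 (by omega)
    rw [show 4 = 2 * 2 from rfl, Nat.lcm_mul_left, hm.lcm_eq_mul,
      Nat.totient_mul_of_prime_of_dvd Nat.prime_two (Dvd.intro m rfl)] at ht
    omega
  · have hm : Nat.Coprime 4 (2 * m + 1) :=
      Nat.Coprime.pow_left 2 (Nat.coprime_two_left.2 (by simp))
    rw [hm.lcm_eq_mul, Nat.totient_mul hm, show Nat.totient 4 = 2 from rfl] at ht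
    omega

theorem eight_dvd [NeZero n] (h : IsCyclotomicSquare n (-1)) (h2 : IsCyclotomicSquare n 2) :
    8 ∣ n := by
  have ht := cyclotomicSubfield.totient_lcm_of_le (h.cyclotomicSubfield_eight_le h2)
  have hpos := Nat.totient_pos.2 (NeZero.pos n)
  obtain ⟨m, rfl⟩ := h.four_dvd
  by_contra h8
  have hm : Nat.Coprime 2 m := (Nat.Prime.coprime_iff_not_dvd Nat.prime_two).2 (by omega)
  rw [show 8 = 4 * 2 from rfl, Nat.lcm_mul_left, hm.lcm_eq_mul, mul_left_comm,
    Nat.totient_mul_of_prime_of_dvd Nat.prime_two ⟨2 * m, by ring⟩] at ht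
  omega

theorem prime (p : ℕ) [Fact p.Prime] (hp : p ≠ 2) :
    IsCyclotomicSquare p (ZMod.χ₄ p * p) := by
  have hζ := Complex.isPrimitiveRoot_exp p (NeZero.ne p)
  set χ := (quadraticChar (ZMod p)).ringHomComp (Int.castRingHom ℂ)
  set ψ := AddChar.zmodChar p hζ.pow_eq_one
  have hF : ringChar (ZMod p) ≠ 2 := by rwa [ZMod.ringChar_zmod_n]
  have h := gaussSum_sq (χ := χ) (ψ := ψ)
    ((MulChar.ringHomComp_ne_one_iff (RingHom.injective_int _)).mpr (quadraticChar_ne_one hF))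
    ((quadraticChar_isQuadratic _).comp _) (AddChar.zmodChar_primitive_of_primitive_root p hζ)
  refine ⟨gaussSum χ ψ, sum_mem fun a _ => mul_mem ?_ ?_, ?_⟩
  · exact intCast_mem _ _
  · exact pow_mem (cyclotomicSubfield.mem_of_pow_eq_one hζ.pow_eq_one) _
  · rw [h, MulChar.ringHomComp_apply, quadraticChar_neg_one hF, ZMod.card]
    simp

theorem odd (m : ℕ) (hm : Odd m) : IsCyclotomicSquare m (ZMod.χ₄ m * m) := by
  induction m using induction_on_primes with
  | zero => simp at hm
  | one => exact ⟨1, one_mem _, by simp⟩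
  | prime_mul p a hp ih =>
    have : Fact p.Prime := ⟨hp⟩
    obtain ⟨h1, h2⟩ := Nat.odd_mul.1 hm
    have := ((prime p (by rintro rfl; exact absurd h1 (by decide))).of_dvd (Dvd.intro a rfl)).mul
      ((ih h2).of_dvd (Dvd.intro_left p rfl))
    convert this using 1
    push_cast
    rw [map_mul]
    ring

theorem natCast_of_odd (hm : Odd m) (hmn : m ∣ n) (h : IsCyclotomicSquare n (-1)) :
    IsCyclotomicSquare n m := by
  have := (odd m hm).of_dvd hmn
  rw [ZMod.χ₄_nat_eq_if_mod_four, if_neg (by rcases hm with ⟨k, rfl⟩; omega)] at this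
  split_ifs at this
  · simpa using this
  · simpa using this.mul h

theorem natCast_of_four_mul_dvd {k : ℕ} (hk : Squarefree k) (h : 4 * k ∣ n) :
    IsCyclotomicSquare n k := by
  have hi := neg_one_four.of_dvd ((Dvd.intro k rfl).trans h)
  rcases Nat.even_or_odd' k with ⟨m, rfl | rfl⟩
  · have hm : Odd m := by
      rw [← Nat.not_even_iff_odd]
      rintro ⟨l, rfl⟩
      exact absurd (hk 2 ⟨l, by ring⟩) (by decide)
    push_cast
    exact (two_eight.of_dvd ((Dvd.intro m (by ring)).trans h)).mul
      (natCast_of_odd hm ((Dvd.intro_left 8 (by ring)).trans h) hi)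
  · exact natCast_of_odd ⟨m, rfl⟩ ((Dvd.intro_left 4 rfl).trans h) hi

theorem prime_dvd [NeZero n] {D p : ℕ} (hD : Squarefree D) (h : IsCyclotomicSquare n D)
    (hp : p.Prime) (hp2 : p ≠ 2) (hpD : p ∣ D) : p ∣ n := by
  obtain ⟨k, rfl⟩ := hpD
  by_contra hpn
  have : Fact p.Prime := ⟨hp⟩
  have hk0 : k ≠ 0 := by rintro rfl; simp at hD
  have : NeZero (8 * k * n) := ⟨by simp [hk0, NeZero.ne n]⟩
  have hco : p.Coprime (8 * k * n) := by
    refine .mul_right (.mul_right ?_ (Nat.coprime_of_squarefree_mul hD))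
      ((Nat.Prime.coprime_iff_not_dvd hp).2 hpn)
    exact Nat.Coprime.pow_right 3 ((Nat.coprime_primes hp Nat.prime_two).2 hp2)
  have hi : IsCyclotomicSquare (8 * k * n) (-1) := neg_one_four.of_dvd ⟨2 * k * n, by ring⟩
  have hk : IsCyclotomicSquare (8 * k * n) k :=
    natCast_of_four_mul_dvd hD.of_mul_right ⟨2 * n, by ring⟩
  have hpN : IsCyclotomicSquare (8 * k * n) p := by
    refine of_mul_right ?_ hk (mod_cast hk0)
    exact_mod_cast h.of_dvd (Dvd.intro_left _ rfl)
  have hsq : ∀ ε : ℤ, IsUnit ε → ¬ IsSquare (ε * p) := fun ε hε hs => by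
    obtain ⟨r, hr⟩ := hs
    have := congrArg Int.natAbs hr
    rw [Int.natAbs_mul, Int.isUnit_iff_natAbs_eq.1 hε, Int.natAbs_mul, one_mul,
      Int.natAbs_natCast] at this
    exact hp.prime.irreducible.not_isSquare ⟨_, this⟩
  have hpp := prime p hp2
  rw [ZMod.χ₄_nat_eq_if_mod_four, if_neg (by have := hp.eq_two_or_odd; omega)] at hpp
  split_ifs at hpp
  · exact hsq 1 isUnit_one (hpp.isSquare_of_coprime hco (by simpa using hpN))
  · exact hsq (-1) isUnit_one.neg (hpp.isSquare_of_coprime hco (by simpa using hpN.mul hi))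

theorem dvd_of_odd [NeZero n] {D m : ℕ} (hD : Squarefree D) (h : IsCyclotomicSquare n D)
    (hm : Odd m) (hmD : m ∣ D) : m ∣ n := by
  rw [← Nat.prod_primeFactors_of_squarefree (hD.squarefree_of_dvd hmD)]
  refine Finset.prod_primes_dvd n (fun p hp => (Nat.prime_of_mem_primeFactors hp).prime)
    fun p hp => ?_
  have hpm := Nat.dvd_of_mem_primeFactors hp
  refine h.prime_dvd hD (Nat.prime_of_mem_primeFactors hp) ?_ (hpm.trans hmD)
  rintro rfl
  exact absurd (hm.of_dvd_nat hpm) (by decide)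

theorem iff_discr_dvd [NeZero n] {D : ℕ} (hD : Squarefree D) :
    IsCyclotomicSquare n D ↔ (if D % 4 = 1 then D else 4 * D) ∣ n := by
  have h0 : D % 4 ≠ 0 := fun h0 => absurd (hD 2 (Nat.dvd_of_mod_eq_zero h0)) (by decide)
  rcases Nat.even_or_odd' D with ⟨m, rfl | hDm⟩
  · have hm : Odd m := by
      rw [Nat.odd_iff]
      omega
    rw [if_neg (by omega)]
    refine ⟨fun h => ?_, fun h => natCast_of_four_mul_dvd hD h⟩
    have : NeZero (Nat.lcm 4 n) := ⟨Nat.lcm_ne_zero (by norm_num) (NeZero.ne n)⟩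
    have hmn := h.dvd_of_odd hD hm (Dvd.intro_left 2 rfl)
    have hn := Nat.dvd_lcm_right 4 n
    have hi := neg_one_four.of_dvd (Nat.dvd_lcm_left 4 n)
    have h2 : IsCyclotomicSquare (Nat.lcm 4 n) 2 :=
      of_mul_right (mod_cast h.of_dvd hn) (natCast_of_odd hm (hmn.trans hn) hi)
        (mod_cast hm.pos.ne')
    have h8 : 8 ∣ n := by
      have hl := hi.eight_dvd h2
      by_cases h4 : 4 ∣ n
      · rwa [Nat.lcm_eq_right h4] at hl
      · have h4n := hl.trans (Nat.lcm_dvd_mul 4 n)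
        have h2n := hl.trans (Nat.lcm_dvd (show 4 ∣ 2 * n by omega) (Dvd.intro_left 2 rfl))
        omega
    rw [← mul_assoc]
    exact Nat.Coprime.mul_dvd_of_dvd_of_dvd
      (Nat.Coprime.pow_left 3 (Nat.coprime_two_left.2 hm)) h8 hmn
  · have hodd : Odd D := ⟨m, hDm⟩
    have key := odd D hodd
    rw [ZMod.χ₄_nat_eq_if_mod_four, if_neg (by omega)] at key
    split_ifs at key ⊢ with h1
    · exact ⟨fun h => h.dvd_of_odd hD hodd dvd_rfl, fun h => by simpa using key.of_dvd h⟩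
    · refine ⟨fun h => ?_, fun h => ?_⟩
      · have hDn := h.dvd_of_odd hD hodd dvd_rfl
        have hi : IsCyclotomicSquare n (-1) :=
          of_mul_right (key.of_dvd hDn) h (mod_cast hodd.pos.ne')
        exact Nat.Coprime.mul_dvd_of_dvd_of_dvd
          (Nat.Coprime.pow_left 2 (Nat.coprime_two_left.2 hodd)) hi.four_dvd hDn
      · exact natCast_of_odd hodd ((Dvd.intro_left 4 rfl).trans h)
          (neg_one_four.of_dvd ((Dvd.intro _ rfl).trans h))

end IsCyclotomicSquare

theorem finrank_adjoin_sqrt {F L : Type*} [Field F] [Field L] [Algebra F L] {s : L} {e : F}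
    (hs : s ^ 2 = algebraMap F L e) (hF : s ∉ (algebraMap F L).range) :
    Module.finrank F F⟮s⟯ = 2 := by
  have hint : IsIntegral F s := ⟨Polynomial.X ^ 2 - Polynomial.C e,
    Polynomial.monic_X_pow_sub_C e two_ne_zero, by simp [hs]⟩
  rw [adjoin.finrank hint]
  refine le_antisymm ?_ ((minpoly.two_le_natDegree_iff hint).2 hF)
  rw [← Polynomial.natDegree_X_pow_sub_C (n := 2) (r := e)]
  exact Polynomial.natDegree_le_of_dvd (minpoly.dvd F s (by simp [hs]))
    (Polynomial.X_pow_sub_C_ne_zero two_pos e)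

/-- `Φ_n` is irreducible exactly when a primitive `n`-th root of unity has degree `φ(n)`. -/
theorem irreducible_cyclotomic_iff_finrank {F L : Type*} [Field F] [Field L] [Algebra F L] {n : ℕ}
    (hn : 0 < n) {ζ : L} (hζ : IsPrimitiveRoot ζ n) :
    Irreducible (Polynomial.cyclotomic n F) ↔ Module.finrank F F⟮ζ⟯ = n.totient := by
  have hroot : Polynomial.aeval ζ (Polynomial.cyclotomic n F) = 0 := by
    rw [Polynomial.aeval_def, Polynomial.eval₂_eq_eval_map, Polynomial.map_cyclotomic]
    exact hζ.isRoot_cyclotomic hn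
  have hmonic := Polynomial.cyclotomic.monic n F
  have hint : IsIntegral F ζ := ⟨_, hmonic, hroot⟩
  rw [adjoin.finrank hint]
  constructor
  · intro h
    rw [← minpoly.eq_of_irreducible_of_monic h hroot hmonic, Polynomial.natDegree_cyclotomic]
  · intro h
    rw [Polynomial.eq_of_monic_of_dvd_of_natDegree_le (minpoly.monic hint) hmonic
      (minpoly.dvd F ζ hroot) (by rw [h, Polynomial.natDegree_cyclotomic])]
    exact minpoly.irreducible hint

theorem irreducible_cyclotomic_adjoin_iff {n : ℕ} [NeZero n] {e : ℚ} {s : ℂ}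
    (hs : s ^ 2 = e) (hsQ : s ∉ (⊥ : IntermediateField ℚ ℂ)) :
    Irreducible (Polynomial.cyclotomic n ℚ⟮s⟯) ↔ s ∉ cyclotomicSubfield n := by
  have hζ := Complex.isPrimitiveRoot_exp n (NeZero.ne n)
  set ζ := Complex.exp (2 * Real.pi * Complex.I / n)
  rw [irreducible_cyclotomic_iff_finrank (NeZero.pos n) hζ]
  have hpos := Nat.totient_pos.2 (NeZero.pos n)
  have h2 : Module.finrank ℚ ℚ⟮s⟯ = 2 := finrank_adjoin_sqrt (e := e) (by simpa using hs) hsQ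
  have hdeg : 2 * Module.finrank ℚ⟮s⟯ ℚ⟮s⟯⟮ζ⟯ =
      Module.finrank ℚ ↥(cyclotomicSubfield n ⊔ ℚ⟮s⟯) := by
    rw [cyclotomicSubfield.eq_adjoin hζ, sup_comm, ← restrictScalars_adjoin_eq_sup, ← h2]
    exact Module.finrank_mul_finrank ℚ ℚ⟮s⟯ ℚ⟮s⟯⟮ζ⟯
  by_cases h : s ∈ cyclotomicSubfield n
  · rw [sup_eq_left.2 (adjoin_simple_le_iff.2 h), cyclotomicSubfield.finrank] at hdeg
    exact iff_of_false (by omega) (not_not.2 h)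
  · refine iff_of_true ?_ h
    have hC : Module.finrank (cyclotomicSubfield n) (cyclotomicSubfield n)⟮s⟯ = 2 :=
      finrank_adjoin_sqrt (e := algebraMap ℚ _ e) (by simpa using hs) (by
        rintro ⟨x, rfl⟩
        exact h x.2)
    have := Module.finrank_mul_finrank ℚ (cyclotomicSubfield n) (cyclotomicSubfield n)⟮s⟯
    rw [hC, cyclotomicSubfield.finrank] at this
    rw [← restrictScalars_adjoin_eq_sup] at hdeg
    have h3 : Module.finrank ℚ (restrictScalars ℚ (cyclotomicSubfield n)⟮s⟯) = n.totient * 2 :=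
      this.symm
    have := hdeg.trans h3
    omega

theorem cyclotomic_irreducible_over_real_quadratic (n : ℕ) (hn : 0 < n)
    (d : ℤ) (hd2 : 2 ≤ d) (hdsf : Squarefree d) :
    Irreducible
        (Polynomial.cyclotomic n (IntermediateField.adjoin ℚ {Real.sqrt (d : ℝ)})) ↔
      ¬ ((if d % 4 = 1 then d else 4 * d) ∣ (n : ℤ)) := by
  have : NeZero n := ⟨hn.ne'⟩
  lift d to ℕ using by omega
  have hD : Squarefree d := Int.squarefree_natCast.1 hdsf
  set s : ℂ := ((Real.sqrt d : ℝ) : ℂ)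
  have hs : s ^ 2 = (d : ℂ) := by
    rw [← Complex.ofReal_pow, Real.sq_sqrt d.cast_nonneg, Complex.ofReal_natCast]
  have hsQ : s ∉ (⊥ : IntermediateField ℚ ℂ) := by
    rintro ⟨r, hr⟩
    have hsq : IsSquare d := by
      rw [← Rat.isSquare_natCast_iff]
      refine ⟨r, Rat.cast_injective (α := ℂ) ?_⟩
      rw [Rat.cast_natCast, ← hs, ← hr]
      simp [sq]
    obtain ⟨r, rfl⟩ := hsq
    have := Nat.isUnit_iff.1 (hD r dvd_rfl)
    subst this
    norm_num at hd2
  have hmem : s ∈ cyclotomicSubfield n ↔ IsCyclotomicSquare n d :=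
    ⟨fun h => ⟨s, h, by simpa using hs⟩, fun h => h.mem_of_sq_eq (by simpa using hs)⟩
  let f : ℝ →ₐ[ℚ] ℂ := Complex.ofRealAm.restrictScalars ℚ
  have hmap : (adjoin ℚ {Real.sqrt d}).map f = ℚ⟮s⟯ := by
    rw [adjoin_map, Set.image_singleton]
    rfl
  let e : adjoin ℚ {Real.sqrt d} ≃+* ℚ⟮s⟯ :=
    ((equivMap _ f).trans (equivOfEq hmap)).toRingEquiv
  have hirr : Irreducible (Polynomial.cyclotomic n (adjoin ℚ {Real.sqrt d})) ↔
      Irreducible (Polynomial.cyclotomic n ℚ⟮s⟯) := by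
    rw [← MulEquiv.irreducible_iff (Polynomial.mapEquiv e), Polynomial.mapEquiv_apply,
      Polynomial.map_cyclotomic]
  have hdvd : (if (d : ℤ) % 4 = 1 then (d : ℤ) else 4 * d) ∣ (n : ℤ) ↔
      (if d % 4 = 1 then d else 4 * d) ∣ n := by
    rw [← Int.natCast_dvd_natCast]
    split_ifs <;> first | omega | push_cast; rfl
  rw [hdvd, ← IsCyclotomicSquare.iff_discr_dvd hD, ← hmem,
    ← irreducible_cyclotomic_adjoin_iff (e := d) (by simpa using hs) hsQ]
  exact hirr
end

section
/- Let r be a rational number with N(r) ≥ 2, and let P be the unique monic integer polynomial of degree φ(2N(r))/2 satisfying Φ_{2N(r)}(z) = z^{φ(2N(r))/2} · P(z + z^{-1}) for all nonzero complex z. Then P is the minimal polynomial over ℚ of the real algebraic number 2·(-1)^{1 + r·N(r)}·cos(π·r). In particular, the degree of cos(π·r) over ℚ equals φ(2N(r))/2. -/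
/-- Passing from `z` to `z + z⁻¹` at most halves the degree. -/
theorem minpoly_natDegree_le_two_mul_add_inv {F K : Type*} [Field F] [Field K] [Algebra F K]
    {z : K} (hz : z ≠ 0) (hint : IsIntegral F (z + z⁻¹)) :
    (minpoly F z).natDegree ≤ 2 * (minpoly F (z + z⁻¹)).natDegree := by
  set Q := minpoly F (z + z⁻¹)
  set d := Q.natDegree
  let R : Polynomial F := ∑ i ∈ Finset.range (d + 1),
    Polynomial.C (Q.coeff i) * (Polynomial.X ^ 2 + 1) ^ i * Polynomial.X ^ (d - i)
  have heval : R.eval 0 = 1 := by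
    have hlead : Q.coeff d = 1 := minpoly.monic hint
    simp only [R, Finset.sum_range_succ, Polynomial.eval_add, Polynomial.eval_finsetSum]
    rw [Finset.sum_eq_zero]
    · simp [hlead]
    · intro i hi
      have : d - i ≠ 0 := by have := Finset.mem_range.mp hi; omega
      simp [this]
  have hne : R ≠ 0 := by
    intro h
    simp [h] at heval
  have hroot : Polynomial.aeval z R = 0 := by
    have h0 : Polynomial.aeval (z + z⁻¹) Q = 0 := minpoly.aeval _ _
    rw [Polynomial.aeval_eq_sum_range] at h0
    have : Polynomial.aeval z R = z ^ d * ∑ i ∈ Finset.range (d + 1),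
        Q.coeff i • (z + z⁻¹) ^ i := by
      simp only [R, map_sum, Finset.mul_sum]
      refine Finset.sum_congr rfl fun i hi => ?_
      have hle : i ≤ d := by have := Finset.mem_range.mp hi; omega
      have hsq : z ^ 2 + 1 = z * (z + z⁻¹) := by field_simp
      have hpow : z ^ d = z ^ i * z ^ (d - i) := by rw [← pow_add]; congr 1; omega
      simp only [map_mul, map_pow, map_add, map_one, Polynomial.aeval_C, Polynomial.aeval_X,
        Algebra.smul_def]
      rw [hsq, hpow, mul_pow]
      ring
    rw [this, h0, mul_zero]
  have hdeg : R.natDegree ≤ 2 * d := by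
    refine Polynomial.natDegree_sum_le_of_forall_le _ _ fun i hi => ?_
    have hle : i ≤ d := by have := Finset.mem_range.mp hi; omega
    have : (Polynomial.C (Q.coeff i) * (Polynomial.X ^ 2 + 1) ^ i *
        Polynomial.X ^ (d - i)).natDegree ≤ i * 2 + (d - i) := by
      compute_degree
    omega
  exact (Polynomial.natDegree_le_of_dvd (minpoly.dvd F z hroot) hne).trans hdeg

/-- Scaling by a nonzero element of the base field preserves the degree. -/
theorem minpoly_natDegree_algebraMap_mul {F K : Type*} [Field F] [Field K] [Algebra F K]
    {c : F} (hc : c ≠ 0) {x : K} (hx : IsIntegral F x) :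
    (minpoly F (algebraMap F K c * x)).natDegree = (minpoly F x).natDegree := by
  have hadj : IntermediateField.adjoin F {algebraMap F K c * x} =
      IntermediateField.adjoin F {x} := by
    apply le_antisymm <;> rw [IntermediateField.adjoin_simple_le_iff]
    · exact mul_mem (IntermediateField.algebraMap_mem _ c)
        (IntermediateField.mem_adjoin_simple_self F x)
    · have hmem := mul_mem
        (IntermediateField.algebraMap_mem (IntermediateField.adjoin F {algebraMap F K c * x}) c⁻¹)
        (IntermediateField.mem_adjoin_simple_self F (algebraMap F K c * x))
      rwa [← mul_assoc, ← map_mul, inv_mul_cancel₀ hc, map_one, one_mul] at hmem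
  rw [← IntermediateField.adjoin.finrank hx,
    ← IntermediateField.adjoin.finrank (isIntegral_algebraMap.mul hx), hadj]

/-- `2 (-1) ^ (1 + p) cos (π p / q)` is the trace `z + z⁻¹` of a primitive `2q`-th root of unity,
for `p / q` in lowest terms. -/
theorem exists_isPrimitiveRoot_add_inv_eq_two_cos_pi_rat (r : ℚ) :
    ∃ z : ℂ, IsPrimitiveRoot z (2 * r.den) ∧
      ((2 * (-1 : ℝ) ^ (1 + r.num) * Real.cos (Real.pi * (r : ℝ)) : ℝ) : ℂ) = z + z⁻¹ := by
  have hq : (r.den : ℂ) ≠ 0 := by exact_mod_cast r.den_nz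
  have hcop : IsCoprime r.num (r.den : ℤ) :=
    Int.isCoprime_iff_gcd_eq_one.mpr (by simpa [Int.gcd] using r.reduced)
  set m : ℤ := r.num + (1 + r.num) * r.den with hm
  have hodd : IsCoprime m 2 := by
    rw [Int.isCoprime_two_right]
    rcases Int.even_or_odd r.num with hp | hp
    · have hd : Odd (r.den : ℤ) := by
        by_contra h
        rw [Int.not_odd_iff_even] at h
        exact absurd (hcop.isUnit_of_dvd' hp.two_dvd h.two_dvd) (by decide)
      exact hp.add_odd ((odd_one.add_even hp).mul hd)
    · exact hp.add_even ((odd_one.add_odd hp).mul_right _)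
  have hm2 : IsCoprime m (2 * r.den : ℕ) := by
    push_cast
    exact hodd.mul_right (hcop.add_mul_right_left _)
  set ζ : ℂ := Complex.exp (2 * Real.pi * Complex.I / (2 * r.den : ℕ)) with hζ
  have hprim : IsPrimitiveRoot ζ (2 * r.den) :=
    Complex.isPrimitiveRoot_exp _ (by have := r.den_nz; omega)
  refine ⟨ζ ^ m, hprim.zpow_of_gcd_eq_one m (Int.isCoprime_iff_gcd_eq_one.mp hm2), ?_⟩
  have hz : ζ ^ m = (-1 : ℂ) ^ (1 + r.num) * Complex.exp (Real.pi * r * Complex.I) := by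
    rw [hζ, ← Complex.exp_int_mul, ← Complex.exp_pi_mul_I, ← Complex.exp_int_mul,
      ← Complex.exp_add]
    congr 1
    have hr : (r : ℂ) = r.num / r.den := Rat.cast_def r
    rw [hr, hm]
    push_cast
    field_simp
    ring
  have hsign : ((-1 : ℂ) ^ (1 + r.num))⁻¹ = (-1) ^ (1 + r.num) := by
    rw [← inv_zpow]; norm_num
  rw [hz, mul_inv, hsign, ← Complex.exp_neg]
  push_cast
  rw [Complex.cos]
  ring_nf

theorem minpoly_two_cos_pi_rat (r : ℚ) (hr : 2 ≤ r.den) (P : Polynomial ℤ)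
    (hmonic : P.Monic) (hdeg : P.natDegree = (2 * r.den).totient / 2)
    (hP : ∀ z : ℂ, z ≠ 0 →
      (Polynomial.cyclotomic (2 * r.den) ℂ).eval z =
        z ^ ((2 * r.den).totient / 2) * Polynomial.aeval (z + z⁻¹) P) :
    minpoly ℚ (2 * (-1 : ℝ) ^ (1 + r.num) * Real.cos (Real.pi * (r : ℝ))) =
      P.map (algebraMap ℤ ℚ) ∧
    (minpoly ℚ (Real.cos (Real.pi * (r : ℝ)))).natDegree = (2 * r.den).totient / 2 := by
  obtain ⟨z, hprim, hz⟩ := exists_isPrimitiveRoot_add_inv_eq_two_cos_pi_rat r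
  set a : ℝ := 2 * (-1 : ℝ) ^ (1 + r.num) * Real.cos (Real.pi * (r : ℝ)) with ha
  have hpos : 0 < 2 * r.den := by omega
  have hz0 : z ≠ 0 := hprim.ne_zero hpos.ne'
  have hrootC : Polynomial.aeval (a : ℂ) P = 0 := by
    have h := hP z hz0
    rw [(hprim.isRoot_cyclotomic hpos).eq_zero, ← hz] at h
    exact (mul_eq_zero.mp h.symm).resolve_left (pow_ne_zero _ hz0)
  have hroot : Polynomial.aeval a P = 0 := by
    rw [← Complex.coe_algebraMap, Polynomial.aeval_algebraMap_apply] at hrootC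
    exact (map_eq_zero _).mp hrootC
  have hmonic' : (P.map (algebraMap ℤ ℚ)).Monic := hmonic.map _
  have hroot' : Polynomial.aeval a (P.map (algebraMap ℤ ℚ)) = 0 := by
    rwa [Polynomial.aeval_map_algebraMap]
  have hint : IsIntegral ℚ a := ⟨_, hmonic', hroot'⟩
  have hmin : minpoly ℚ (a : ℂ) = minpoly ℚ a :=
    minpoly.algebraMap_eq (algebraMap ℝ ℂ).injective a
  have hle : (2 * r.den).totient ≤ 2 * (minpoly ℚ a).natDegree := by
    rw [← hmin, hz, ← Polynomial.natDegree_cyclotomic (2 * r.den) ℚ,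
      Polynomial.cyclotomic_eq_minpoly_rat hprim hpos]
    refine minpoly_natDegree_le_two_mul_add_inv hz0 ?_
    rw [← hz]
    exact hint.map (IsScalarTower.toAlgHom ℚ ℝ ℂ)
  have heq : minpoly ℚ a = P.map (algebraMap ℤ ℚ) := by
    refine (Polynomial.eq_of_monic_of_dvd_of_natDegree_le (minpoly.monic hint) hmonic'
      (minpoly.dvd ℚ a hroot') ?_).symm
    rw [hmonic.natDegree_map, hdeg]
    omega
  refine ⟨heq, ?_⟩
  have hc : (2 * (-1 : ℚ) ^ (1 + r.num))⁻¹ ≠ 0 :=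
    inv_ne_zero (mul_ne_zero two_ne_zero (zpow_ne_zero _ (by norm_num)))
  have hcos : Real.cos (Real.pi * (r : ℝ)) =
      algebraMap ℚ ℝ (2 * (-1 : ℚ) ^ (1 + r.num))⁻¹ * a := by
    have h1 : (-1 : ℝ) ^ (1 + r.num) ≠ 0 := zpow_ne_zero _ (by norm_num)
    rw [ha, eq_ratCast]
    push_cast
    field_simp
  rw [hcos, minpoly_natDegree_algebraMap_mul hc hint, heq, hmonic.natDegree_map, hdeg]
end

section
/- For every odd integer n ≥ 3, the identity 2·Σ_{1 ≤ j < n/2, gcd(j,n)=1} (-1)^j · cos(π·j/n) = μ(n) holds, where the sum ranges over those integers j with 1 ≤ j < n/2 that are coprime to n, and μ denotes the Möbius function. -/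
/-- Sorting the residues modulo `n` by the reduced denominator of `j / n`. -/
theorem sum_range_eq_sum_divisors_coprime {M : Type*} [AddCommMonoid M] {n : ℕ} (hn : n ≠ 0)
    (f : ℕ → ℕ → M) (hf : ∀ d e k, d * e = n → f (d * e) (k * e) = f d k) :
    ∑ j ∈ Finset.range n, f n j =
      ∑ d ∈ n.divisors, ∑ k ∈ Finset.range d with Nat.Coprime k d, f d k := by
  rw [← Finset.sum_fiberwise_of_maps_to (s := Finset.range n) (t := n.divisors)
    (g := fun j => n / j.gcd n)
    (fun j _ => Nat.mem_divisors.2 ⟨Nat.div_dvd_of_dvd (Nat.gcd_dvd_right j n), hn⟩)]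
  refine Finset.sum_congr rfl fun d hd => ?_
  obtain ⟨⟨e, rfl⟩, -⟩ := Nat.mem_divisors.1 hd
  have hd0 : 0 < d := Nat.pos_of_ne_zero (left_ne_zero_of_mul hn)
  have he0 : 0 < e := Nat.pos_of_ne_zero (right_ne_zero_of_mul hn)
  refine (Finset.sum_bij (fun k _ => k * e) ?_ ?_ ?_ ?_).symm
  · intro k hk
    simp only [Finset.mem_filter, Finset.mem_range] at hk ⊢
    refine ⟨Nat.mul_lt_mul_of_pos_right hk.1 he0, ?_⟩
    rw [Nat.gcd_mul_right, hk.2.gcd_eq_one, one_mul, Nat.mul_div_cancel _ he0]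
  · intro a _ b _ h
    exact Nat.eq_of_mul_eq_mul_right he0 h
  · intro j hj
    simp only [Finset.mem_filter, Finset.mem_range] at hj
    obtain ⟨hj, hg⟩ := hj
    have hge : j.gcd (d * e) = e := by
      have h := Nat.div_mul_cancel (Nat.gcd_dvd_right j (d * e))
      rw [hg] at h
      exact Nat.eq_of_mul_eq_mul_left hd0 h
    obtain ⟨k, rfl⟩ : e ∣ j := hge ▸ Nat.gcd_dvd_left j (d * e)
    rw [mul_comm e k] at hj hge
    refine ⟨k, ?_, mul_comm k e⟩
    simp only [Finset.mem_filter, Finset.mem_range]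
    refine ⟨Nat.lt_of_mul_lt_mul_right hj, ?_⟩
    rw [Nat.gcd_mul_right] at hge
    exact Nat.eq_of_mul_eq_mul_right he0 (by rw [hge, one_mul])
  · intro k _
    exact (hf d e k rfl).symm

theorem sum_range_neg_one_pow_mul_cos {n : ℕ} (hodd : Odd n) (hn : n ≠ 1) :
    ∑ j ∈ Finset.range n, (-1 : ℝ) ^ j * Real.cos (Real.pi * j / n) = 0 := by
  have hn1 : 1 < n := by have := hodd.pos; omega
  have hn0 : (n : ℂ) ≠ 0 := by exact_mod_cast hodd.pos.ne'
  set w : ℂ := -Complex.exp ((Real.pi / n : ℝ) * Complex.I) with hw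
  have hwn : w ^ n = 1 := by
    rw [hw, hodd.neg_pow, ← Complex.exp_nat_mul]
    have : (n : ℂ) * ((Real.pi / n : ℝ) * Complex.I) = Real.pi * Complex.I := by
      push_cast
      field_simp
    rw [this, Complex.exp_pi_mul_I, neg_neg]
  have hw1 : w ≠ 1 := by
    intro h
    have him := congrArg Complex.im h
    rw [hw, Complex.neg_im, Complex.exp_ofReal_mul_I_im, Complex.one_im, neg_eq_zero] at him
    have hpos : 0 < Real.pi / n := div_pos Real.pi_pos (by exact_mod_cast hodd.pos)
    have hlt : Real.pi / n < Real.pi := div_lt_self Real.pi_pos (by exact_mod_cast hn1)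
    exact (Real.sin_pos_of_pos_of_lt_pi hpos hlt).ne' him
  have hsum : ∑ j ∈ Finset.range n, w ^ j = 0 := by
    rw [geom_sum_eq hw1, hwn, sub_self, zero_div]
  have hre := congrArg Complex.re hsum
  rw [Complex.re_sum, Complex.zero_re] at hre
  rw [← hre]
  refine Finset.sum_congr rfl fun j _ => ?_
  have harg : (j : ℂ) * ((Real.pi / n : ℝ) * Complex.I) =
      (Real.pi * j / n : ℝ) * Complex.I := by
    push_cast
    ring
  have hsign : ((-1 : ℂ)) ^ j = (((-1 : ℝ) ^ j : ℝ) : ℂ) := by push_cast; rfl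
  rw [hw, neg_pow (Complex.exp _), ← Complex.exp_nat_mul, harg, hsign, Complex.re_ofReal_mul,
    Complex.exp_ofReal_mul_I_re]

theorem sum_coprime_neg_one_pow_mul_cos {n : ℕ} (hodd : Odd n) :
    ∑ j ∈ Finset.range n with Nat.Coprime j n, (-1 : ℝ) ^ j * Real.cos (Real.pi * j / n) =
      (ArithmeticFunction.moebius n : ℝ) := by
  have key := (ArithmeticFunction.sum_eq_iff_sum_mul_moebius_eq_on (R := ℝ)
    (f := fun d => ∑ k ∈ Finset.range d with Nat.Coprime k d,
      (-1 : ℝ) ^ k * Real.cos (Real.pi * k / d))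
    (g := fun m => if m = 1 then 1 else 0) {m | Odd m}
    (fun m d hmd hd => Odd.of_dvd_nat hd hmd)).1 ?_ n hodd.pos hodd
  · rw [← key, Finset.sum_eq_single (n, 1)]
    · simp
    · rintro ⟨a, b⟩ hab hne
      have hb : b ≠ 1 := by
        rintro rfl
        have := (Nat.mem_divisorsAntidiagonal.1 hab).1
        simp_all
      simp [hb]
    · intro h
      exact absurd (Nat.mem_divisorsAntidiagonal.2 ⟨mul_one n, hodd.pos.ne'⟩) h
  · intro m hm hmodd
    have hmodd : Odd m := hmodd
    rw [← sum_range_eq_sum_divisors_coprime hm.ne'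
      (fun d k => (-1 : ℝ) ^ k * Real.cos (Real.pi * k / d))]
    · by_cases h1 : m = 1
      · subst h1
        simp
      · rw [sum_range_neg_one_pow_mul_cos hmodd h1, if_neg h1]
    · rintro d e k rfl
      have he : Odd e := (Nat.odd_mul.1 hmodd).2
      have he0 : (e : ℝ) ≠ 0 := by exact_mod_cast he.pos.ne'
      rw [mul_comm k e, pow_mul, he.neg_one_pow, mul_comm e k]
      push_cast
      rw [← mul_assoc, mul_div_mul_right _ _ he0]

theorem cos_sum_eq_moebius (n : ℕ) (hn : 3 ≤ n) (hodd : Odd n) :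
    2 * ∑ j ∈ (Finset.range n).filter (fun j => 1 ≤ j ∧ 2 * j < n ∧ Nat.Coprime j n),
        (-1 : ℝ) ^ j * Real.cos (Real.pi * j / n) =
      (ArithmeticFunction.moebius n : ℝ) := by
  have hpos : ∀ j, Nat.Coprime j n → 1 ≤ j := by
    intro j hj
    by_contra! h
    obtain rfl : j = 0 := by omega
    rw [Nat.coprime_zero_left] at hj
    omega
  have hn0 : (n : ℝ) ≠ 0 := by exact_mod_cast hodd.pos.ne'
  rw [← sum_coprime_neg_one_pow_mul_cos hodd,
    ← Finset.sum_filter_add_sum_filter_not ((Finset.range n).filter (Nat.Coprime · n))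
      (fun j => 2 * j < n), two_mul,
    Finset.filter_filter, Finset.filter_filter]
  congr 1
  · refine Finset.sum_congr (Finset.filter_congr fun j _ => ?_) fun _ _ => rfl
    exact ⟨fun h => ⟨h.2.2, h.2.1⟩, fun h => ⟨hpos j h.1, h.2, h.1⟩⟩
  · refine Finset.sum_nbij' (fun j => n - j) (fun j => n - j) ?_ ?_ ?_ ?_ ?_
    · intro j hj
      simp only [Finset.mem_filter, Finset.mem_range] at hj ⊢
      exact ⟨by omega, (Nat.coprime_self_sub_left hj.1.le).2 hj.2.2.2, by omega⟩
    · intro j hj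
      simp only [Finset.mem_filter, Finset.mem_range] at hj ⊢
      have := hpos j hj.2.1
      obtain ⟨m, hm⟩ := hodd
      exact ⟨by omega, by omega, by omega, (Nat.coprime_self_sub_left hj.1.le).2 hj.2.1⟩
    · intro j hj
      simp only [Finset.mem_filter, Finset.mem_range] at hj
      omega
    · intro j hj
      simp only [Finset.mem_filter, Finset.mem_range] at hj
      omega
    · intro j hj
      simp only [Finset.mem_filter, Finset.mem_range] at hj
      have hsign : (-1 : ℝ) ^ (n - j) = -(-1) ^ j := by
        rcases Nat.even_or_odd j with h | h
        · rw [h.neg_one_pow, (Nat.Odd.sub_even hj.1.le hodd h).neg_one_pow]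
        · rw [h.neg_one_pow, (Nat.Odd.sub_odd hodd h).neg_one_pow, neg_neg]
      have harg : Real.pi * ((n - j : ℕ) : ℝ) / n = Real.pi - Real.pi * j / n := by
        rw [Nat.cast_sub hj.1.le]
        field_simp
      rw [hsign, harg, Real.cos_pi_sub, neg_mul_neg]
end

section
/- Let r be a rational number with 0 ≤ r ≤ 1. Then the number (1/π)·arccos(√r) is rational if and only if 4r ∈ {0, 1, 2, 3, 4}, i.e., if and only if r ∈ {0, 1/4, 1/2, 3/4, 1}. -/
theorem Real.arccos_sqrt_cos_sq {θ : ℝ} (hθ₀ : 0 ≤ θ) (hθ₁ : θ ≤ Real.pi / 2) :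
    Real.arccos (Real.sqrt (Real.cos θ ^ 2)) = θ := by
  rw [Real.sqrt_sq (Real.cos_nonneg_of_neg_pi_div_two_le_of_le (by linarith) hθ₁),
    Real.arccos_cos hθ₀ (by linarith [Real.pi_pos])]

theorem Real.cos_two_mul_arccos_sqrt {x : ℝ} (h0 : 0 ≤ x) (h1 : x ≤ 1) :
    Real.cos (2 * Real.arccos (Real.sqrt x)) = 2 * x - 1 := by
  rw [Real.cos_two_mul, Real.cos_arccos (by linarith [Real.sqrt_nonneg x])
    (Real.sqrt_le_one.mpr h1), Real.sq_sqrt h0]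

theorem arccos_sqrt_rational_iff (r : ℚ) (h0 : 0 ≤ r) (h1 : r ≤ 1) :
    (∃ q : ℚ, (1 / Real.pi) * Real.arccos (Real.sqrt (r : ℝ)) = (q : ℝ)) ↔
      r ∈ ({0, 1/4, 1/2, 3/4, 1} : Set ℚ) := by
  have hpi := Real.pi_pos
  simp only [Set.mem_insert_iff, Set.mem_singleton_iff]
  constructor
  · rintro ⟨q, hq⟩
    have hcos := Real.cos_two_mul_arccos_sqrt (x := (r : ℝ)) (by exact_mod_cast h0)
      (by exact_mod_cast h1)
    have hangle : ∃ s : ℚ, 2 * Real.arccos (Real.sqrt (r : ℝ)) = s * Real.pi := by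
      refine ⟨2 * q, ?_⟩
      push_cast
      rw [← hq]
      field_simp
    have hniven := niven hangle ⟨2 * r - 1, by rw [hcos]; push_cast; ring⟩
    rw [hcos] at hniven
    simp only [Set.mem_insert_iff, Set.mem_singleton_iff] at hniven
    have hcast : ∀ c : ℚ, (2 * (r : ℝ) - 1 = c) → r = (c + 1) / 2 := fun c hc => by
      have : 2 * r - 1 = c := by exact_mod_cast hc
      linarith
    rcases hniven with h | h | h | h | h
    · have := hcast (-1) (by rw [h]; norm_num)
      norm_num [this]
    · have := hcast (-1 / 2) (by rw [h]; norm_num)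
      norm_num [this]
    · have := hcast 0 (by rw [h]; norm_num)
      norm_num [this]
    · have := hcast (1 / 2) (by rw [h]; norm_num)
      norm_num [this]
    · have := hcast 1 (by rw [h]; norm_num)
      norm_num [this]
  · have key : ∀ q : ℚ, 0 ≤ q → q ≤ 1 / 2 → (r : ℝ) = Real.cos (q * Real.pi) ^ 2 →
        ∃ q : ℚ, (1 / Real.pi) * Real.arccos (Real.sqrt (r : ℝ)) = (q : ℝ) := by
      intro q hq₀ hq₁ hr
      have hq₀' : (0 : ℝ) ≤ q := by exact_mod_cast hq₀
      have hq₁' : (q : ℝ) ≤ 1 / 2 := by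
        have : (q : ℝ) ≤ ((1 / 2 : ℚ) : ℝ) := by exact_mod_cast hq₁
        simpa using this
      refine ⟨q, ?_⟩
      rw [hr, Real.arccos_sqrt_cos_sq (by positivity) (by nlinarith)]
      field_simp
    rintro (rfl | rfl | rfl | rfl | rfl)
    · refine key (1 / 2) (by norm_num) (by norm_num) ?_
      rw [show ((1 / 2 : ℚ) : ℝ) * Real.pi = Real.pi / 2 by push_cast; ring, Real.cos_pi_div_two]
      norm_num
    · refine key (1 / 3) (by norm_num) (by norm_num) ?_
      rw [show ((1 / 3 : ℚ) : ℝ) * Real.pi = Real.pi / 3 by push_cast; ring, Real.cos_pi_div_three]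
      norm_num
    · refine key (1 / 4) (by norm_num) (by norm_num) ?_
      rw [show ((1 / 4 : ℚ) : ℝ) * Real.pi = Real.pi / 4 by push_cast; ring, Real.cos_pi_div_four,
        div_pow, Real.sq_sqrt (by norm_num)]
      norm_num
    · refine key (1 / 6) (by norm_num) (by norm_num) ?_
      rw [show ((1 / 6 : ℚ) : ℝ) * Real.pi = Real.pi / 6 by push_cast; ring, Real.cos_pi_div_six,
        div_pow, Real.sq_sqrt (by norm_num)]
      norm_num
    · exact key 0 (by norm_num) (by norm_num) (by simp)
end
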